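/- arXiv:1101.2951 — 3 statements merged into one kernel-verified Lean document; each statement's English description precedes it below -/
import Mathlib

section
/- For every natural number n, s(73²·n) − 73·s(n) = 24·r₁(n) + 24·r₂(n) + 12·r₃(n) + 12·r₄(n) − 48·r₅(n) − 48·r₆(n) − 24·r₇(n) − 24·r₈(n), where rᵢ(n) is the number of triples (x,y,z) ∈ ℤ³ satisfying, respectively: r₁: 31x²+5y²+11z²+yz−14zx+6xy = n; r₂: 15x²+14y²+10z²+7yz+4zx+16xy = n; r₃: 11x²+7y²+20z²+7yz+2zx+4xy = n; r₄: 7x²+11y²+21z²+11yz+2zx+4xy = n; r₅: 31x²+20y²+44z²+4yz−28zx+12xy = n; r₆: 15x²+56y²+40z²+28yz+8zx+32xy = n; r₇: 11x²+28y²+80z²+28yz+4zx+8xy = n; r₈: 7x²+44y²+84z²+44yz+4zx+8xy = n. -/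
/-- Number of representations of `n` as a sum of three integer squares. -/
noncomputable def s (n : ℕ) : ℕ :=
  Set.ncard {v : ℤ × ℤ × ℤ | v.1 ^ 2 + v.2.1 ^ 2 + v.2.2 ^ 2 = (n : ℤ)}

/-- Number of representations of `n` by the ternary form
`a x² + b y² + c z² + d yz + e zx + f xy`. -/
noncomputable def R (a b c d e f : ℤ) (n : ℕ) : ℕ :=
  Set.ncard {v : ℤ × ℤ × ℤ |
    a * v.1 ^ 2 + b * v.2.1 ^ 2 + c * v.2.2 ^ 2 + d * v.2.1 * v.2.2 +
      e * v.2.2 * v.1 + f * v.1 * v.2.1 = (n : ℤ)}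

open Complex Real Matrix

/-- The additive character `z ↦ exp (2πiz)`. -/
noncomputable def expTwoPiI (z : ℂ) : ℂ := cexp (2 * π * I * z)

lemma expTwoPiI_add (z w : ℂ) : expTwoPiI (z + w) = expTwoPiI z * expTwoPiI w := by
  rw [expTwoPiI, mul_add, Complex.exp_add]; rfl

lemma expTwoPiI_int (n : ℤ) : expTwoPiI n = 1 := by
  rw [expTwoPiI, mul_comm]; exact Complex.exp_int_mul_two_pi_mul_I n

lemma norm_expTwoPiI (z : ℂ) : ‖expTwoPiI z‖ = rexp (-(2 * π * z.im)) := by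
  rw [expTwoPiI, Complex.norm_exp]; simp

lemma expTwoPiI_add_int (z : ℂ) (n : ℤ) : expTwoPiI (z + n) = expTwoPiI z := by
  rw [expTwoPiI_add, expTwoPiI_int, mul_one]

/-- Inductive description, through completing squares, of a positive definite quadratic form
`Q` on `ℝⁿ`, of the form `Q'` on the dual space such that the Gaussian of `Q'` is
the Fourier transform of the Gaussian of `Q`, and of the determinant of the bilinear form
`Q (x + y) - Q x - Q y`. -/
inductive GaussianDual : (n : ℕ) → ((Fin n → ℝ) → ℝ) → ((Fin n → ℝ) → ℝ) → ℝ → Prop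
  | zero : GaussianDual 0 (fun _ => 0) (fun _ => 0) 1
  | succ {n : ℕ} {Q Q' : (Fin n → ℝ) → ℝ} {D : ℝ} (β : ℝ) (hβ : 0 < β) (μ : Fin n → ℝ)
      (h : GaussianDual n Q Q' D) :
      GaussianDual (n + 1)
        (fun v => β * (v 0 + μ ⬝ᵥ Fin.tail v) ^ 2 + Q (Fin.tail v))
        (fun w => (w 0) ^ 2 / (4 * β) + Q' (Fin.tail w - w 0 • μ)) (2 * β * D)

/-- Gaussian sums of `Q` over all translates of the integral lattice are uniformly bounded. -/
def UniformGaussianSum {n : ℕ} (Q : (Fin n → ℝ) → ℝ) : Prop :=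
  ∀ y : ℝ, 0 < y → ∃ C : ENNReal, C ≠ ⊤ ∧ ∀ s : Fin n → ℝ,
    ∑' x : Fin n → ℤ, ENNReal.ofReal (rexp (-y * Q ((fun i => (x i : ℝ)) + s))) ≤ C

lemma summable_gaussian_int {y : ℝ} (hy : 0 < y) :
    Summable fun n : ℤ => rexp (-y * (n : ℝ) ^ 2) := by
  have h := (summable_jacobiTheta₂_term_iff 0 ((y / π : ℝ) * I)).2 (by simp; positivity)
  refine h.norm.congr fun n => ?_
  rw [norm_jacobiTheta₂_term]
  simp
  field_simp

lemma exists_gaussian_int_bound {y : ℝ} (hy : 0 < y) : ∃ C : ENNReal, C ≠ ⊤ ∧ ∀ t : ℝ,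
    ∑' n : ℤ, ENNReal.ofReal (rexp (-y * ((n : ℝ) + t) ^ 2)) ≤ C := by
  have hs : Summable fun n : ℤ => rexp y * rexp (-(y / 2) * (n : ℝ) ^ 2) :=
    (summable_gaussian_int (half_pos hy)).mul_left _
  refine ⟨∑' n : ℤ, ENNReal.ofReal (rexp y * rexp (-(y / 2) * (n : ℝ) ^ 2)), hs.tsum_ofReal_ne_top,
    fun t => ?_⟩
  rw [← (Equiv.subRight ⌊t⌋).tsum_eq]
  refine ENNReal.tsum_le_tsum fun n => ENNReal.ofReal_le_ofReal ?_
  rw [← Real.exp_add]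
  apply Real.exp_le_exp.2
  have h1 := Int.fract_nonneg t
  have h2 := Int.fract_lt_one t
  have h3 : (((Equiv.subRight ⌊t⌋) n : ℤ) : ℝ) + t = n + Int.fract t := by
    simp only [Equiv.subRight_apply, Int.cast_sub]
    linarith [Int.floor_add_fract t]
  rw [h3]
  nlinarith [sq_nonneg ((n : ℝ) + 2 * Int.fract t), mul_nonneg hy.le (sq_nonneg ((n : ℝ) + 2 * Int.fract t)), mul_nonneg hy.le (sub_nonneg.2 (show Int.fract t ^ 2 ≤ 1 by nlinarith))]

lemma tsum_fin_succ {M : Type*} [AddCommMonoid M] [TopologicalSpace M] {n : ℕ}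
    (f : (Fin (n + 1) → ℤ) → M) :
    ∑' x, f x = ∑' p : ℤ × (Fin n → ℤ), f (Fin.cons p.1 p.2) :=
  ((Fin.consEquiv fun _ => ℤ).tsum_eq f).symm

lemma GaussianDual.uniform {n : ℕ} {Q Q' : (Fin n → ℝ) → ℝ} {D : ℝ} (h : GaussianDual n Q Q' D) :
    UniformGaussianSum Q ∧ UniformGaussianSum Q' := by
  induction h with
  | zero => exact ⟨fun y _ => ⟨1, by simp⟩, fun y _ => ⟨1, by simp⟩⟩
  | @succ n Q Q' D β hβ μ h ih =>
    constructor
    · intro y hy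
      obtain ⟨C, hC, hb⟩ := ih.1 y hy
      obtain ⟨C', hC', hb'⟩ := exists_gaussian_int_bound (mul_pos hy hβ)
      refine ⟨C' * C, ENNReal.mul_ne_top hC' hC, fun s => ?_⟩
      rw [tsum_fin_succ, ENNReal.tsum_prod', ENNReal.tsum_comm]
      calc _ = ∑' x : Fin n → ℤ,
            (∑' k : ℤ, ENNReal.ofReal (rexp (-(y * β) * ((k : ℝ) + (s 0 + μ ⬝ᵥ ((fun i => (x i : ℝ)) + Fin.tail s))) ^ 2))) *
            ENNReal.ofReal (rexp (-y * Q ((fun i => (x i : ℝ)) + Fin.tail s))) := by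
              refine tsum_congr fun x => ?_
              rw [← ENNReal.tsum_mul_right]
              refine tsum_congr fun k => ?_
              rw [← ENNReal.ofReal_mul (by positivity), ← Real.exp_add]
              congr 2
              have : Fin.tail ((fun i => ((Fin.cons k x : Fin (n + 1) → ℤ) i : ℝ)) + s) =
                (fun i => (x i : ℝ)) + Fin.tail s := by ext i; simp [Fin.tail]
              dsimp only
              rw [this]; simp; ring
        _ ≤ ∑' x : Fin n → ℤ, C' *
            ENNReal.ofReal (rexp (-y * Q ((fun i => (x i : ℝ)) + Fin.tail s))) := by
              gcongr; exact hb' _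
        _ ≤ _ := by
              rw [ENNReal.tsum_mul_left]; gcongr; exact hb _
    · intro y hy
      obtain ⟨C, hC, hb⟩ := ih.2 y hy
      obtain ⟨C', hC', hb'⟩ := exists_gaussian_int_bound (div_pos hy (by positivity : 0 < 4 * β))
      refine ⟨C' * C, ENNReal.mul_ne_top hC' hC, fun s => ?_⟩
      rw [tsum_fin_succ, ENNReal.tsum_prod']
      calc _ = ∑' k : ℤ, ENNReal.ofReal (rexp (-(y / (4 * β)) * ((k : ℝ) + s 0) ^ 2)) *
            ∑' x : Fin n → ℤ,
            ENNReal.ofReal (rexp (-y * Q' ((fun i => (x i : ℝ)) + (Fin.tail s - ((k : ℝ) + s 0) • μ)))) := by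
              refine tsum_congr fun x => ?_
              rw [← ENNReal.tsum_mul_left]
              refine tsum_congr fun k => ?_
              rw [← ENNReal.ofReal_mul (by positivity), ← Real.exp_add]
              congr 2
              have : Fin.tail ((fun i => ((Fin.cons x k : Fin (n + 1) → ℤ) i : ℝ)) + s) =
                (fun i => (k i : ℝ)) + Fin.tail s := by ext i; simp [Fin.tail]
              dsimp only
              rw [this, add_sub_assoc]; simp; ring
        _ ≤ ∑' k : ℤ, ENNReal.ofReal (rexp (-(y / (4 * β)) * ((k : ℝ) + s 0) ^ 2)) * C := by
              gcongr; exact hb _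
        _ ≤ _ := by
              rw [ENNReal.tsum_mul_right]; gcongr; exact hb' _

lemma UniformGaussianSum.summable {n : ℕ} {Q : (Fin n → ℝ) → ℝ} (h : UniformGaussianSum Q)
    {y : ℝ} (hy : 0 < y) (s : Fin n → ℝ) :
    Summable fun x : Fin n → ℤ => rexp (-y * Q ((fun i => (x i : ℝ)) + s)) := by
  obtain ⟨C, hC, hb⟩ := h y hy
  have := ENNReal.summable_toReal (ne_top_of_le_ne_top hC (hb s))
  exact this.congr fun x => by rw [ENNReal.toReal_ofReal (by positivity)]

lemma tsum_gaussian_int {β : ℝ} (hβ : 0 < β) {τ : ℂ} (hτ : 0 < τ.im) (s z : ℝ) :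
    ∑' n : ℤ, expTwoPiI (τ * (β * ((n : ℝ) + s) ^ 2 : ℝ) + (z * (n + s) : ℝ)) =
      ((-I * τ) ^ (1 / 2 : ℂ))⁻¹ * ((√(2 * β) : ℝ) : ℂ)⁻¹ *
        ∑' m : ℤ, expTwoPiI (-((((m : ℝ) - z) ^ 2 / (4 * β) : ℝ) : ℂ) / τ + (m * s : ℝ)) := by
  have hτ0 : τ ≠ 0 := fun h => by simp [h] at hτ
  have hβ0 : (β : ℂ) ≠ 0 := by exact_mod_cast hβ.ne'
  set t : ℂ := 2 * β * τ with ht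
  have ht0 : t ≠ 0 := by rw [ht]; exact mul_ne_zero (mul_ne_zero two_ne_zero hβ0) hτ0
  have hc : (-I * t) ^ (1 / 2 : ℂ) = (√(2 * β) : ℝ) * (-I * τ) ^ (1 / 2 : ℂ) := by
    have : -I * t = ((2 * β : ℝ) : ℂ) * (-I * τ) := by rw [ht]; push_cast; ring
    have hne : -I * τ ≠ 0 := mul_ne_zero (neg_ne_zero.2 I_ne_zero) hτ0
    rw [this, Complex.cpow_def_of_ne_zero (mul_ne_zero (by exact_mod_cast (by positivity : 2 * β ≠ 0)) hne),
      Complex.log_ofReal_mul (by positivity) hne, add_mul, Complex.exp_add,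
      ← Complex.cpow_def_of_ne_zero hne, Real.sqrt_eq_rpow, Real.rpow_def_of_pos (by positivity)]
    push_cast
    rfl
  have h := jacobiTheta₂_functional_equation (z + t * s) t
  have h1 : ∀ n : ℤ, expTwoPiI (τ * (β * ((n : ℝ) + s) ^ 2 : ℝ) + (z * (n + s) : ℝ)) =
      cexp (π * I * (t * s ^ 2 + 2 * z * s)) * jacobiTheta₂_term n (z + t * s) t := by
    intro n
    rw [expTwoPiI, jacobiTheta₂_term, ← Complex.exp_add, ht]
    congr 1; push_cast; ring
  have h2 : ∀ m : ℤ, expTwoPiI (-((((m : ℝ) - z) ^ 2 / (4 * β) : ℝ) : ℂ) / τ + (m * s : ℝ)) =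
      cexp (-π * I * z ^ 2 / t) * jacobiTheta₂_term m ((z + t * s) / t) (-1 / t) := by
    intro n
    rw [expTwoPiI, jacobiTheta₂_term, ← Complex.exp_add, ht]
    congr 1; push_cast; field_simp; ring
  simp_rw [h1, h2, tsum_mul_left]
  change _ * jacobiTheta₂ _ _ = _ * (_ * jacobiTheta₂ _ _)
  rw [h, hc, one_div, mul_inv]
  have h3 : cexp (-π * I * z ^ 2 / t) = cexp (π * I * (t * s ^ 2 + 2 * z * s)) *
      cexp (-π * I * (z + t * s) ^ 2 / t) := by
    rw [← Complex.exp_add]; congr 1; field_simp; ring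
  rw [h3]; ring

lemma UniformGaussianSum.summable_expTwoPiI {n : ℕ} {Q : (Fin n → ℝ) → ℝ}
    (h : UniformGaussianSum Q) {τ : ℂ} (hτ : 0 < τ.im) (s : Fin n → ℝ) (r : (Fin n → ℤ) → ℝ) :
    Summable fun x : Fin n → ℤ => expTwoPiI (τ * Q ((fun i => (x i : ℝ)) + s) + (r x : ℝ)) := by
  refine .of_norm ((h.summable (y := 2 * π * τ.im) (by positivity) s).congr fun x => ?_)
  rw [norm_expTwoPiI]
  congr 1
  simp
  ring

lemma im_neg_inv_pos {τ : ℂ} (hτ : 0 < τ.im) : 0 < (-τ⁻¹).im := by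
  have : τ ≠ 0 := fun h => by simp [h] at hτ
  simp only [neg_im, inv_im, neg_div, neg_neg]
  exact div_pos hτ (Complex.normSq_pos.2 this)

set_option maxHeartbeats 800000 in
theorem GaussianDual.tsum_eq {n : ℕ} {Q Q' : (Fin n → ℝ) → ℝ} {D : ℝ} (h : GaussianDual n Q Q' D)
    {τ : ℂ} (hτ : 0 < τ.im) (s z : Fin n → ℝ) :
    ∑' x : Fin n → ℤ, expTwoPiI (τ * Q ((fun i => (x i : ℝ)) + s) +
        (z ⬝ᵥ ((fun i => (x i : ℝ)) + s) : ℝ)) =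
      ((-I * τ) ^ (1 / 2 : ℂ))⁻¹ ^ n * ((√D : ℝ) : ℂ)⁻¹ *
        ∑' m : Fin n → ℤ, expTwoPiI (-(Q' ((fun i => (m i : ℝ)) - z) : ℂ) / τ +
          ((fun i => (m i : ℝ)) ⬝ᵥ s : ℝ)) := by
  induction h with
  | zero => simp [expTwoPiI]
  | @succ n Q Q' D β hβ μ h ih =>
    have hu := h.uniform
    have hu' := (h.succ β hβ μ).uniform
    have hτ' := im_neg_inv_pos hτ
    set X : (Fin n → ℤ) → Fin n → ℝ := fun x i => (x i : ℝ) with hX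
    set S : (Fin n → ℤ) → ℝ := fun x => s 0 + μ ⬝ᵥ (X x + Fin.tail s) with hS
    set G : ℤ → ℂ := fun m => expTwoPiI (-((((m : ℝ) - z 0) ^ 2 / (4 * β) : ℝ) : ℂ) / τ +
      (m * s 0 : ℝ)) with hG
    set z' : ℤ → Fin n → ℝ := fun m => Fin.tail z + ((m : ℝ) - z 0) • μ with hz'
    have e : ∀ (k : ℤ) (x : Fin n → ℤ) (s : Fin (n + 1) → ℝ),
        Fin.tail ((fun i => ((Fin.cons k x : Fin (n + 1) → ℤ) i : ℝ)) + s) =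
          X x + Fin.tail s := fun k x s => by ext i; simp [Fin.tail, hX]
    have d : ∀ (k : ℤ) (x : Fin n → ℤ) (s z : Fin (n + 1) → ℝ),
        z ⬝ᵥ ((fun i => ((Fin.cons k x : Fin (n + 1) → ℤ) i : ℝ)) + s) =
          z 0 * (k + s 0) + Fin.tail z ⬝ᵥ (X x + Fin.tail s) := fun k x s z => by
      simp [dotProduct, Fin.sum_univ_succ, Fin.tail, hX]
    have hA : ∀ (k : ℤ) (x : Fin n → ℤ), expTwoPiI
        (τ * ((β * (((fun i => ((Fin.cons k x : Fin (n + 1) → ℤ) i : ℝ)) + s) 0 +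
          μ ⬝ᵥ Fin.tail ((fun i => ((Fin.cons k x : Fin (n + 1) → ℤ) i : ℝ)) + s)) ^ 2 +
          Q (Fin.tail ((fun i => ((Fin.cons k x : Fin (n + 1) → ℤ) i : ℝ)) + s)) : ℝ) : ℂ) +
          (z ⬝ᵥ ((fun i => ((Fin.cons k x : Fin (n + 1) → ℤ) i : ℝ)) + s) : ℝ)) =
        expTwoPiI (τ * (β * ((k : ℝ) + S x) ^ 2 : ℝ) + (z 0 * (k + S x) : ℝ)) *
          expTwoPiI (τ * Q (X x + Fin.tail s) +
            ((Fin.tail z - z 0 • μ) ⬝ᵥ (X x + Fin.tail s) : ℝ)) := fun k x => by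
      rw [← expTwoPiI_add, e, d, sub_dotProduct, smul_dotProduct]
      congr 1
      simp [hS]
      ring
    have hB : ∀ (k : ℤ) (x : Fin n → ℤ), expTwoPiI
        (-(((((fun i => ((Fin.cons k x : Fin (n + 1) → ℤ) i : ℝ)) - z) 0) ^ 2 / (4 * β) +
          Q' (Fin.tail ((fun i => ((Fin.cons k x : Fin (n + 1) → ℤ) i : ℝ)) - z) -
          ((fun i => ((Fin.cons k x : Fin (n + 1) → ℤ) i : ℝ)) - z) 0 • μ) : ℝ) : ℂ) / τ +
          ((fun i => ((Fin.cons k x : Fin (n + 1) → ℤ) i : ℝ)) ⬝ᵥ s : ℝ)) =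
        G k * expTwoPiI (-(Q' (X x - z' k) : ℂ) / τ + (X x ⬝ᵥ Fin.tail s : ℝ)) := fun k x => by
      have d' := d k x 0 s
      have e' := e k x (-z)
      have e'' : Fin.tail (-z) = -Fin.tail z := rfl
      have e0 : Fin.tail (0 : Fin (n + 1) → ℝ) = 0 := rfl
      rw [add_zero, e0, add_zero] at d'
      rw [← sub_eq_add_neg, e''] at e'
      rw [← expTwoPiI_add, e', dotProduct_comm, d', dotProduct_comm (X x)]
      congr 1
      simp only [hz', Pi.sub_apply, Fin.cons_zero, sub_eq_add_neg, add_assoc, neg_add,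
        Pi.zero_apply]
      push_cast
      ring
    have hl : Summable fun p : (Fin n → ℤ) × ℤ => _ :=
      (Equiv.summable_iff ((Equiv.prodComm (Fin n → ℤ) ℤ).trans (Fin.consEquiv fun _ => ℤ))).2
        (hu'.1.summable_expTwoPiI hτ s (fun x => z ⬝ᵥ ((fun i => (x i : ℝ)) + s)))
    have hr := (Equiv.summable_iff (Fin.consEquiv fun _ => ℤ)).2
        (hu'.2.summable_expTwoPiI hτ' (-z) (fun m => (fun i => (m i : ℝ)) ⬝ᵥ s))
    replace hl : Summable fun p : (Fin n → ℤ) × ℤ =>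
        expTwoPiI (τ * (β * ((p.2 : ℝ) + S p.1) ^ 2 : ℝ) + (z 0 * (p.2 + S p.1) : ℝ)) *
          expTwoPiI (τ * Q (X p.1 + Fin.tail s) +
            ((Fin.tail z - z 0 • μ) ⬝ᵥ (X p.1 + Fin.tail s) : ℝ)) :=
      hl.congr fun p => hA p.2 p.1
    replace hr : Summable fun p : ℤ × (Fin n → ℤ) =>
        G p.1 * expTwoPiI (-(Q' (X p.2 - z' p.1) : ℂ) / τ + (X p.2 ⬝ᵥ Fin.tail s : ℝ)) := by
      refine hr.congr fun p => ?_
      rw [← hB]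
      simp only [Function.comp_apply, Fin.consEquiv_apply, ← sub_eq_add_neg, div_eq_mul_inv]
      congr 1
      ring
    have hm : Summable fun p : ℤ × (Fin n → ℤ) =>
        G p.1 * expTwoPiI (τ * Q (X p.2 + Fin.tail s) + (z' p.1 ⬝ᵥ (X p.2 + Fin.tail s) : ℝ)) := by
      have h1 : Summable fun m : ℤ => ‖G m‖ := by
        have hy : 0 < 2 * π * (-τ⁻¹).im / (4 * β) := by positivity
        obtain ⟨C, hC, hb⟩ := exists_gaussian_int_bound hy
        refine (ENNReal.summable_toReal (ne_top_of_le_ne_top hC (hb (-z 0)))).congr fun m => ?_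
        rw [ENNReal.toReal_ofReal (by positivity), hG, norm_expTwoPiI, neg_div, div_eq_mul_inv _ τ,
          add_im, ofReal_im, neg_im, neg_im, im_ofReal_mul, ← sub_eq_add_neg]
        congr 1
        ring
      have h2 := (hu.1.summable_expTwoPiI hτ (Fin.tail s) (fun _ => 0)).norm
      refine .of_norm ((h1.mul_of_nonneg h2 (fun _ => norm_nonneg _) (fun _ => norm_nonneg _)).congr
        fun p => ?_)
      simp [norm_expTwoPiI, hX]
    rw [tsum_fin_succ, tsum_fin_succ, ← (Equiv.prodComm (Fin n → ℤ) ℤ).tsum_eq]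
    simp only [Equiv.prodComm_apply, Prod.fst_swap, Prod.snd_swap, hA, hB]
    rw [hl.tsum_prod, hr.tsum_prod]
    simp_rw [tsum_mul_right, tsum_mul_left, tsum_gaussian_int hβ hτ]
    calc _ = ((-I * τ) ^ (1 / 2 : ℂ))⁻¹ * ((√(2 * β) : ℝ) : ℂ)⁻¹ *
          ∑' x : Fin n → ℤ, ∑' m : ℤ, G m *
            expTwoPiI (τ * Q (X x + Fin.tail s) + (z' m ⬝ᵥ (X x + Fin.tail s) : ℝ)) := by
          rw [← tsum_mul_left]
          refine tsum_congr fun x => ?_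
          rw [mul_assoc, ← tsum_mul_right]
          congr 1
          refine tsum_congr fun m => ?_
          rw [hG, ← expTwoPiI_add, ← expTwoPiI_add]
          congr 1
          simp [hS, hz', add_dotProduct, sub_dotProduct]
          ring
      _ = _ := by
          rw [hm.tsum_comm]
          have hc : ∀ m : ℤ, ∑' x : Fin n → ℤ, G m *
              expTwoPiI (τ * Q (X x + Fin.tail s) + (z' m ⬝ᵥ (X x + Fin.tail s) : ℝ)) =
              ((-I * τ) ^ (1 / 2 : ℂ))⁻¹ ^ n * ((√D : ℝ) : ℂ)⁻¹ * (G m * ∑' x : Fin n → ℤ,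
                expTwoPiI (-(Q' (X x - z' m) : ℂ) / τ + (X x ⬝ᵥ Fin.tail s : ℝ))) := fun m => by
            rw [tsum_mul_left, ih]
            ring
          rw [tsum_congr hc, tsum_mul_left, Real.sqrt_mul (x := 2 * β) (by positivity) D, ofReal_mul, mul_inv,
            pow_succ]
          ring

/-- The integral ternary quadratic form `a x² + b y² + c z² + d yz + e zx + f xy`. -/
structure TernaryForm where
  (a b c d e f : ℤ)

namespace TernaryForm

/-- The orthogonal sum of a ternary form and the unary form `g t²`. -/
def extend (T : TernaryForm) (g : ℤ) {A : Type*} [CommRing A] (v : Fin 4 → A) : A :=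
  T.a * v 0 ^ 2 + T.b * v 1 ^ 2 + T.c * v 2 ^ 2 + T.d * v 1 * v 2 + T.e * v 2 * v 0 +
    T.f * v 0 * v 1 + g * v 3 ^ 2

/-- Half the determinant of the Hessian matrix of a ternary form. -/
def disc (T : TernaryForm) : ℤ :=
  4 * T.a * T.b * T.c + T.d * T.e * T.f - T.a * T.d ^ 2 - T.b * T.e ^ 2 - T.c * T.f ^ 2

/-- `T` is a positive definite ternary form of square discriminant whose Hessian matrix has an
inverse equal to the Hessian matrix of `T'` divided by `4 * M`. -/
structure IsLevel (T T' : TernaryForm) (M : ℕ) : Prop where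
  pos : 0 < M
  pos_one : 0 < T.a
  pos_two : 0 < 4 * T.a * T.b - T.f ^ 2
  pos_disc : 0 < T.disc
  square : IsSquare T.disc
  mul11 : 2 * T.a * (2 * T'.a) + T.f * T'.f + T.e * T'.e = 4 * M
  mul12 : 2 * T.a * T'.f + T.f * (2 * T'.b) + T.e * T'.d = 0
  mul13 : 2 * T.a * T'.e + T.f * T'.d + T.e * (2 * T'.c) = 0
  mul21 : T.f * (2 * T'.a) + 2 * T.b * T'.f + T.d * T'.e = 0
  mul22 : T.f * T'.f + 2 * T.b * (2 * T'.b) + T.d * T'.d = 4 * M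
  mul23 : T.f * T'.e + 2 * T.b * T'.d + T.d * (2 * T'.c) = 0
  mul31 : T.e * (2 * T'.a) + T.d * T'.f + 2 * T.c * T'.e = 0
  mul32 : T.e * T'.f + T.d * (2 * T'.b) + 2 * T.c * T'.d = 0
  mul33 : T.e * T'.e + T.d * T'.d + 2 * T.c * (2 * T'.c) = 4 * M

/-- The gradient of the extended form. -/
def gradient (T : TernaryForm) (g : ℤ) {A : Type*} [CommRing A] (v : Fin 4 → A) : Fin 4 → A :=
  ![2 * T.a * v 0 + T.f * v 1 + T.e * v 2, T.f * v 0 + 2 * T.b * v 1 + T.d * v 2,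
    T.e * v 0 + T.d * v 1 + 2 * T.c * v 2, 2 * g * v 3]

lemma dotProduct_gradient (T : TernaryForm) (g : ℤ) {A : Type*} [CommRing A] (v : Fin 4 → A) :
    v ⬝ᵥ T.gradient g v = 2 * T.extend g v := by
  simp [dotProduct, Fin.sum_univ_four, gradient, extend]
  ring

lemma extend_smul (T : TernaryForm) (g : ℤ) {A : Type*} [CommRing A] (r : A) (v : Fin 4 → A) :
    T.extend g (r • v) = r ^ 2 * T.extend g v := by
  simp [extend]; ring

lemma extend_map (T : TernaryForm) (g : ℤ) {A B : Type*} [CommRing A] [CommRing B] (φ : A →+* B)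
    (v : Fin 4 → A) : T.extend g (φ ∘ v) = φ (T.extend g v) := by
  simp [extend]

lemma extend_intCast (T : TernaryForm) (g : ℤ) {A : Type*} [CommRing A] (v : Fin 4 → ℤ) :
    T.extend g (fun i => (v i : A)) = (T.extend g v : ℤ) :=
  T.extend_map g (Int.castRingHom A) v

namespace IsLevel

variable {T T' : TernaryForm} {M : ℕ}

lemma extend_add_gradient (h : T.IsLevel T' M) (k : ℤ) (v m : Fin 4 → ℤ) :
    T.extend 1 (v + k • T'.gradient M m) =
      T.extend 1 v + k * (4 * M) * m ⬝ᵥ v + k ^ 2 * (4 * M) * T'.extend M m := by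
  have hu' := T'.dotProduct_gradient M m
  obtain ⟨u, hu⟩ : ∃ u, u = T'.gradient M m := ⟨_, rfl⟩
  have g0 : 2 * T.a * u 0 + T.f * u 1 + T.e * u 2 = 4 * M * m 0 := by
    simp only [hu, gradient, cons_val, Int.cast_id]
    linear_combination m 0 * h.mul11 + m 1 * h.mul12 + m 2 * h.mul13
  have g1 : T.f * u 0 + 2 * T.b * u 1 + T.d * u 2 = 4 * M * m 1 := by
    simp only [hu, gradient, cons_val, Int.cast_id]
    linear_combination m 0 * h.mul21 + m 1 * h.mul22 + m 2 * h.mul23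
  have g2 : T.e * u 0 + T.d * u 1 + 2 * T.c * u 2 = 4 * M * m 2 := by
    simp only [hu, gradient, cons_val, Int.cast_id]
    linear_combination m 0 * h.mul31 + m 1 * h.mul32 + m 2 * h.mul33
  have g3 : u 3 = 2 * M * m 3 := by simp [hu, gradient]
  rw [← hu] at hu' ⊢
  simp only [dotProduct, Fin.sum_univ_four] at hu' ⊢
  have hq : 2 * T.extend 1 u = 2 * (4 * M * T'.extend M m) := by
    simp only [extend, Int.cast_id] at hu' ⊢
    linear_combination u 0 * g0 + u 1 * g1 + u 2 * g2 + 2 * u 3 * g3 + 4 * M * hu'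
  replace hq := mul_left_cancel₀ two_ne_zero hq
  simp only [extend, Pi.add_apply, Pi.smul_apply, smul_eq_mul, Int.cast_id] at hq ⊢
  linear_combination k * (v 0 * g0 + v 1 * g1 + v 2 * g2 + 2 * v 3 * g3) + k ^ 2 * hq

lemma disc_mul_extend (h : T.IsLevel T' M) (w : Fin 4 → ℝ) :
    T.disc * T'.extend M w = M * ((4 * T.b * T.c - T.d ^ 2) * w 0 ^ 2 +
      (4 * T.a * T.c - T.e ^ 2) * w 1 ^ 2 + (4 * T.a * T.b - T.f ^ 2) * w 2 ^ 2 +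
      2 * (T.e * T.f - 2 * T.a * T.d) * w 1 * w 2 + 2 * (T.d * T.f - 2 * T.b * T.e) * w 2 * w 0 +
      2 * (T.d * T.e - 2 * T.c * T.f) * w 0 * w 1 + T.disc * w 3 ^ 2) := by
  have c (x y : ℤ) (e : x = y) : (x : ℝ) = y := by rw [e]
  have h11 := c _ _ h.mul11
  have h12 := c _ _ h.mul12
  have h13 := c _ _ h.mul13
  have h21 := c _ _ h.mul21
  have h22 := c _ _ h.mul22
  have h23 := c _ _ h.mul23
  have h31 := c _ _ h.mul31
  have h32 := c _ _ h.mul32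
  have h33 := c _ _ h.mul33
  push_cast at h11 h12 h13 h21 h22 h23 h31 h32 h33
  simp only [extend, disc]
  push_cast
  linear_combination
    (h11 * (4 * T.b * T.c - T.d ^ 2) + h21 * (T.d * T.e - 2 * T.c * T.f) +
      h31 * (T.d * T.f - 2 * T.b * T.e)) / 4 * w 0 ^ 2 +
    (h12 * (T.d * T.e - 2 * T.c * T.f) + h22 * (4 * T.a * T.c - T.e ^ 2) +
      h32 * (T.e * T.f - 2 * T.a * T.d)) / 4 * w 1 ^ 2 +
    (h13 * (T.d * T.f - 2 * T.b * T.e) + h23 * (T.e * T.f - 2 * T.a * T.d) +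
      h33 * (4 * T.a * T.b - T.f ^ 2)) / 4 * w 2 ^ 2 +
    (h12 * (4 * T.b * T.c - T.d ^ 2) + h22 * (T.d * T.e - 2 * T.c * T.f) +
      h32 * (T.d * T.f - 2 * T.b * T.e)) / 2 * w 0 * w 1 +
    (h13 * (4 * T.b * T.c - T.d ^ 2) + h23 * (T.d * T.e - 2 * T.c * T.f) +
      h33 * (T.d * T.f - 2 * T.b * T.e)) / 2 * w 0 * w 2 +
    (h13 * (T.d * T.e - 2 * T.c * T.f) + h23 * (4 * T.a * T.c - T.e ^ 2) +
      h33 * (T.e * T.f - 2 * T.a * T.d)) / 2 * w 1 * w 2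

lemma gaussianDual (h : T.IsLevel T' M) :
    GaussianDual 4 (T.extend 1) (fun w => T'.extend M w / (4 * M)) (4 * T.disc) := by
  have h0 : (0 : ℝ) < M := by exact_mod_cast h.pos
  have h1 : (0 : ℝ) < T.a := by exact_mod_cast h.pos_one
  have h2 : (0 : ℝ) < 4 * T.a * T.b - T.f ^ 2 := by exact_mod_cast h.pos_two
  have h3 : (0 : ℝ) < T.disc := by exact_mod_cast h.pos_disc
  have hd : (T.disc : ℝ) = 4 * T.a * T.b * T.c + T.d * T.e * T.f - T.a * T.d ^ 2 - T.b * T.e ^ 2 -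
    T.c * T.f ^ 2 := by simp [disc]
  obtain ⟨m, hm⟩ : ∃ m : ℝ, m = 4 * T.a * T.b - T.f ^ 2 := ⟨_, rfl⟩
  rw [← hm] at h2
  have key := ((((GaussianDual.zero.succ 1 one_pos ![]).succ
    (T.disc / m) (by positivity) ![0]).succ
    (m / (4 * T.a)) (by positivity)
    ![(2 * T.a * T.d - T.e * T.f) / m, 0]).succ
    T.a h1 ![T.f / (2 * T.a), T.e / (2 * T.a), 0])
  convert key using 1
  · ext v
    simp [extend, Fin.tail, dotProduct, Fin.sum_univ_succ]
    rw [hd]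
    field_simp
    rw [hm]
    ring
  · ext v
    have := h.disc_mul_extend v
    have e : T'.extend M v / (4 * M) = (T.disc * T'.extend M v) / (4 * M * T.disc) := by field_simp
    rw [e, this]
    simp [Fin.tail, vecHead, vecTail]
    rw [← hm]
    field_simp
    rw [hd, hm]
    ring
  · field_simp
    norm_num

end IsLevel
end TernaryForm

section GaussSum

variable {F : Type*} [Field F] [Fintype F] [DecidableEq F]

/-- The quadratic character of a finite field, with complex values. -/
noncomputable def complexQuadraticChar (F : Type*) [Field F] [Fintype F] [DecidableEq F] :
    MulChar F ℂ :=
  (quadraticChar F).ringHomComp (Int.castRingHom ℂ)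

lemma sum_addChar_mul_sq (hF : ringChar F ≠ 2) {ψ : AddChar F ℂ} (hψ : ψ.IsPrimitive)
    {α : F} (hα : α ≠ 0) (t : F) :
    ∑ x, ψ (α * (x + t) ^ 2) = complexQuadraticChar F α * gaussSum (complexQuadraticChar F) ψ := by
  have h1 : ∑ x, ψ (α * (x + t) ^ 2) = ∑ x, ψ (α * x ^ 2) :=
    Fintype.sum_equiv (Equiv.addRight t) _ _ fun x => rfl
  have h2 : ∑ x, ψ (α * x ^ 2) = ∑ y, (complexQuadraticChar F y + 1) * ψ (α * y) := by
    rw [← Finset.sum_fiberwise (s := Finset.univ) (g := fun x : F => x ^ 2)]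
    refine Finset.sum_congr rfl fun y _ => ?_
    rw [Finset.sum_congr rfl (g := fun _ => ψ (α * y)) fun x hx => by
      rw [(Finset.mem_filter.1 hx).2], Finset.sum_const, nsmul_eq_mul]
    congr 1
    have := quadraticChar_card_sqrts hF y
    rw [Set.toFinset_ofPred] at this
    have h := congrArg (Int.cast : ℤ → ℂ) this
    simpa [complexQuadraticChar] using h
  have h3 : ∑ y, ψ (α * y) = 0 := by
    have := AddChar.sum_mulShift α hψ
    simpa [hα, mul_comm] using this
  rw [h1, h2]
  simp_rw [add_mul, one_mul]
  rw [Finset.sum_add_distrib, h3, add_zero, ← gaussSum_mulShift _ ψ (Units.mk0 α hα), ← mul_assoc]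
  have h4 : complexQuadraticChar F α * complexQuadraticChar F α = 1 := by
    have := quadraticChar_sq_one hα
    rw [← pow_two]
    simpa [complexQuadraticChar] using congrArg (Int.cast : ℤ → ℂ) this
  rw [Units.val_mk0, h4, one_mul]
  rfl

lemma sum_addChar_completeSquare (hF : ringChar F ≠ 2) {ψ : AddChar F ℂ} (hψ : ψ.IsPrimitive)
    {n : ℕ} {α : F} (hα : α ≠ 0) (μ q : (Fin n → F) → F) (q' : (Fin (n + 1) → F) → F)
    (hq : ∀ v, q' v = α * (v 0 + μ (Fin.tail v)) ^ 2 + q (Fin.tail v)) :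
    ∑ v, ψ (q' v) =
      complexQuadraticChar F α * gaussSum (complexQuadraticChar F) ψ * ∑ v, ψ (q v) := by
  rw [← (Fin.consEquiv fun _ => F).sum_comp, Fintype.sum_prod_type_right, Finset.mul_sum]
  refine Finset.sum_congr rfl fun w _ => ?_
  rw [← sum_addChar_mul_sq hF hψ hα (μ w), Finset.sum_mul]
  refine Finset.sum_congr rfl fun x _ => ?_
  rw [hq, AddChar.map_add_eq_mul]
  rfl

lemma gaussSum_complexQuadraticChar_pow_four (hF : ringChar F ≠ 2) {ψ : AddChar F ℂ}
    (hψ : ψ.IsPrimitive) :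
    gaussSum (complexQuadraticChar F) ψ ^ 4 = (Fintype.card F : ℂ) ^ 2 := by
  have h1 : complexQuadraticChar F ≠ 1 := by
    obtain ⟨a, ha⟩ := quadraticChar_exists_neg_one hF
    intro h
    have h0 : a ≠ 0 := by rintro rfl; simp at ha
    have := congrArg (fun χ : MulChar F ℂ => χ a) h
    rw [MulChar.one_apply (isUnit_iff_ne_zero.2 h0)] at this
    simp [complexQuadraticChar, ha] at this
    norm_num at this
  have h2 : (complexQuadraticChar F).IsQuadratic :=
    (quadraticChar_isQuadratic F).comp _
  have h3 : complexQuadraticChar F (-1) ^ 2 = 1 := by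
    rw [← map_pow, neg_one_sq, map_one]
  rw [show 4 = 2 * 2 from rfl, pow_mul, gaussSum_sq h1 h2 hψ, mul_pow, h3, one_mul]

namespace TernaryForm

lemma sum_addChar_extend (T : TernaryForm) {ψ : AddChar F ℂ} (hψ : ψ.IsPrimitive)
    (hF : ringChar F ≠ 2) (hsq : IsSquare T.disc) (h1 : (T.a : F) ≠ 0)
    (h2 : ((4 * T.a * T.b - T.f ^ 2 : ℤ) : F) ≠ 0) (h3 : (T.disc : F) ≠ 0) {b : F} (hb : b ≠ 0) :
    ∑ v, ψ (b * T.extend 1 v) = (Fintype.card F : ℂ) ^ 2 := by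
  have h20 : (2 : F) ≠ 0 := Ring.two_ne_zero hF
  obtain ⟨m, hm⟩ : ∃ m : F, m = 4 * T.a * T.b - T.f ^ 2 := ⟨_, rfl⟩
  have hm0 : m ≠ 0 := by rw [hm]; push_cast at h2; exact h2
  have hd : (T.disc : F) = 4 * T.a * T.b * T.c + T.d * T.e * T.f - T.a * T.d ^ 2 - T.b * T.e ^ 2 -
    T.c * T.f ^ 2 := by simp [disc]
  have h40 : (4 : F) ≠ 0 := by
    rw [show (4 : F) = 2 * 2 by norm_num]; exact mul_ne_zero h20 h20
  rw [sum_addChar_completeSquare hF hψ (mul_ne_zero hb h1)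
      (fun v => (T.f * v 0 + T.e * v 1) / (2 * T.a))
      (fun v => b * (m / (4 * T.a) * (v 0 + (2 * T.a * T.d - T.e * T.f) / m * v 1) ^ 2 +
        T.disc / m * v 1 ^ 2 + v 2 ^ 2)),
    sum_addChar_completeSquare hF hψ
      (mul_ne_zero hb (div_ne_zero hm0 (mul_ne_zero h40 h1)))
      (fun v => (2 * T.a * T.d - T.e * T.f) / m * v 0)
      (fun v => b * (T.disc / m * v 0 ^ 2 + v 1 ^ 2)),
    sum_addChar_completeSquare hF hψ (mul_ne_zero hb (div_ne_zero h3 hm0))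
      (fun _ => 0) (fun v => b * v 0 ^ 2),
    sum_addChar_completeSquare hF hψ hb (fun _ => 0) (fun _ => 0)]
  · rw [← gaussSum_complexQuadraticChar_pow_four hF hψ]
    obtain ⟨r, hr⟩ := hsq
    have hr0 : (r : F) ≠ 0 := by
      rintro h; apply h3; rw [hr, Int.cast_mul, h, zero_mul]
    have : complexQuadraticChar F (b * T.a) * complexQuadraticChar F (b * (m / (4 * T.a))) *
        complexQuadraticChar F (b * (T.disc / m)) * complexQuadraticChar F b = 1 := by
      rw [← map_mul, ← map_mul, ← map_mul, show b * T.a * (b * (m / (4 * T.a))) * (b * (T.disc / m)) * b =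
        (b ^ 2 * r / 2) ^ 2 by rw [hr]; push_cast; field_simp; ring]
      have := quadraticChar_sq_one (F := F) (a := b ^ 2 * r / 2) (by positivity)
      rw [map_pow]
      simpa [complexQuadraticChar] using congrArg (Int.cast : ℤ → ℂ) this
    simp only [AddChar.map_zero_eq_one, Finset.sum_const, Finset.card_univ, Fintype.card_unique,
      one_smul]
    linear_combination gaussSum (complexQuadraticChar F) ψ ^ 4 * this
  · intro v; simp
  · intro v; simp [Fin.tail]; ring
  · intro v; simp [Fin.tail]; ring
  · intro v
    simp [Fin.tail, extend]
    rw [hd]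
    field_simp
    rw [hm]
    ring

end TernaryForm

end GaussSum

namespace TernaryForm

/-- The theta series of the quaternary form `T ⊕ t²`. -/
noncomputable def theta (T : TernaryForm) (τ : ℂ) : ℂ :=
  ∑' x : Fin 4 → ℤ, expTwoPiI (τ * (T.extend 1 x : ℤ))

lemma theta_add_int (T : TernaryForm) (τ : ℂ) (k : ℤ) : T.theta (τ + k) = T.theta τ := by
  refine tsum_congr fun x => ?_
  rw [add_mul, ← Int.cast_mul, expTwoPiI_add_int]

namespace IsLevel

variable {T T' : TernaryForm} {M : ℕ}

lemma sqrt_inv_pow_four (τ : ℂ) : ((-I * τ) ^ (1 / 2 : ℂ))⁻¹ ^ 4 = (-τ ^ 2)⁻¹ := by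
  have : ((-I * τ) ^ (1 / 2 : ℂ)) ^ 2 = -I * τ := by
    rw [one_div]; exact_mod_cast Complex.cpow_nat_inv_pow (-I * τ) two_ne_zero
  rw [inv_pow, show 4 = 2 * 2 from rfl, pow_mul, this, mul_pow, neg_sq, I_sq]
  ring

lemma tsum_eq (h : T.IsLevel T' M) {τ : ℂ} (hτ : 0 < τ.im) (s : Fin 4 → ℝ) :
    ∑' x : Fin 4 → ℤ, expTwoPiI (τ * T.extend 1 ((fun i => (x i : ℝ)) + s)) =
      (-τ ^ 2)⁻¹ * ((√(4 * T.disc) : ℝ) : ℂ)⁻¹ *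
        ∑' m : Fin 4 → ℤ, expTwoPiI (-(T'.extend M m : ℤ) / (4 * M) / τ +
          ((fun i => (m i : ℝ)) ⬝ᵥ s : ℝ)) := by
  have := h.gaussianDual.tsum_eq hτ s 0
  rw [sqrt_inv_pow_four] at this
  simp only [zero_dotProduct, ofReal_zero, add_zero, sub_zero] at this
  rw [this]
  congr 1
  refine tsum_congr fun m => ?_
  have e := T'.extend_intCast M (A := ℝ) m
  rw [e]
  push_cast
  congr 2
  ring

lemma summable_theta (h : T.IsLevel T' M) {τ : ℂ} (hτ : 0 < τ.im) :
    Summable fun x : Fin 4 → ℤ => expTwoPiI (τ * (T.extend 1 x : ℤ)) := by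
  refine (h.gaussianDual.uniform.1.summable_expTwoPiI hτ 0 (fun _ => 0)).congr fun x => ?_
  rw [add_zero, extend_intCast]
  simp

/-- Fractional linear arguments: expansion of the theta series at the cusp `r / K`. -/
theorem theta_rat_add (h : T.IsLevel T' M) (K : ℕ) [NeZero K] (r : ℤ) {ρ : ℂ} (hρ : 0 < ρ.im) :
    T.theta (r / K + ρ) = (-(K ^ 2 * ρ) ^ 2)⁻¹ * ((√(4 * T.disc) : ℝ) : ℂ)⁻¹ *
      ∑ v : Fin 4 → Fin K, expTwoPiI (r * (T.extend 1 (fun i => (v i : ℤ)) : ℤ) / K) *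
        ∑' m : Fin 4 → ℤ, expTwoPiI (-(T'.extend M m : ℤ) / (4 * M) / (K ^ 2 * ρ) +
          (m ⬝ᵥ (fun i => (v i : ℤ)) : ℤ) / K) := by
  have hK : (K : ℂ) ≠ 0 := by exact_mod_cast NeZero.ne K
  have hK' : (0 : ℝ) < K := by exact_mod_cast Nat.pos_of_ne_zero (NeZero.ne K)
  let e : (Fin 4 → ℤ) ≃ (Fin 4 → ℤ) × (Fin 4 → Fin K) :=
    (Equiv.piCongrRight fun _ => Int.divModEquiv K).trans (Equiv.arrowProdEquivProdArrow _ _ _)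
  have he : ∀ p, e.symm p = (K : ℤ) • p.1 + fun i => ((p.2 i : ℕ) : ℤ) := fun p => by
    ext i
    simp [e, Int.divModEquiv, Equiv.arrowProdEquivProdArrow, mul_comm]
  have hρ' : 0 < ((K : ℂ) ^ 2 * ρ).im := by
    have : ((K : ℂ) ^ 2 * ρ) = ((K ^ 2 : ℝ) : ℂ) * ρ := by push_cast; ring
    rw [this, im_ofReal_mul]
    positivity
  have key : ∀ p : (Fin 4 → ℤ) × (Fin 4 → Fin K),
      expTwoPiI ((r / K + ρ) * (T.extend 1 (e.symm p) : ℤ)) =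
      expTwoPiI (r * (T.extend 1 (fun i => (p.2 i : ℤ)) : ℤ) / K) *
      expTwoPiI ((K ^ 2 * ρ) * T.extend 1 ((fun i => (p.1 i : ℝ)) + fun i => (p.2 i : ℝ) / K)) := by
    intro p
    have h1 : ∃ k : ℤ, T.extend 1 (e.symm p) = T.extend 1 (fun i => (p.2 i : ℤ)) + K * k := by
      rw [he]
      simp only [extend, Pi.add_apply, Pi.smul_apply, smul_eq_mul, Int.cast_id]
      refine ⟨T.a * (p.1 0 * (K * p.1 0 + 2 * p.2 0)) + T.b * (p.1 1 * (K * p.1 1 + 2 * p.2 1)) +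
        T.c * (p.1 2 * (K * p.1 2 + 2 * p.2 2)) + p.1 3 * (K * p.1 3 + 2 * p.2 3) +
        T.d * (K * p.1 1 * p.1 2 + p.1 1 * p.2 2 + p.2 1 * p.1 2) +
        T.e * (K * p.1 2 * p.1 0 + p.1 2 * p.2 0 + p.2 2 * p.1 0) +
        T.f * (K * p.1 0 * p.1 1 + p.1 0 * p.2 1 + p.2 0 * p.1 1), by ring⟩
    have h2 : ((T.extend 1 (e.symm p) : ℤ) : ℝ) =
        K ^ 2 * T.extend 1 ((fun i => (p.1 i : ℝ)) + fun i => (p.2 i : ℝ) / K) := by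
      rw [← extend_intCast, ← extend_smul, he]
      congr 1
      ext i
      simp
      field_simp
    obtain ⟨k, hk⟩ := h1
    have h3 : ((T.extend 1 (e.symm p) : ℤ) : ℂ) = (K : ℂ) ^ 2 *
        (T.extend 1 ((fun i => (p.1 i : ℝ)) + fun i => (p.2 i : ℝ) / K) : ℝ) := by
      exact_mod_cast congrArg (Complex.ofReal) h2
    have h4 : (r : ℂ) / K * (T.extend 1 (e.symm p) : ℤ) =
        r * (T.extend 1 (fun i => (p.2 i : ℤ)) : ℤ) / K + (r * k : ℤ) := by
      rw [hk]; push_cast; field_simp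
    rw [add_mul, h4, h3, expTwoPiI_add, expTwoPiI_add_int]
    congr 2
    ring
  have hs := h.summable_theta (τ := r / K + ρ) (by
    rw [add_im, show (r : ℂ) / K = ((r / K : ℝ) : ℂ) by push_cast; rfl, ofReal_im, zero_add]
    exact hρ)
  rw [theta, ← e.symm.tsum_eq, ← (Equiv.prodComm _ _).tsum_eq, Summable.tsum_prod, tsum_fintype,
    Finset.mul_sum]
  · refine Finset.sum_congr rfl fun v _ => ?_
    simp only [Equiv.prodComm_apply, Prod.swap, key]
    rw [tsum_mul_left, h.tsum_eq hρ' , mul_left_comm]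
    congr 3
    ext m
    congr 2
    simp [dotProduct, Finset.sum_div, mul_div_assoc]
  · exact ((Equiv.prodComm _ _).summable_iff.2 (e.symm.summable_iff.2 hs))

end IsLevel
end TernaryForm

lemma sum_fin_natCast {K : ℕ} [NeZero K] {ι : Type*} [Fintype ι] [DecidableEq ι] {A : Type*} [AddCommMonoid A]
    (φ : (ι → ZMod K) → A) :
    ∑ v : ι → Fin K, φ (fun i => ((v i : ℕ) : ZMod K)) = ∑ v, φ v := by
  refine Function.Bijective.sum_comp (g := φ)
    (e := fun (v : ι → Fin K) i => ((v i : ℕ) : ZMod K)) ?_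
  refine (Fintype.bijective_iff_injective_and_card _).2 ⟨fun v w hvw => ?_, by simp [ZMod.card]⟩
  ext i
  have := (ZMod.natCast_eq_natCast_iff' _ _ _).1 (congrFun hvw i)
  rwa [Nat.mod_eq_of_lt (v i).2, Nat.mod_eq_of_lt (w i).2] at this

lemma expTwoPiI_int_div {K : ℕ} [NeZero K] (j : ℤ) :
    expTwoPiI ((j : ℂ) / K) = ZMod.stdAddChar (j : ZMod K) := by
  rw [ZMod.stdAddChar_coe, expTwoPiI]
  congr 1; ring

namespace TernaryForm.IsLevel

variable {T T' : TernaryForm} {M : ℕ}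

lemma sum_completeSquare (h : T.IsLevel T' M) {p : ℕ} [Fact p.Prime] (hp2 : p ≠ 2)
    (h1 : (T.a : ZMod p) ≠ 0) (h2 : ((4 * T.a * T.b - T.f ^ 2 : ℤ) : ZMod p) ≠ 0)
    (h3 : (T.disc : ZMod p) ≠ 0) {b k : ℤ} (hb : ((b * (4 * M) * k : ℤ) : ZMod p) = -1)
    (m : Fin 4 → ℤ) :
    ∑ v : Fin 4 → Fin p, expTwoPiI (((b * T.extend 1 (fun i => (v i : ℤ)) +
      m ⬝ᵥ (fun i => (v i : ℤ)) - k * T'.extend M m : ℤ) : ℂ) / p) = (p : ℂ) ^ 2 := by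
  have hb0 : (b : ZMod p) ≠ 0 := by
    intro hb0
    push_cast at hb
    rw [hb0] at hb
    simp at hb
  have hF : ringChar (ZMod p) ≠ 2 := by rwa [ZMod.ringChar_zmod_n]
  have key := T.sum_addChar_extend (ZMod.isPrimitive_stdAddChar p) hF h.square h1 h2 h3 hb0
  rw [ZMod.card] at key
  rw [← key]
  simp_rw [expTwoPiI_int_div]
  have e1 : ∀ v : Fin 4 → Fin p, (((b * T.extend 1 (fun i => (v i : ℤ)) +
      m ⬝ᵥ (fun i => (v i : ℤ)) - k * T'.extend M m : ℤ)) : ZMod p) =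
      b * T.extend 1 (fun i => ((v i : ℕ) : ZMod p)) +
        (fun i => (m i : ZMod p)) ⬝ᵥ (fun i => ((v i : ℕ) : ZMod p)) - k * (T'.extend M m : ℤ) := by
    intro v
    have := T.extend_intCast 1 (A := ZMod p) (fun i => (v i : ℤ))
    push_cast at this ⊢
    rw [← this]
    simp [dotProduct]
  simp_rw [e1]
  rw [sum_fin_natCast (fun v : Fin 4 → ZMod p => ZMod.stdAddChar ((b : ZMod p) * T.extend 1 v +
        (fun i => (m i : ZMod p)) ⬝ᵥ v - (k : ZMod p) * ((T'.extend M m : ℤ) : ZMod p))),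
    ← Equiv.sum_comp (Equiv.addRight fun i => ((k * T'.gradient M m i : ℤ) : ZMod p))]
  refine Finset.sum_congr rfl fun w _ => congrArg _ ?_
  obtain ⟨w, rfl⟩ : ∃ w' : Fin 4 → ℤ, (fun i => (w' i : ZMod p)) = w :=
    ⟨fun i => (ZMod.intCast_surjective (w i)).choose,
      funext fun i => (ZMod.intCast_surjective (w i)).choose_spec⟩
  have e2 : (Equiv.addRight fun i => ((k * T'.gradient M m i : ℤ) : ZMod p)) (fun i => (w i : ZMod p))
      = fun i => (((w + k • T'.gradient M m) i : ℤ) : ZMod p) := by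
    ext i; simp
  have e3 : ∀ x : Fin 4 → ℤ, (fun i => (m i : ZMod p)) ⬝ᵥ (fun i => (x i : ZMod p)) =
      (m ⬝ᵥ x : ℤ) := fun x => by simp [dotProduct]
  rw [e2, e3, extend_intCast, extend_intCast, h.extend_add_gradient, dotProduct_add,
    dotProduct_smul, dotProduct_gradient]
  push_cast at hb ⊢
  simp only [smul_eq_mul]
  push_cast
  linear_combination ((m ⬝ᵥ w : ℤ) + k * (T'.extend M m : ℤ) : ZMod p) * hb

lemma theta_smul_prime (h : T.IsLevel T' M) {p : ℕ} [Fact p.Prime] (hp2 : p ≠ 2)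
    (h1 : (T.a : ZMod p) ≠ 0) (h2 : ((4 * T.a * T.b - T.f ^ 2 : ℤ) : ZMod p) ≠ 0)
    (h3 : (T.disc : ZMod p) ≠ 0) {a b k : ℤ} (hdet : a * p - b * (4 * M * k) = 1)
    {τ : ℂ} (hτ : 0 < τ.im) :
    T.theta ((a * τ + b) / (4 * M * k * τ + p)) = (4 * M * k * τ + p) ^ 2 * T.theta τ := by
  have hτ0 : τ ≠ 0 := fun h => by simp [h] at hτ
  have hM0 : (M : ℂ) ≠ 0 := by exact_mod_cast h.pos.ne'
  have hp0 : (p : ℂ) ≠ 0 := by exact_mod_cast (Fact.out : p.Prime).ne_zero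
  have hb : ((b * (4 * M) * k : ℤ) : ZMod p) = -1 := by
    have := congrArg (Int.cast : ℤ → ZMod p) hdet
    push_cast at this ⊢
    rw [ZMod.natCast_self, mul_zero] at this
    linear_combination -this
  have hdet' : (a : ℂ) * p - b * (4 * M * k) = 1 := by exact_mod_cast hdet
  obtain ⟨c, hc⟩ : ∃ c : ℂ, c = 4 * M * k := ⟨_, rfl⟩
  rw [← hc] at hdet' ⊢
  have hσ : 0 < (-τ⁻¹ - c / p).im := by
    have : c / p = ((4 * M * k / p : ℝ) : ℂ) := by rw [hc]; push_cast; rfl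
    rw [this, sub_im, ofReal_im, sub_zero]
    exact im_neg_inv_pos hτ
  have hσ0 : (-τ⁻¹ - c / p) ≠ 0 := fun h => by rw [h] at hσ; simp at hσ
  have hj : c * τ + p ≠ 0 := by
    intro h0
    apply hσ0
    field_simp
    linear_combination -h0
  obtain ⟨ρ, hρ_def⟩ : ∃ ρ : ℂ, ρ = τ / (p * (c * τ + p)) := ⟨_, rfl⟩
  have hρ : 0 < ρ.im := by
    have e : ρ = ((p ^ 2 : ℝ)⁻¹ : ℝ) * (-(-τ⁻¹ - c / p)⁻¹) := by
      have : -τ⁻¹ - c / p = -(c * τ + p) / (p * τ) := by field_simp; ring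
      rw [this, hρ_def]
      push_cast
      field_simp
    rw [e, im_ofReal_mul]
    have := im_neg_inv_pos hσ
    have hp0' : (0 : ℝ) < p := by exact_mod_cast (Fact.out : p.Prime).pos
    positivity
  have e1 : (a * τ + b) / (c * τ + p) = b / p + ρ := by
    obtain ⟨j, hj'⟩ : ∃ j, j = c * τ + p := ⟨_, rfl⟩
    rw [hρ_def, ← hj']
    rw [← hj'] at hj
    field_simp
    rw [hj']
    linear_combination τ * hdet'
  have hτ' := im_neg_inv_pos hτ
  rw [e1, h.theta_rat_add p b hρ]
  have e2 : ∀ (v : Fin 4 → Fin p) (m : Fin 4 → ℤ),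
      expTwoPiI (b * (T.extend 1 (fun i => (v i : ℤ)) : ℤ) / p) *
        expTwoPiI (-(T'.extend M m : ℤ) / (4 * M) / (p ^ 2 * ρ) +
          (m ⬝ᵥ (fun i => (v i : ℤ)) : ℤ) / p) =
      expTwoPiI (((b * T.extend 1 (fun i => (v i : ℤ)) +
        m ⬝ᵥ (fun i => (v i : ℤ)) - k * T'.extend M m : ℤ) : ℂ) / p) *
      expTwoPiI (-(T'.extend M m : ℤ) / (4 * M) / τ) := fun v m => by
    rw [← expTwoPiI_add, ← expTwoPiI_add, hρ_def]
    congr 1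
    push_cast
    field_simp
    rw [hc]
    ring
  simp_rw [← tsum_mul_left, e2]
  have hs := h.gaussianDual.uniform.2.summable_expTwoPiI hτ' 0
  rw [← Summable.tsum_finsetSum]
  · simp_rw [← Finset.sum_mul, h.sum_completeSquare hp2 h1 h2 h3 hb]
    have e3 := h.tsum_eq hτ 0
    simp only [add_zero, dotProduct_zero, ofReal_zero, extend_intCast] at e3
    have e4 : T.theta τ = _ := e3
    rw [e4, tsum_mul_left, hρ_def]
    field_simp
  · intro v _
    refine (hs (fun m => ((b * T.extend 1 (fun i => (v i : ℤ)) +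
        m ⬝ᵥ (fun i => (v i : ℤ)) - k * T'.extend M m : ℤ) : ℝ) / p)).congr fun m => ?_
    rw [← expTwoPiI_add, add_zero, extend_intCast]
    congr 1
    push_cast
    field_simp
    ring

end TernaryForm.IsLevel

lemma GaussianDual.nonneg {n : ℕ} {Q Q' : (Fin n → ℝ) → ℝ} {D : ℝ} (h : GaussianDual n Q Q' D) :
    (∀ v, 0 ≤ Q v) ∧ ∀ w, 0 ≤ Q' w := by
  induction h with
  | zero => simp
  | succ β hβ μ h ih =>
    exact ⟨fun v => add_nonneg (by positivity) (ih.1 _), fun w => add_nonneg (by positivity) (ih.2 _)⟩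

namespace TernaryForm

lemma norm_tsum_expTwoPiI_le {n : ℕ} {Q : (Fin n → ℝ) → ℝ}
    (hu : UniformGaussianSum Q) {f : (Fin n → ℤ) → ℂ}
    (hf : ∀ x, Q (fun i => (x i : ℝ)) ≤ (f x).im) :
    ‖∑' x, expTwoPiI (f x)‖ ≤ ∑' x : Fin n → ℤ, rexp (-(2 * π) * Q (fun i => (x i : ℝ))) := by
  have hs := hu.summable (y := 2 * π) (by positivity) 0
  simp only [add_zero] at hs
  refine tsum_of_norm_bounded hs.hasSum fun x => ?_
  rw [norm_expTwoPiI]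
  have := hf x
  gcongr
  nlinarith [pi_pos]

namespace IsLevel

variable {T T' : TernaryForm} {M : ℕ}

theorem theta_smul (h : T.IsLevel T' M) {a b k d : ℤ} (hdet : a * d - b * (4 * M * k) = 1)
    {τ : ℂ} (hτ : 0 < τ.im) :
    T.theta ((a * τ + b) / (4 * M * k * τ + d)) = (4 * M * k * τ + d) ^ 2 * T.theta τ := by
  have hM := h.pos
  rcases eq_or_ne k 0 with rfl | hk
  · rw [mul_zero, mul_zero, sub_zero] at hdet
    rcases Int.mul_eq_one_iff_eq_one_or_neg_one.1 hdet with ⟨rfl, rfl⟩ | ⟨rfl, rfl⟩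
    · simpa using T.theta_add_int τ b
    · have := T.theta_add_int τ (-b)
      simp only [Int.cast_neg] at this
      simpa [sub_eq_add_neg, add_comm, div_neg] using this
  · have hq : (4 * M * k).natAbs ≠ 0 := by
      rw [Int.natAbs_ne_zero]; positivity
    have hc : IsCoprime d ((4 * M * k).natAbs : ℤ) := by
      have : IsCoprime d (4 * M * k) := ⟨a, -b, by linarith⟩
      simpa only [Int.isCoprime_iff_gcd_eq_one, Int.gcd, Int.natAbs_natCast] using this
    obtain ⟨p, hp, hpp, hpd⟩ := Nat.forall_exists_prime_gt_and_zmodEq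
      (2 + T.a.natAbs + (4 * T.a * T.b - T.f ^ 2).natAbs + T.disc.natAbs) hq hc
    have := Fact.mk hpp
    have hne : ∀ z : ℤ, 0 < z → z.natAbs < p → (z : ZMod p) ≠ 0 := fun z hz hzp h0 => by
      rw [ZMod.intCast_zmod_eq_zero_iff_dvd] at h0
      have := Int.le_of_dvd hz h0
      omega
    obtain ⟨j, hj⟩ := Int.natAbs_dvd.1 hpd.symm.dvd
    have h1 := h.theta_smul_prime (p := p) (by omega) (hne _ h.pos_one (by omega))
      (hne _ h.pos_two (by omega)) (hne _ h.pos_disc (by omega)) (a := a) (b := b + a * j) (k := k)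
      (by linear_combination hdet + a * hj) (τ := τ - j) (by simpa using hτ)
    have hj' : (p : ℂ) = 4 * M * k * j + d := by
      have : (p : ℤ) = 4 * M * k * j + d := by linarith
      exact_mod_cast congrArg (Int.cast (R := ℂ)) this
    have h2 := T.theta_add_int τ (-j)
    rw [Int.cast_neg, ← sub_eq_add_neg] at h2
    rw [h2] at h1
    convert h1 using 2
    · push_cast
      rw [hj']
      congr 1 <;> ring
    · rw [hj']
      ring

lemma exists_norm_theta_le (h : T.IsLevel T' M) :
    ∃ C, ∀ τ : ℂ, 1 ≤ τ.im → ‖T.theta τ‖ ≤ C := by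
  refine ⟨_, fun τ hτ => norm_tsum_expTwoPiI_le h.gaussianDual.uniform.1
    fun x => ?_⟩
  have := h.gaussianDual.nonneg.1 (fun i => (x i : ℝ))
  rw [extend_intCast] at this ⊢
  rw [← Complex.ofReal_intCast, im_mul_ofReal]
  nlinarith

lemma exists_norm_theta_smul_le (h : T.IsLevel T' M) {a b c d : ℤ} (hdet : a * d - b * c = 1) :
    ∃ C, ∀ τ : ℂ, 1 ≤ τ.im → ‖T.theta ((a * τ + b) / (c * τ + d))‖ ≤ C * ‖c * τ + d‖ ^ 2 := by
  rcases eq_or_ne c 0 with rfl | hc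
  · obtain ⟨C, hC⟩ := h.exists_norm_theta_le
    refine ⟨C, fun τ hτ => ?_⟩
    have := h.theta_smul (a := a) (b := b) (k := 0) (d := d) (by linarith)
      (τ := τ) (by linarith)
    simp only [Int.cast_zero, mul_zero, zero_mul, zero_add] at this ⊢
    rw [this, norm_mul, norm_pow, mul_comm]
    gcongr
    exact hC τ hτ
  · set K := c.natAbs with hK
    have : NeZero K := ⟨by omega⟩
    obtain ⟨r, hr⟩ : ∃ r : ℤ, r * c = a * K := ⟨a * c.sign, by rw [mul_assoc, Int.sign_mul_self, hK]⟩
    have hc' : (c : ℂ) ≠ 0 := by exact_mod_cast hc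
    have hKC : (K : ℂ) ≠ 0 := by exact_mod_cast NeZero.ne K
    have hK2 : (K : ℂ) ^ 2 = c ^ 2 := by
      have : (K : ℤ) ^ 2 = c ^ 2 := Int.natAbs_sq c
      exact_mod_cast congrArg (Int.cast (R := ℂ)) this
    set S := ∑' m : Fin 4 → ℤ, rexp (-(2 * π) * (T'.extend M (fun i => (m i : ℝ)) / (4 * M)))
    refine ⟨‖((√(4 * T.disc) : ℝ) : ℂ)⁻¹‖ * (∑ v : Fin 4 → Fin K, S) / ‖(c : ℂ)‖ ^ 2, fun τ hτ => ?_⟩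
    have hcd : (c : ℂ) * τ + d ≠ 0 := fun h0 => by
      have := congrArg Complex.im h0
      simp [hc] at this
      linarith
    set ρ : ℂ := -1 / (c * (c * τ + d)) with hρ
    have hρc : c * τ + d = -(1 / (c * ρ)) := by
      rw [hρ]; field_simp
    have hr' : (r : ℂ) / K = a / c := by
      rw [div_eq_div_iff hKC hc']
      exact_mod_cast congrArg (Int.cast (R := ℂ)) hr
    have hdet' : (a * d - b * c : ℂ) = 1 := by exact_mod_cast congrArg (Int.cast (R := ℂ)) hdet
    have e1 : (a * τ + b) / (c * τ + d) = r / K + ρ := by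
      rw [hr', hρ, div_add_div _ _ hc' (mul_ne_zero hc' hcd), div_eq_div_iff hcd (by positivity)]
      linear_combination -c * (c * τ + d) * hdet'
    have e2 : ∀ z : ℂ, z / (K ^ 2 * ρ) = z * (-τ - d / c) := fun z => by
      rw [hK2, hρ]; field_simp; ring
    have hρim : 0 < ρ.im := by
      have : ρ = (((c : ℝ) ^ 2)⁻¹ : ℝ) * -(τ + (d / c : ℝ))⁻¹ := by
        rw [hρ]; push_cast; field_simp
      rw [this, im_ofReal_mul]
      exact mul_pos (by positivity) (im_neg_inv_pos (by
        rw [add_im, ofReal_im, add_zero]; linarith))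
    rw [e1, h.theta_rat_add K r hρim, norm_mul, norm_mul]
    have e3 : ‖(-((K : ℂ) ^ 2 * ρ) ^ 2)⁻¹‖ = ‖c * τ + d‖ ^ 2 / ‖(c : ℂ)‖ ^ 2 := by
      rw [← norm_pow, ← norm_pow, ← norm_div, ← norm_neg]
      congr 1
      rw [hK2, hρ]
      field_simp
    have e4 : ‖∑ v : Fin 4 → Fin K, expTwoPiI (r * (T.extend 1 (fun i => (v i : ℤ)) : ℤ) / K) *
        ∑' m, expTwoPiI (-(T'.extend M m : ℤ) / (4 * M) / (K ^ 2 * ρ) +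
          (m ⬝ᵥ (fun i => (v i : ℤ)) : ℤ) / K)‖ ≤ ∑ v : Fin 4 → Fin K, S := by
      refine (norm_sum_le _ _).trans (Finset.sum_le_sum fun v _ => ?_)
      have e5 : ‖expTwoPiI (r * (T.extend 1 (fun i => (v i : ℤ)) : ℤ) / K)‖ = 1 := by
        rw [norm_expTwoPiI]
        have : (r * (T.extend 1 (fun i => (v i : ℤ)) : ℤ) / K : ℂ) =
          ((r * (T.extend 1 (fun i => (v i : ℤ)) : ℤ) / K : ℝ) : ℂ) := by push_cast; rfl
        rw [this, ofReal_im]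
        simp
      rw [norm_mul, e5, one_mul]
      refine norm_tsum_expTwoPiI_le h.gaussianDual.uniform.2 fun m => ?_
      have hn := h.gaussianDual.nonneg.2 (fun i => (m i : ℝ))
      simp only [extend_intCast] at hn ⊢
      rw [e2]
      have : (-(T'.extend M m : ℤ) / (4 * M) * (-τ - d / c) + (m ⬝ᵥ (fun i => (v i : ℤ)) : ℤ) / K : ℂ)
          = (((T'.extend M m : ℤ) / (4 * M) : ℝ) : ℂ) * τ +
          (((T'.extend M m : ℤ) / (4 * M) * (d / c) + (m ⬝ᵥ (fun i => (v i : ℤ)) : ℤ) / K : ℝ) : ℂ) := by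
        push_cast; ring
      rw [this, add_im, ofReal_im, add_zero, im_ofReal_mul]
      nlinarith
    rw [e3]
    calc _ ≤ ‖c * τ + d‖ ^ 2 / ‖(c : ℂ)‖ ^ 2 * ‖((√(4 * T.disc) : ℝ) : ℂ)⁻¹‖ *
          (∑ v : Fin 4 → Fin K, S) := by gcongr
      _ = _ := by ring

lemma differentiableOn_theta (h : T.IsLevel T' M) :
    DifferentiableOn ℂ T.theta {τ | 0 < τ.im} := by
  intro τ₀ hτ₀
  have hτ₀' : 0 < τ₀.im := hτ₀
  have ho : IsOpen {τ : ℂ | τ₀.im / 2 < τ.im} := isOpen_lt continuous_const continuous_im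
  have hs := h.gaussianDual.uniform.1.summable (y := 2 * π * (τ₀.im / 2)) (by positivity) 0
  simp only [add_zero, extend_intCast] at hs
  refine ((differentiableOn_tsum_of_summable_norm hs (fun x => ?_) ho fun x τ hτ => ?_).differentiableAt
    (ho.mem_nhds ?_)).differentiableWithinAt
  · unfold expTwoPiI
    fun_prop
  · have := h.gaussianDual.nonneg.1 (fun i => (x i : ℝ))
    rw [extend_intCast] at this
    rw [norm_expTwoPiI, ← Complex.ofReal_intCast, im_mul_ofReal]
    have hτ' : τ₀.im / 2 < τ.im := hτ
    rw [neg_mul]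
    refine exp_le_exp.2 (neg_le_neg ?_)
    rw [mul_assoc (2 * π)]
    gcongr
  · change τ₀.im / 2 < τ₀.im
    linarith

end IsLevel
end TernaryForm

section ModularForm

open UpperHalfPlane hiding I
open Matrix.SpecialLinearGroup CongruenceSubgroup
open scoped MatrixGroups ModularForm Manifold

namespace TernaryForm

/-- Number of representations of `n` by the quaternary form `T ⊕ t²`. -/
noncomputable def extendCount (T : TernaryForm) (n : ℕ) : ℕ :=
  Set.ncard {x : Fin 4 → ℤ | T.extend 1 x = n}

namespace IsLevel

variable {T T' : TernaryForm} {M : ℕ}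

/-- The theta series of a ternary form of square discriminant and level `4M`, extended by a
square, as a modular form of weight 2. -/
noncomputable def thetaForm (h : T.IsLevel T' M) [NeZero (4 * M)] :
    ModularForm (Gamma0 (4 * M) : Subgroup (GL (Fin 2) ℝ)) 2 where
  toFun τ := T.theta τ
  slash_action_eq' := by
    rintro _ ⟨γ, hγ, rfl⟩
    change (fun τ : ℍ => T.theta τ) ∣[(2 : ℤ)] γ = _
    ext τ
    have hdet : γ 0 0 * γ 1 1 - γ 0 1 * γ 1 0 = 1 := (det_fin_two γ.1).symm.trans γ.2
    obtain ⟨k, hk⟩ := (ZMod.intCast_zmod_eq_zero_iff_dvd _ _).1 (Gamma0_mem.1 hγ)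
    push_cast at hk
    have := h.theta_smul (a := γ 0 0) (b := γ 0 1) (k := k) (d := γ 1 1) (hk ▸ hdet) τ.im_pos
    have hd : denom γ τ = 4 * M * k * τ + γ 1 1 := by
      simp [denom, hk]
    have hd0 := denom_ne_zero γ τ
    have e : ((γ • τ : ℍ) : ℂ) = (γ 0 0 * τ + γ 0 1) / (4 * M * k * τ + γ 1 1) := by
      rw [UpperHalfPlane.coe_specialLinearGroup_apply]; simp [hk]
    rw [ModularForm.SL_slash_apply, e, this, ← hd, _root_.zpow_neg]
    norm_cast
    field_simp
  holo' := by
    rw [UpperHalfPlane.mdifferentiable_iff]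
    exact h.differentiableOn_theta.congr fun τ hτ => by
      simp [Function.comp_apply, UpperHalfPlane.ofComplex_apply_of_im_pos hτ]
  bdd_at_cusps' {c} hc := by
    rw [OnePoint.isBoundedAt_iff_forall_SL2Z (Subgroup.IsArithmetic.isCusp_iff_isCusp_SL2Z _ |>.1 hc)]
    intro γ _
    rw [isBoundedAtImInfty_iff]
    have hdet : γ 0 0 * γ 1 1 - γ 0 1 * γ 1 0 = 1 := (det_fin_two γ.1).symm.trans γ.2
    obtain ⟨C, hC⟩ := h.exists_norm_theta_smul_le hdet
    refine ⟨C, 1, fun τ hτ => ?_⟩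
    have := hC τ hτ
    have hd : denom γ τ = γ 1 0 * τ + γ 1 1 := by
      simp [denom]
    have hd0 := norm_pos_iff.2 (denom_ne_zero γ τ)
    have e : ((γ • τ : ℍ) : ℂ) = (γ 0 0 * τ + γ 0 1) / (γ 1 0 * τ + γ 1 1) := by
      rw [UpperHalfPlane.coe_specialLinearGroup_apply]; simp
    rw [← e, ← hd] at this
    rw [ModularForm.SL_slash_apply, norm_mul, _root_.zpow_neg, norm_inv, norm_zpow,
      ← div_eq_mul_inv, div_le_iff₀ (by positivity)]
    exact_mod_cast this

lemma finite_extend_eq (h : T.IsLevel T' M) (n : ℕ) : {x : Fin 4 → ℤ | T.extend 1 x = n}.Finite := by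
  have hs := (h.gaussianDual.uniform.1.summable one_pos 0).tendsto_cofinite_zero
  have := hs.eventually (gt_mem_nhds (exp_pos (-n)))
  rw [Filter.eventually_cofinite] at this
  refine this.subset fun x hx => ?_
  simp only [Set.mem_ofPred_eq] at hx ⊢
  rw [add_zero, extend_intCast, hx]
  simp

lemma hasSum_theta (h : T.IsLevel T' M) (τ : ℍ) :
    HasSum (fun n : ℕ => (T.extendCount n : ℂ) • Function.Periodic.qParam 1 τ ^ n) (T.theta τ) := by
  have hs := (h.summable_theta τ.im_pos).hasSum
  let N : (Fin 4 → ℤ) → ℕ := fun x => (T.extend 1 x).toNat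
  have hN : ∀ x, (N x : ℤ) = T.extend 1 x := fun x => by
    have := h.gaussianDual.nonneg.1 (fun i => (x i : ℝ))
    rw [extend_intCast] at this
    exact Int.toNat_of_nonneg (by exact_mod_cast this)
  have := (Equiv.sigmaFiberEquiv N).hasSum_iff.2 hs
  refine this.sigma fun n => ?_
  have hset : {x | N x = n} = {x : Fin 4 → ℤ | T.extend 1 x = n} := by
    ext x
    simp only [Set.mem_ofPred_eq, ← hN]
    norm_cast
  have hfin : Finite {x // N x = n} := (hset ▸ h.finite_extend_eq n : {x | N x = n}.Finite).to_subtype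
  have := Fintype.ofFinite {x // N x = n}
  convert hasSum_fintype _ using 1
  rw [Finset.sum_congr rfl (g := fun _ => Function.Periodic.qParam 1 τ ^ n)]
  · rw [Finset.sum_const, Finset.card_univ, ← Nat.card_eq_fintype_card, extendCount, ← hset,
      ← Nat.card_coe_set_eq, nsmul_eq_mul]
    rfl
  · rintro ⟨x, rfl⟩ -
    simp only [Function.comp_apply, Equiv.sigmaFiberEquiv, Equiv.coe_fn_mk, ← hN,
      Function.Periodic.qParam, ← Complex.exp_nat_mul, expTwoPiI]
    congr 1
    push_cast
    ring

end IsLevel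
end TernaryForm

end ModularForm

section Sturm

open UpperHalfPlane hiding I
open Matrix.SpecialLinearGroup CongruenceSubgroup Filter
open scoped MatrixGroups ModularForm Manifold Topology

lemma Subgroup.index_le_card_of_maps {G α : Type*} [Group G] {H : Subgroup G} (f : G → α)
    (S : Finset α) (hS : ∀ g, f g ∈ S) (hf : ∀ g g', f g = f g' → g⁻¹ * g' ∈ H) :
    H.index ≤ S.card := by
  rw [Subgroup.index, ← Fintype.card_coe, ← Nat.card_eq_fintype_card]
  refine Nat.card_le_card_of_injective (fun q : G ⧸ H => (⟨f q.out, hS _⟩ : S)) fun q q' h => ?_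
  rw [← q.out_eq', ← q'.out_eq']
  exact QuotientGroup.eq.2 (hf _ _ (congrArg Subtype.val h))

lemma SL2Z_inv_mul_apply_one_zero (g g' : SL(2, ℤ)) :
    (g⁻¹ * g') 1 0 = g 0 0 * g' 1 0 - g 1 0 * g' 0 0 := by
  change (adjugate g.1 * g'.1) 1 0 = g.1 0 0 * g'.1 1 0 - g.1 1 0 * g'.1 0 0
  rw [Matrix.adjugate_fin_two]
  simp [Matrix.mul_apply, Fin.sum_univ_two]
  ring

lemma index_Gamma0_prime_le (p : ℕ) [Fact p.Prime] : (Gamma0 p).index ≤ p + 1 := by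
  have h := Subgroup.index_le_card_of_maps (H := Gamma0 p) (α := Option (ZMod p))
    (fun g => if (g 0 0 : ZMod p) = 0 then none else some ((g 1 0 : ZMod p) / g 0 0))
    Finset.univ (fun _ => Finset.mem_univ _) fun g g' hgg => ?_
  · simpa [ZMod.card] using h
  · have hdet : (g 0 0 * g 1 1 - g 0 1 * g 1 0 : ZMod p) = 1 := by
      exact_mod_cast congrArg (Int.cast (R := ZMod p)) ((det_fin_two g.1).symm.trans g.2)
    rw [Gamma0_mem, SL2Z_inv_mul_apply_one_zero]
    push_cast
    split_ifs at hgg with h1 h2 h2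
    · rw [h1, h2]; ring
    · have := Option.some_injective _ hgg
      field_simp at this
      linear_combination -this

lemma index_Gamma0_four_le : (Gamma0 4).index ≤ 6 := by
  have h := Subgroup.index_le_card_of_maps (H := Gamma0 4) (α := ZMod 4 × ZMod 4)
    (fun g => if (g 0 0 * g 0 0 : ZMod 4) = 1 then (1, g 1 0 * g 0 0) else (g 0 0 * g 1 0, 1))
    {(1, 0), (1, 1), (1, 2), (1, 3), (0, 1), (2, 1)} ?_ fun g g' hgg => ?_
  · exact h
  · intro g
    have hdet : (g 0 0 * g 1 1 - g 0 1 * g 1 0 : ZMod 4) = 1 := by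
      exact_mod_cast congrArg (Int.cast (R := ZMod 4)) ((det_fin_two g.1).symm.trans g.2)
    generalize (g 0 0 : ZMod 4) = a at *
    generalize (g 0 1 : ZMod 4) = b at *
    generalize (g 1 0 : ZMod 4) = c at *
    generalize (g 1 1 : ZMod 4) = d at *
    decide +revert
  · have key : ∀ a b c d : ZMod 4, a * d - b * c = 1 → a * a = 1 ∨ c * c = 1 := by decide
    have key2 : ∀ a c a' c' : ZMod 4, (a * a = 1 ∨ c * c = 1) → (a' * a' = 1 ∨ c' * c' = 1) →
      (if a * a = 1 then (1, c * a) else (a * c, 1)) =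
        (if a' * a' = 1 then (1, c' * a') else (a' * c', 1)) → a * c' - c * a' = 0 := by decide
    have hdet : ∀ g : SL(2, ℤ), (g 0 0 * g 1 1 - g 0 1 * g 1 0 : ZMod 4) = 1 := fun g => by
      exact_mod_cast congrArg (Int.cast (R := ZMod 4)) ((det_fin_two g.1).symm.trans g.2)
    rw [Gamma0_mem, SL2Z_inv_mul_apply_one_zero]
    push_cast
    exact key2 _ _ _ _ (key _ _ _ _ (hdet g)) (key _ _ _ _ (hdet g')) hgg

lemma index_Gamma0_four_mul_prime_le (p : ℕ) [Fact p.Prime] (hp : p ≠ 2) :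
    (Gamma0 (4 * p)).index ≤ 6 * (p + 1) := by
  have : Gamma0 (4 * p) = Gamma0 4 ⊓ Gamma0 p := by
    ext g
    rw [Subgroup.mem_inf, Gamma0_mem, Gamma0_mem, Gamma0_mem, ZMod.intCast_zmod_eq_zero_iff_dvd,
      ZMod.intCast_zmod_eq_zero_iff_dvd, ZMod.intCast_zmod_eq_zero_iff_dvd]
    have hc : IsCoprime ((4 : ℕ) : ℤ) (p : ℤ) := by
      rw [Nat.isCoprime_iff_coprime, show 4 = 2 ^ 2 from rfl]
      exact Nat.Coprime.pow_left 2 ((Nat.coprime_primes Nat.prime_two Fact.out).2 hp.symm)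
    push_cast at hc ⊢
    exact ⟨fun h => ⟨(dvd_mul_right _ _).trans h, (dvd_mul_left _ _).trans h⟩,
      fun h => hc.mul_dvd h.1 h.2⟩
  rw [this]
  exact Subgroup.index_inf_le.trans (Nat.mul_le_mul index_Gamma0_four_le (index_Gamma0_prime_le p))

lemma card_quotient_map_mapGL (Γ : Subgroup SL(2, ℤ)) :
    Nat.card (𝒮ℒ ⧸ (Γ : Subgroup (GL (Fin 2) ℝ)).subgroupOf 𝒮ℒ) = Γ.index := by
  change (Γ.map (mapGL ℝ)).relIndex (mapGL ℝ).range = _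
  rw [MonoidHom.range_eq_map, Subgroup.relIndex_map_map_of_injective _ _ (mapGL_injective),
    Subgroup.relIndex_top_right]

lemma qExpansion_coeff_eq_zero_of_norm_le {Γ : Subgroup (GL (Fin 2) ℝ)} (hΓ : (1 : ℝ) ∈ Γ.strictPeriods)
    {k : ℤ} (g : ModularForm Γ k) {m n : ℕ} {C A : ℝ}
    (hg : ∀ τ : ℍ, A ≤ τ.im → ‖g τ‖ ≤ C * rexp (-(2 * π * m * τ.im))) (hn : n < m) :
    (qExpansion 1 g).coeff n = 0 := by
  have hb : ∀ t : ℝ, max A 1 ≤ t → ‖(qExpansion 1 g).coeff n‖ ≤ C * rexp (-(2 * π * t)) := by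
    intro t ht
    have ht0 : 0 < t := by linarith [le_max_right A 1]
    rw [ModularFormClass.qExpansion_coeff_eq_intervalIntegral g one_pos hΓ n ht0]
    rw [ofReal_one, div_one, one_mul]
    refine (intervalIntegral.norm_integral_le_of_norm_le_const
      (C := C * rexp (-(2 * π * t))) fun u _ => ?_).trans (by simp)
    have h1 := hg ⟨u + t * I, by simpa using ht0⟩
    have him : UpperHalfPlane.im ⟨u + t * I, by simpa using ht0⟩ = t := by simp [UpperHalfPlane.im]
    rw [him] at h1
    have h2 := h1 ((le_max_left _ _).trans ht)
    have hC : 0 ≤ C := by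
      by_contra hC
      push Not at hC
      exact absurd ((norm_nonneg _).trans h2) (not_le.2 (mul_neg_of_neg_of_pos hC (exp_pos _)))
    rw [norm_mul, norm_div, norm_one, norm_pow, Function.Periodic.norm_qParam, ← Real.exp_nat_mul,
      one_div, ← Real.exp_neg]
    calc _ ≤ rexp (-(n * (-2 * π * (u + t * I : ℂ).im / 1))) * (C * rexp (-(2 * π * m * t))) := by gcongr
      _ = C * rexp (-(2 * π * (m - n) * t)) := by
        rw [mul_left_comm, ← Real.exp_add]
        congr 2
        simp
        ring
      _ ≤ _ := by
        have : (n : ℝ) + 1 ≤ m := by exact_mod_cast hn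
        have : 2 * π * t * 1 ≤ 2 * π * t * (m - n) := by gcongr; linarith
        exact mul_le_mul_of_nonneg_left (Real.exp_le_exp.2 (by linarith)) hC
  have ht : Tendsto (fun t : ℝ => C * rexp (-(2 * π * t))) atTop (𝓝 (C * 0)) := by
    refine (Real.tendsto_exp_neg_atTop_nhds_zero.comp ?_).const_mul C
    exact tendsto_id.const_mul_atTop (by positivity)
  rw [mul_zero] at ht
  exact norm_le_zero_iff.1 (ge_of_tendsto ht ((eventually_ge_atTop _).mono hb))

/-- A Sturm bound for congruence subgroups with cusp width one at infinity, in terms of the index. -/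
theorem ModularForm.eq_zero_of_norm_le {Γ : Subgroup SL(2, ℤ)} [Γ.FiniteIndex] {k : ℤ}
    (f : ModularForm (Γ : Subgroup (GL (Fin 2) ℝ)) k) {m : ℕ} {C A : ℝ}
    (hf : ∀ τ : ℍ, A ≤ τ.im → ‖f τ‖ ≤ C * rexp (-(2 * π * m * τ.im)))
    (hm : (k * Γ.index).toNat / 12 < m) : f = 0 := by
  have key : ModularForm.norm 𝒮ℒ f = 0 := by
    refine ModularForm.sturm_bound_levelOne ?_
    refine lt_of_lt_of_le (b := (m : ℕ∞)) (by rw [card_quotient_map_mapGL Γ]; exact_mod_cast hm) ?_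
    refine PowerSeries.nat_le_order _ _ fun n hn => ?_
    let Q := 𝒮ℒ ⧸ (Γ : Subgroup (GL (Fin 2) ℝ)).subgroupOf 𝒮ℒ
    have hb : ∀ q : Q, IsBoundedAtImInfty (SlashInvariantForm.quotientFunc f q) := by
      intro q
      induction q using Quotient.inductionOn with
      | h r =>
        obtain ⟨_, γ, rfl⟩ := r
        refine f.bdd_at_cusps' (c := (mapGL ℝ γ)⁻¹ • OnePoint.infty) ?_ _ rfl
        rw [Subgroup.IsArithmetic.isCusp_iff_isCusp_SL2Z, isCusp_SL2Z_iff']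
        exact ⟨γ⁻¹, by rw [map_inv]⟩
    simp only [isBoundedAtImInfty_iff] at hb
    choose B A' hB using hb
    let := Fintype.ofFinite Q
    classical
    obtain ⟨A₀, hA₀⟩ := (Set.finite_range A').bddAbove
    refine qExpansion_coeff_eq_zero_of_norm_le (by simp) _ (m := m)
      (C := C * ∏ q ∈ Finset.univ.erase (⟦1⟧ : Q), B q) (A := max A A₀) (fun τ hτ => ?_) hn
    rw [ModularForm.coe_norm, Finset.prod_apply, norm_prod, mul_right_comm]
    refine (Finset.mul_prod_erase Finset.univ (fun q : Q => ‖SlashInvariantForm.quotientFunc f q τ‖)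
      (Finset.mem_univ (⟦1⟧ : Q))).symm.trans_le ?_
    have h1 : SlashInvariantForm.quotientFunc f (⟦1⟧ : Q) τ = f τ := by simp
    have h2 := hf τ ((le_max_left _ _).trans hτ)
    rw [h1]
    refine mul_le_mul h2 ?_ (Finset.prod_nonneg fun _ _ => norm_nonneg _) ((norm_nonneg _).trans h2)
    exact Finset.prod_le_prod (fun _ _ => norm_nonneg _) fun q _ =>
      hB q τ ((hA₀ ⟨q, rfl⟩).trans ((le_max_right _ _).trans hτ))
  exact DFunLike.coe_injective ((ModularForm.norm_eq_zero_iff 𝒮ℒ f).1 key)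

/-- Vanishing of the first coefficients forces all coefficients to vanish. -/
theorem ModularForm.coeff_eq_zero {N : ℕ} [NeZero N] {k : ℤ}
    (f : ModularForm (Gamma0 N : Subgroup (GL (Fin 2) ℝ)) k) {c : ℕ → ℂ}
    (hc : ∀ τ : ℍ, HasSum (fun n => c n • Function.Periodic.qParam 1 τ ^ n) (f τ)) {m : ℕ}
    (hm : (k * (Gamma0 N).index).toNat / 12 < m) (h0 : ∀ n < m, c n = 0) (n : ℕ) : c n = 0 := by
  have hf : f = 0 := by
    have hs : Summable fun n => ‖c (n + m) • Function.Periodic.qParam 1 I ^ (n + m)‖ := by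
      have := (hc UpperHalfPlane.I).summable.norm
      exact (summable_nat_add_iff m).2 this
    refine f.eq_zero_of_norm_le (m := m) (A := 1)
      (C := (∑' n, ‖c (n + m) • Function.Periodic.qParam 1 I ^ (n + m)‖) * rexp (2 * π * m)) (fun τ hτ => ?_) hm
    have h1 := (hasSum_nat_add_iff' m).2 (hc τ)
    rw [Finset.sum_eq_zero (fun i hi => by rw [h0 i (Finset.mem_range.1 hi), zero_smul]), sub_zero] at h1
    rw [mul_assoc, ← Real.exp_add, ← tsum_mul_right, ← h1.tsum_eq]
    refine tsum_of_norm_bounded (hs.mul_right _).hasSum fun i => ?_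
    rw [norm_smul, norm_smul, mul_assoc, norm_pow, norm_pow, Function.Periodic.norm_qParam,
      Function.Periodic.norm_qParam, ← Real.exp_nat_mul, ← Real.exp_nat_mul, ← Real.exp_add]
    gcongr
    simp only [Complex.I_im, UpperHalfPlane.coe_im]
    push_cast
    have : 0 ≤ 2 * π * i * (τ.im - 1) := mul_nonneg (by positivity) (by linarith)
    nlinarith
  rw [ModularFormClass.qExpansion_coeff_unique one_pos (by simp) hc n, hf]
  simp [qExpansion_zero]

end Sturm

namespace TernaryForm

/-- The value of a ternary form. -/
def eval (T : TernaryForm) {A : Type*} [CommRing A] (v : Fin 3 → A) : A :=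
  T.a * v 0 ^ 2 + T.b * v 1 ^ 2 + T.c * v 2 ^ 2 + T.d * v 1 * v 2 + T.e * v 2 * v 0 +
    T.f * v 0 * v 1

/-- Number of representations of `m` by a ternary form. -/
noncomputable def count (T : TernaryForm) (m : ℤ) : ℕ :=
  Set.ncard {v : Fin 3 → ℤ | T.eval v = m}

end TernaryForm

section Hecke

/-- The lattice vectors that span the line through `u` modulo `p`. -/
def OnLine (p : ℕ) (u v : Fin 3 → ℤ) : Prop :=
  ¬ (p : ℤ) ∣ v 2 ∧ ∀ i, (p : ℤ) ∣ v i - v 2 * u i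

/-- The data of a `p`-neighbour step of the lattice `ℤ³` along the isotropic line of `u`:
`p⁻¹ M` is an isometry moving the neighbour back to `ℤ³`, and the columns of `N` are a basis
of the sublattice which `M` maps into `p ℤ³`, with Gram form `T`. -/
structure IsNeighbourStep (p : ℕ) (u : Fin 3 → ℤ) (M N : Matrix (Fin 3) (Fin 3) ℤ)
    (κ : Fin 3 → ℤ) (T : TernaryForm) : Prop where
  last : u 2 = 1
  norm : (p : ℤ) ^ 2 ∣ u ⬝ᵥ u
  isometry : M * Mᵀ = (p : ℤ) ^ 2 • (1 : Matrix (Fin 3) (Fin 3) ℤ)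
  isometry' : Mᵀ * M = (p : ℤ) ^ 2 • (1 : Matrix (Fin 3) (Fin 3) ℤ)
  mulVec : ∀ j, (p : ℤ) ^ 2 ∣ (Mᵀ *ᵥ u) j
  rank_one : ∀ i j, (p : ℤ) ∣ M i j - u i * M 2 j
  det : N.det ^ 2 = (p : ℤ) ^ 2
  adjugate : ∀ i j, (p : ℤ) ∣ N.adjugate i j - κ i * M 2 j
  mul : ∀ j, (p : ℤ) ∣ (M * N) 2 j
  gram : ∀ y : Fin 3 → ℤ, (N *ᵥ y) ⬝ᵥ (N *ᵥ y) = T.eval y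

namespace IsNeighbourStep

variable {p : ℕ} {u : Fin 3 → ℤ} {M N : Matrix (Fin 3) (Fin 3) ℤ} {κ : Fin 3 → ℤ}
  {T : TernaryForm}

lemma ncard_sublattice (h : IsNeighbourStep p u M N κ T) (hp : p.Prime) (m : ℤ) :
    Set.ncard {x : Fin 3 → ℤ | x ⬝ᵥ x = m ∧ (p : ℤ) ∣ (M *ᵥ x) 2} = T.count m := by
  have hp0 : (p : ℤ) ≠ 0 := by exact_mod_cast hp.ne_zero
  have hdet : N.det ≠ 0 := fun h0 => hp0 (by simpa [h0] using h.det.symm)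
  refine (Set.ncard_congr (fun y _ => N *ᵥ y) ?_
    (fun _ _ _ _ e => mulVec_injective_of_det_ne_zero hdet e) ?_).symm
  · refine fun y hy => ⟨(h.gram y).trans hy, ?_⟩
    rw [mulVec_mulVec]
    exact Finset.dvd_sum (s := Finset.univ) (f := fun j => (M * N) 2 j * y j) fun j _ => (h.mul j).mul_right _
  · rintro x ⟨hx, hd⟩
    have hdet' : N.det ∣ p := by
      rw [← Int.natAbs_dvd_natAbs]
      exact (Int.natAbs_eq_iff_sq_eq.2 h.det).dvd
    have : ∀ i, N.det ∣ (N.adjugate *ᵥ x) i := fun i => hdet'.trans <| by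
      have e : (N.adjugate *ᵥ x) i =
          ∑ j, (N.adjugate i j - κ i * M 2 j) * x j + κ i * (M *ᵥ x) 2 := by
        simp only [Matrix.mulVec, dotProduct, Finset.mul_sum, ← Finset.sum_add_distrib]
        exact Finset.sum_congr rfl fun j _ => by ring
      rw [e]
      exact dvd_add (Finset.dvd_sum fun j _ => (h.adjugate i j).mul_right _) (hd.mul_left _)
    choose y hy using this
    have hy' : N.adjugate *ᵥ x = N.det • y := funext hy
    have e : N *ᵥ y = x := by
      apply smul_right_injective _ hdet
      simp only
      rw [← mulVec_smul, ← hy', mulVec_mulVec, mul_adjugate, smul_mulVec, one_mulVec]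
    exact ⟨y, by rw [Set.mem_ofPred_eq, ← h.gram, e, hx], e⟩

lemma ncard_onLine (h : IsNeighbourStep p u M N κ T) (hp : p.Prime) (hp2 : p ≠ 2) (m : ℤ) :
    Set.ncard {v : Fin 3 → ℤ | v ⬝ᵥ v = p ^ 2 * m ∧ OnLine p u v} =
      Set.ncard {x : Fin 3 → ℤ | x ⬝ᵥ x = m ∧ ¬ (p : ℤ) ∣ (M *ᵥ x) 2} := by
  have hp0 : (p : ℤ) ≠ 0 := by exact_mod_cast hp.ne_zero
  have hpp : Prime (p : ℤ) := Nat.prime_iff_prime_int.1 hp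
  have hdot (x : Fin 3 → ℤ) : (M *ᵥ x) ⬝ᵥ (M *ᵥ x) = p ^ 2 * (x ⬝ᵥ x) := by
    rw [dotProduct_mulVec, vecMul_mulVec, h.isometry', vecMul_smul, vecMul_one, smul_dotProduct, smul_eq_mul]
  refine (Set.ncard_congr (fun x _ => M *ᵥ x) ?_ ?_ ?_).symm
  · rintro x ⟨hx, hd⟩
    refine ⟨by rw [hdot, hx], hd, fun i => ?_⟩
    have e : (M *ᵥ x) i - (M *ᵥ x) 2 * u i = ∑ j, (M i j - u i * M 2 j) * x j := by
      simp only [Matrix.mulVec, dotProduct, Finset.sum_mul, ← Finset.sum_sub_distrib]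
      exact Finset.sum_congr rfl fun j _ => by ring
    rw [e]
    exact Finset.dvd_sum fun j _ => (h.rank_one i j).mul_right _
  · intro x y _ _ hxy
    have := congrArg (Mᵀ *ᵥ ·) hxy
    simp only [mulVec_mulVec, h.isometry', smul_mulVec, one_mulVec] at this
    exact smul_right_injective _ (pow_ne_zero 2 hp0) this
  · rintro v ⟨hv, hl, hd⟩
    choose t ht using hd
    have hvt : v = v 2 • u + (p : ℤ) • t := by
      ext i
      simp only [Pi.add_apply, Pi.smul_apply, smul_eq_mul, ← ht]
      ring
    have hut : (p : ℤ) ∣ u ⬝ᵥ t := by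
      have h1 : (p : ℤ) ^ 2 ∣ 2 * v 2 * p * (u ⬝ᵥ t) := by
        have : 2 * v 2 * p * (u ⬝ᵥ t) = p ^ 2 * m - v 2 ^ 2 * (u ⬝ᵥ u) - p ^ 2 * (t ⬝ᵥ t) := by
          rw [← hv]
          nth_rw 2 3 [hvt]
          simp only [add_dotProduct, dotProduct_add, smul_dotProduct, dotProduct_smul, smul_eq_mul,
            dotProduct_comm t u]
          ring
        rw [this]
        exact ((dvd_mul_right _ _).sub (h.norm.mul_left _)).sub (dvd_mul_right _ _)
      have h2 : (p : ℤ) ∣ 2 * v 2 * (u ⬝ᵥ t) := by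
        rw [← mul_dvd_mul_iff_left hp0]
        rwa [← pow_two, show (p : ℤ) * (2 * v 2 * (u ⬝ᵥ t)) = 2 * v 2 * p * (u ⬝ᵥ t) by ring]
      refine (hpp.dvd_or_dvd h2).resolve_left fun h3 => (hpp.dvd_or_dvd h3).elim (fun h4 => hp2 ?_) hl
      exact (Nat.prime_dvd_prime_iff_eq hp Nat.prime_two).1 (by exact_mod_cast h4)
    have h3 : ∀ j, (p : ℤ) ^ 2 ∣ (Mᵀ *ᵥ v) j := fun j => by
      rw [hvt, mulVec_add, mulVec_smul, mulVec_smul]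
      refine dvd_add ((h.mulVec j).mul_left _) ?_
      rw [pow_two]
      refine mul_dvd_mul_left _ ?_
      have e : (Mᵀ *ᵥ t) j = ∑ i, (M i j - u i * M 2 j) * t i + M 2 j * (u ⬝ᵥ t) := by
        simp only [Matrix.mulVec, dotProduct, Finset.mul_sum, ← Finset.sum_add_distrib, transpose_apply]
        exact Finset.sum_congr rfl fun j _ => by ring
      rw [e]
      exact dvd_add (Finset.dvd_sum fun i _ => (h.rank_one i j).mul_right _) (hut.mul_left _)
    choose x hx using h3
    have hx' : Mᵀ *ᵥ v = (p : ℤ) ^ 2 • x := funext hx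
    have e : M *ᵥ x = v := by
      apply smul_right_injective _ (pow_ne_zero 2 hp0)
      simp only
      rw [← mulVec_smul, ← hx', mulVec_mulVec, h.isometry, smul_mulVec, one_mulVec]
    refine ⟨x, ⟨?_, by rwa [e]⟩, e⟩
    have := hdot x
    rw [e, hv] at this
    exact (mul_left_cancel₀ (pow_ne_zero 2 hp0) this).symm

lemma finite_dotProduct_eq (m : ℤ) : {x : Fin 3 → ℤ | x ⬝ᵥ x = m}.Finite := by
  refine (Set.Finite.pi (t := fun _ : Fin 3 => Set.Icc (-m) m) fun _ => Set.finite_Icc _ _).subset ?_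
  intro x hx i _
  rw [Set.mem_ofPred_eq] at hx
  have : x i * x i ≤ m := by
    rw [← hx]
    exact Finset.single_le_sum (f := fun i => x i * x i) (fun i _ => mul_self_nonneg _) (Finset.mem_univ i)
  constructor <;> nlinarith [mul_self_nonneg (x i - 1), mul_self_nonneg (x i + 1), mul_self_nonneg (x i)]

lemma ncard_onLine_add (h : IsNeighbourStep p u M N κ T) (hp : p.Prime) (hp2 : p ≠ 2) (m : ℤ) :
    Set.ncard {v : Fin 3 → ℤ | v ⬝ᵥ v = p ^ 2 * m ∧ OnLine p u v} + T.count m =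
      Set.ncard {x : Fin 3 → ℤ | x ⬝ᵥ x = m} := by
  rw [h.ncard_onLine hp hp2, ← h.ncard_sublattice hp, add_comm]
  exact Set.ncard_inter_add_ncard_sdiff_eq_ncard {x : Fin 3 → ℤ | x ⬝ᵥ x = m} {x | (p : ℤ) ∣ (M *ᵥ x) 2} (finite_dotProduct_eq m)

end IsNeighbourStep

end Hecke

section SignedPerm

/-- A signed permutation of coordinates, up to a global sign: the first two entries of `g` give
the permutation `i ↦ ±(i + r)`, the last two the signs of the first two new coordinates. -/
def signedPerm (g : Fin 3 × Bool × Bool × Bool) {A : Type*} [Neg A] (v : Fin 3 → A) : Fin 3 → A :=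
  let w : Fin 3 → A := fun i => v (bif g.2.1 then g.1 + i else -(g.1 + i))
  ![bif g.2.2.1 then -w 0 else w 0, bif g.2.2.2 then -w 1 else w 1, w 2]

lemma signedPerm_map (g : Fin 3 × Bool × Bool × Bool) {A B F : Type*} [AddGroup A] [AddGroup B]
    [FunLike F A B] [AddMonoidHomClass F A B] (φ : F) (v : Fin 3 → A) :
    signedPerm g (φ ∘ v) = φ ∘ signedPerm g v := by
  obtain ⟨r, b, e₀, e₁⟩ := g
  ext i
  fin_cases i <;> cases e₀ <;> cases e₁ <;> simp [signedPerm]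

lemma signedPerm_smul (g : Fin 3 × Bool × Bool × Bool) {A : Type*} [Ring A] (c : A) (v : Fin 3 → A) :
    signedPerm g (c • v) = c • signedPerm g v :=
  signedPerm_map g (AddMonoidHom.mulLeft c) v

lemma dotProduct_signedPerm (g : Fin 3 × Bool × Bool × Bool) {A : Type*} [CommRing A] (v : Fin 3 → A) :
    signedPerm g v ⬝ᵥ signedPerm g v = v ⬝ᵥ v := by
  obtain ⟨r, b, e₀, e₁⟩ := g
  have h : ∑ i, v (bif b then r + i else -(r + i)) * v (bif b then r + i else -(r + i)) =
      ∑ i, v i * v i := by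
    cases b
    · exact Equiv.sum_comp ((Equiv.addLeft r).trans (Equiv.neg _)) fun i => v i * v i
    · exact Equiv.sum_comp (Equiv.addLeft r) fun i => v i * v i
  rw [dotProduct, dotProduct, ← h, Fin.sum_univ_three, Fin.sum_univ_three]
  cases e₀ <;> cases e₁ <;> simp [signedPerm]

lemma signedPerm_sub (g : Fin 3 × Bool × Bool × Bool) {A : Type*} [Ring A] (v w : Fin 3 → A) :
    signedPerm g (v - w) = signedPerm g v - signedPerm g w := by
  obtain ⟨r, b, e₀, e₁⟩ := g
  ext i
  fin_cases i <;> cases e₀ <;> cases e₁ <;> simp [signedPerm] <;> abel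

lemma signedPerm_injective (g : Fin 3 × Bool × Bool × Bool) :
    Function.Injective (signedPerm g (A := ℤ)) := fun v w h => by
  have := dotProduct_signedPerm g (v - w)
  rw [signedPerm_sub, h, sub_self, dotProduct_zero] at this
  exact sub_eq_zero.1 (dotProduct_self_eq_zero.1 this.symm)

/-- The number of signed permutations, up to a global sign, that move `v` to a vector spanning the
line through `u`, which is normalized by `u 2 = 1`. -/
def lineCount {p : ℕ} (u v : Fin 3 → ZMod p) : ℕ :=
  (Finset.univ.filter fun g => signedPerm g v 2 ≠ 0 ∧ signedPerm g v 0 = signedPerm g v 2 * u 0 ∧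
    signedPerm g v 1 = signedPerm g v 2 * u 1).card

lemma lineCount_smul {p : ℕ} [Fact p.Prime] (u v : Fin 3 → ZMod p) {c : ZMod p} (hc : c ≠ 0) :
    lineCount u (c • v) = lineCount u v := by
  simp only [lineCount, signedPerm_smul, Pi.smul_apply, smul_eq_mul, mul_assoc,
    mul_right_inj' hc, ne_eq, mul_eq_zero, hc, false_or]

lemma lineCount_zero {p : ℕ} (u : Fin 3 → ZMod p) : lineCount u 0 = 0 := by
  have h (g) : signedPerm g (0 : Fin 3 → ZMod p) 2 = 0 := rfl
  simp [lineCount, h]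

lemma onLine_iff {p : ℕ} {u : Fin 3 → ℤ} (hu : u 2 = 1) (v : Fin 3 → ℤ) :
    OnLine p u v ↔ (v 2 : ZMod p) ≠ 0 ∧ (v 0 : ZMod p) = v 2 * u 0 ∧ (v 1 : ZMod p) = v 2 * u 1 := by
  simp only [OnLine, ← ZMod.intCast_zmod_eq_zero_iff_dvd, Fin.forall_fin_succ]
  simp only [Int.cast_sub, Int.cast_mul, sub_eq_zero, Fin.succ_zero_eq_one, Fin.succ_one_eq_two, hu,
    mul_one, IsEmpty.forall_iff, and_true]

lemma sum_lineCount {p : ℕ} {u : Fin 3 → ℤ} (hu : u 2 = 1) {m : ℤ} {S : Finset (Fin 3 → ℤ)}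
    (hS : ∀ v, v ∈ S ↔ v ⬝ᵥ v = m) :
    ∑ v ∈ S, lineCount (p := p) (Int.cast ∘ u) (Int.cast ∘ v) =
      24 * Set.ncard {v : Fin 3 → ℤ | v ⬝ᵥ v = m ∧ OnLine p u v} := by
  classical
  have h (g) (v : Fin 3 → ℤ) : signedPerm g ((Int.cast : ℤ → ZMod p) ∘ v) = Int.cast ∘ signedPerm g v :=
    signedPerm_map g (Int.castAddHom (ZMod p)) v
  have hc : Set.ncard {v : Fin 3 → ℤ | v ⬝ᵥ v = m ∧ OnLine p u v} = ∑ v ∈ S, if OnLine p u v then 1 else 0 := by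
    rw [Finset.sum_boole, Nat.cast_id, ← Set.ncard_coe_finset]
    congr 1
    ext v
    simp [hS]
  simp only [lineCount, Finset.card_filter, h, Function.comp_apply, ← onLine_iff hu]
  rw [Finset.sum_comm, hc, ← smul_eq_mul, ← show Fintype.card (Fin 3 × Bool × Bool × Bool) = 24 from rfl,
    ← Finset.card_univ, ← Finset.sum_const]
  refine Finset.sum_congr rfl fun g _ => ?_
  have hm : Set.MapsTo (signedPerm g (A := ℤ)) S S := fun v hv => by
    simpa only [Finset.mem_coe, hS, dotProduct_signedPerm] using hv
  have hi : Set.InjOn (signedPerm g (A := ℤ)) S := (signedPerm_injective g).injOn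
  exact Finset.sum_nbij (signedPerm g) hm hi (Finset.surjOn_of_injOn_of_card_le _ hm hi le_rfl)
    fun _ _ => rfl

end SignedPerm

section SeventyThree

/-- The sum of the line counts over representatives of the orbits of isotropic lines modulo 73,
weighted by the sizes of the orbits. -/
def lineWeight (v : Fin 3 → ZMod 73) : ℕ :=
  6 * lineCount ![0, 27, 1] v + 12 * lineCount ![1, 12, 1] v + 24 * lineCount ![7, 13, 1] v +
    8 * lineCount ![8, 9, 1] v + 24 * lineCount ![11, 30, 1] v

instance Nat.fact_prime_seventyThree : Fact (Nat.Prime 73) := ⟨by norm_num⟩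

lemma lineWeight_smul (v : Fin 3 → ZMod 73) {c : ZMod 73} (hc : c ≠ 0) :
    lineWeight (c • v) = lineWeight v := by
  simp only [lineWeight, lineCount_smul _ _ hc]

lemma lineWeight_eq {v : Fin 3 → ZMod 73} (hv : v ≠ 0) (h : v ⬝ᵥ v = 0) : lineWeight v = 24 := by
  have key : ∀ a b : ZMod 73, a * a + b * b + 1 = 0 → lineWeight ![a, b, 1] = 24 := by
    decide +kernel
  have key' : ∀ a : ZMod 73, a * a + 1 = 0 → lineWeight ![a, 1, 0] = 24 := by
    decide +kernel
  rw [dotProduct, Fin.sum_univ_three] at h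
  by_cases h2 : v 2 = 0
  · have h1 : v 1 ≠ 0 := fun h1 => hv <| by
      have h0 : v 0 = 0 := by simpa [h1, h2] using h
      ext i
      fin_cases i <;> simp [h0, h1, h2]
    have e : v = v 1 • ![v 0 / v 1, 1, 0] := by
      ext i
      fin_cases i <;> simp [h2]
      field_simp
    rw [e, lineWeight_smul _ h1]
    exact key' _ (by field_simp; simpa [h2, pow_two] using h)
  · have e : v = v 2 • ![v 0 / v 2, v 1 / v 2, 1] := by
      ext i
      fin_cases i <;> simp <;> field_simp
    rw [e, lineWeight_smul _ h2]
    exact key _ _ (by field_simp; simpa [pow_two] using h)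

lemma ncard_dotProduct_seventyThree (m : ℤ) :
    Set.ncard {v : Fin 3 → ℤ | v ⬝ᵥ v = 73 ^ 2 * m} + 6 * TernaryForm.count ⟨1, 73, 73, 0, 0, 0⟩ m +
      12 * TernaryForm.count ⟨2, 37, 73, 0, 0, 2⟩ m + 24 * TernaryForm.count ⟨6, 25, 38, 2, 6, 4⟩ m +
      8 * TernaryForm.count ⟨3, 49, 49, 48, -2, 2⟩ m + 24 * TernaryForm.count ⟨9, 18, 41, 18, 4, 8⟩ m =
    75 * Set.ncard {v : Fin 3 → ℤ | v ⬝ᵥ v = m} := by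
  have ha : IsNeighbourStep 73 ![0, -776, 1] !![73, 0, 0; 0, 55, -48; 0, 48, 55]
      !![-1, 0, 0; 0, -8, -3; 0, 3, -8] ![0, 61, 32] ⟨1, 73, 73, 0, 0, 0⟩ := by
    refine ⟨rfl, by decide, by decide, by decide, by decide, by decide, by decide, by decide, by decide, fun y => ?_⟩
    simp [TernaryForm.eval, Matrix.mulVec, dotProduct, Fin.sum_univ_three]
    ring
  have hb : IsNeighbourStep 73 ![-72, 12, 1] !![1, 12, 72; 12, 71, -12; -72, 12, -1]
      !![-1, -1, -6; 0, -6, 1; -1, 0, 6] ![37, 72, 67] ⟨2, 37, 73, 0, 0, 2⟩ := by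
    refine ⟨rfl, by decide, by decide, by decide, by decide, by decide, by decide, by decide, by decide, fun y => ?_⟩
    simp [TernaryForm.eval, Matrix.mulVec, dotProduct, Fin.sum_univ_three]
    ring
  have hc : IsNeighbourStep 73 ![7, -2250, 1] !![57, -44, 12; 12, 33, 64; -44, -48, 33]
      !![-2, -3, -3; 1, 0, -5; 1, -4, 2] ![27, 35, 20] ⟨6, 25, 38, 2, 6, 4⟩ := by
    refine ⟨rfl, by decide, by decide, by decide, by decide, by decide, by decide, by decide, by decide, fun y => ?_⟩
    simp [TernaryForm.eval, Matrix.mulVec, dotProduct, Fin.sum_univ_three]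
    ring
  have hd : IsNeighbourStep 73 ![8, 593, 1] !![9, 8, 72; -72, 9, 8; -8, -72, 9]
      !![-1, -6, -3; 1, -2, -6; -1, 3, -2] ![52, 72, 9] ⟨3, 49, 49, 48, -2, 2⟩ := by
    refine ⟨rfl, by decide, by decide, by decide, by decide, by decide, by decide, by decide, by decide, fun y => ?_⟩
    simp [TernaryForm.eval, Matrix.mulVec, dotProduct, Fin.sum_univ_three]
    ring
  have he : IsNeighbourStep 73 ![11, -1941, 1] !![57, -28, 36; 36, 63, -8; -28, 24, 63]
      !![-1, -4, -4; -2, 1, -3; -2, -1, 4] ![13, 36, 52] ⟨9, 18, 41, 18, 4, 8⟩ := by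
    refine ⟨rfl, by decide, by decide, by decide, by decide, by decide, by decide, by decide, by decide, fun y => ?_⟩
    simp [TernaryForm.eval, Matrix.mulVec, dotProduct, Fin.sum_univ_three]
    ring
  obtain ⟨S, hS⟩ : ∃ S : Finset (Fin 3 → ℤ), ∀ v, v ∈ S ↔ v ⬝ᵥ v = (73 : ℕ) ^ 2 * m :=
    ⟨(IsNeighbourStep.finite_dotProduct_eq ((73 : ℕ) ^ 2 * m)).toFinset, by simp⟩
  have hcast (x y z : ℤ) : (Int.cast : ℤ → ZMod 73) ∘ ![x, y, z] = ![(x : ZMod 73), y, z] := by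
    ext i; fin_cases i <;> rfl
  have hsum : ∑ v ∈ S, lineWeight (Int.cast ∘ v) = 24 * (S.filter fun v => ¬ ∀ i, (73 : ℤ) ∣ v i).card := by
    rw [Finset.card_filter, Finset.mul_sum]
    refine Finset.sum_congr rfl fun v hv => ?_
    have hz : (Int.cast : ℤ → ZMod 73) ∘ v = 0 ↔ ∀ i, (73 : ℤ) ∣ v i := by
      simp only [funext_iff, Function.comp_apply, Pi.zero_apply]
      exact forall_congr' fun i => ZMod.intCast_zmod_eq_zero_iff_dvd (v i) 73
    by_cases h0 : (Int.cast : ℤ → ZMod 73) ∘ v = 0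
    · rw [if_neg (not_not.2 (hz.1 h0)), h0]
      simp [lineWeight, lineCount_zero]
    · have e : ((Int.cast ∘ v : Fin 3 → ZMod 73) ⬝ᵥ (Int.cast ∘ v)) = ((v ⬝ᵥ v : ℤ) : ZMod 73) := by
        simp [dotProduct]
      have e0 : ((v ⬝ᵥ v : ℤ) : ZMod 73) = 0 := by
        rw [(hS v).1 hv, Int.cast_mul, Int.cast_pow, Int.cast_natCast, ZMod.natCast_self]
        ring
      rw [if_pos (mt hz.2 h0), lineWeight_eq h0 (e.trans e0), mul_one]
  have hsmul (x : Fin 3 → ℤ) : ((73 : ℤ) • x) ⬝ᵥ ((73 : ℤ) • x) = (73 : ℕ) ^ 2 * (x ⬝ᵥ x) := by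
    rw [smul_dotProduct, dotProduct_smul, smul_eq_mul, smul_eq_mul]
    push_cast
    ring
  have hdiv : (S.filter fun v => ∀ i, (73 : ℤ) ∣ v i).card = Set.ncard {v : Fin 3 → ℤ | v ⬝ᵥ v = m} := by
    rw [← Set.ncard_coe_finset]
    refine (Set.ncard_congr (fun x _ => (73 : ℤ) • x) ?_ ?_ ?_).symm
    · intro x hx
      rw [Set.mem_ofPred_eq] at hx
      rw [Finset.coe_filter, Set.mem_ofPred_eq, hS, hsmul, hx]
      exact ⟨rfl, fun i => dvd_mul_right _ _⟩
    · exact fun x y _ _ h => smul_right_injective _ (by norm_num) h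
    · intro v hv
      simp only [Finset.coe_filter, hS, Set.mem_ofPred_eq] at hv
      choose x hx using hv.2
      have e : v = (73 : ℤ) • x := funext hx
      have := hv.1
      rw [e, hsmul] at this
      exact ⟨x, mul_left_cancel₀ (by norm_num) this, e.symm⟩
  have hcard := Finset.card_filter_add_card_filter_not (s := S) (fun v => ∀ i, (73 : ℤ) ∣ v i)
  have hSn : S.card = Set.ncard {v : Fin 3 → ℤ | v ⬝ᵥ v = 73 ^ 2 * m} := by
    rw [← Set.ncard_coe_finset]
    congr 1
    ext v
    simp [hS]
  have p73 : Nat.Prime 73 := Fact.out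
  have La := ha.ncard_onLine_add p73 (by norm_num) m
  have Lb := hb.ncard_onLine_add p73 (by norm_num) m
  have Lc := hc.ncard_onLine_add p73 (by norm_num) m
  have Ld := hd.ncard_onLine_add p73 (by norm_num) m
  have Le := he.ncard_onLine_add p73 (by norm_num) m
  have Wa := sum_lineCount (p := 73) ha.last hS
  have Wb := sum_lineCount (p := 73) hb.last hS
  have Wc := sum_lineCount (p := 73) hc.last hS
  have Wd := sum_lineCount (p := 73) hd.last hS
  have We := sum_lineCount (p := 73) he.last hS
  simp only [hcast] at Wa Wb Wc Wd We
  simp only [lineWeight, Finset.sum_add_distrib, ← Finset.mul_sum] at hsum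
  rw [show (![0, 27, 1] : Fin 3 → ZMod 73) = ![((0 : ℤ) : ZMod 73), ((-776 : ℤ) : ZMod 73), ((1 : ℤ) : ZMod 73)] by decide,
    show (![1, 12, 1] : Fin 3 → ZMod 73) = ![((-72 : ℤ) : ZMod 73), ((12 : ℤ) : ZMod 73), ((1 : ℤ) : ZMod 73)] by decide,
    show (![7, 13, 1] : Fin 3 → ZMod 73) = ![((7 : ℤ) : ZMod 73), ((-2250 : ℤ) : ZMod 73), ((1 : ℤ) : ZMod 73)] by decide,
    show (![8, 9, 1] : Fin 3 → ZMod 73) = ![((8 : ℤ) : ZMod 73), ((593 : ℤ) : ZMod 73), ((1 : ℤ) : ZMod 73)] by decide,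
    show (![11, 30, 1] : Fin 3 → ZMod 73) = ![((11 : ℤ) : ZMod 73), ((-1941 : ℤ) : ZMod 73), ((1 : ℤ) : ZMod 73)] by decide,
    Wa, Wb, Wc, Wd, We] at hsum
  omega

end SeventyThree

section FirstCoefficients

lemma disc_mul_sq_le {a b c d e f : ℤ} (ha : 0 < a) (hab : 0 < 4 * a * b - f ^ 2) (x y z : ℤ) :
    (4 * a * b * c + d * e * f - a * d ^ 2 - b * e ^ 2 - c * f ^ 2) * z ^ 2 ≤
      (4 * a * b - f ^ 2) *
        (a * x ^ 2 + b * y ^ 2 + c * z ^ 2 + d * y * z + e * z * x + f * x * y) := by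
  have h : 0 ≤ (4 * a * b - f ^ 2) * (2 * a * x + f * y + e * z) ^ 2 +
      ((4 * a * b - f ^ 2) * y + (2 * a * d - e * f) * z) ^ 2 := by positivity
  refine le_of_mul_le_mul_left (?_ : 4 * a * _ ≤ 4 * a * _) (by positivity)
  linear_combination h

lemma eq_zero_of_sum_mul_pow {N : ℕ} {a : ℕ → ℤ} {B : ℤ} (ha : ∀ i < N, |a i| < B)
    (h : ∑ i ∈ Finset.range N, a i * B ^ i = 0) : ∀ i < N, a i = 0 := by
  induction N generalizing a with
  | zero => simp
  | succ N ih =>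
    rw [Finset.sum_range_succ'] at h
    have h1 : ∑ i ∈ Finset.range N, a (i + 1) * B ^ (i + 1) =
        B * ∑ i ∈ Finset.range N, a (i + 1) * B ^ i := by
      rw [Finset.mul_sum]
      exact Finset.sum_congr rfl fun i _ => by ring
    have h0 : a 0 = 0 := by
      refine Int.eq_zero_of_abs_lt_dvd (m := B) ?_ (ha 0 N.succ_pos)
      exact ⟨-∑ i ∈ Finset.range N, a (i + 1) * B ^ i, by linear_combination h - h1⟩
    have hB : B ≠ 0 := ((abs_nonneg _).trans_lt (ha 0 N.succ_pos)).ne'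
    rw [h1, h0, zero_mul, add_zero] at h
    have := ih (fun i hi => ha (i + 1) (Nat.succ_lt_succ hi)) ((mul_eq_zero.1 h).resolve_left hB)
    rintro (_ | i) hi
    · exact h0
    · exact this i (Nat.lt_of_succ_lt_succ hi)

namespace TernaryForm

/-- The box with half-sides `X`, `Y`, `Z` contains all vectors on which the positive definite form
`T` takes a value less than `N`. -/
structure IsBox (T : TernaryForm) (N X Y Z : ℕ) : Prop where
  pos_a : 0 < T.a
  pos_c : 0 < T.c
  pos_ab : 0 < 4 * T.a * T.b - T.f ^ 2
  pos_ac : 0 < 4 * T.a * T.c - T.e ^ 2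
  pos_bc : 0 < 4 * T.c * T.b - T.d ^ 2
  pos_disc : 0 < T.disc
  lt_x : (4 * T.c * T.b - T.d ^ 2) * N ≤ T.disc * (X + 1) ^ 2
  lt_y : (4 * T.a * T.c - T.e ^ 2) * N ≤ T.disc * (Y + 1) ^ 2
  lt_z : (4 * T.a * T.b - T.f ^ 2) * N ≤ T.disc * (Z + 1) ^ 2

/-- The values less than `N` of a ternary form on a box, encoded as digits in base `B`. -/
noncomputable def boxSum (T : TernaryForm) (N X Y Z B : ℕ) : ℕ :=
  ∑ x ∈ Finset.Icc (-X : ℤ) X, ∑ y ∈ Finset.Icc (-Y : ℤ) Y, ∑ z ∈ Finset.Icc (-Z : ℤ) Z,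
    if T.a * x ^ 2 + T.b * y ^ 2 + T.c * z ^ 2 + T.d * y * z + T.e * z * x + T.f * x * y < N then
      B ^ (T.a * x ^ 2 + T.b * y ^ 2 + T.c * z ^ 2 + T.d * y * z + T.e * z * x + T.f * x * y).toNat
    else 0

namespace IsBox

variable {T : TernaryForm} {N X Y Z : ℕ}

lemma eval_nonneg (h : T.IsBox N X Y Z) (v : Fin 3 → ℤ) : 0 ≤ T.eval v := by
  have := disc_mul_sq_le (c := T.c) (d := T.d) (e := T.e) h.pos_a h.pos_ab (v 0) (v 1) (v 2)
  refine nonneg_of_mul_nonneg_right ((mul_nonneg h.pos_disc.le (sq_nonneg (v 2))).trans this) h.pos_ab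

lemma mem_Icc (h : T.IsBox N X Y Z) {v : Fin 3 → ℤ} (hv : T.eval v < N) :
    v 0 ∈ Finset.Icc (-X : ℤ) X ∧ v 1 ∈ Finset.Icc (-Y : ℤ) Y ∧ v 2 ∈ Finset.Icc (-Z : ℤ) Z := by
  have key {δ q x : ℤ} {K : ℕ} (hδ : 0 < δ) (h1 : T.disc * x ^ 2 ≤ δ * q) (hq : q < N)
      (h2 : δ * N ≤ T.disc * (K + 1) ^ 2) : x ∈ Finset.Icc (-K : ℤ) K := by
    have h3 : x ^ 2 < (K + 1 : ℤ) ^ 2 :=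
      lt_of_mul_lt_mul_left (h1.trans_lt ((mul_lt_mul_of_pos_left hq hδ).trans_le h2)) h.pos_disc.le
    have := abs_lt_of_sq_lt_sq h3 (by positivity)
    rw [Finset.mem_Icc, ← abs_le]
    exact Int.lt_add_one_iff.1 this
  refine ⟨key h.pos_bc ?_ hv h.lt_x, key h.pos_ac ?_ hv h.lt_y, key h.pos_ab ?_ hv h.lt_z⟩
  · have := disc_mul_sq_le (c := T.a) (d := T.f) (e := T.e) h.pos_c h.pos_bc (v 2) (v 1) (v 0)
    simp only [eval, disc, Int.cast_id]
    linear_combination this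
  · have := disc_mul_sq_le (c := T.b) (d := T.d) (e := T.f) h.pos_a h.pos_ac (v 0) (v 2) (v 1)
    simp only [eval, disc, Int.cast_id]
    linear_combination this
  · have := disc_mul_sq_le (c := T.c) (d := T.d) (e := T.e) h.pos_a h.pos_ab (v 0) (v 1) (v 2)
    simp only [eval, disc, Int.cast_id]
    linear_combination this

lemma count_eq (h : T.IsBox N X Y Z) {m : ℕ} (hm : m < N) :
    T.count m = ((Finset.Icc (-X : ℤ) X ×ˢ Finset.Icc (-Y : ℤ) Y ×ˢ Finset.Icc (-Z : ℤ) Z).filter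
      fun w => T.eval ![w.1, w.2.1, w.2.2] = (m : ℤ)).card := by
  rw [count, ← Set.ncard_coe_finset]
  refine (Set.ncard_congr (fun w _ => ![w.1, w.2.1, w.2.2]) (fun w hw => ?_) ?_ fun v hv => ?_).symm
  · exact (Finset.mem_filter.1 (Finset.mem_coe.1 hw)).2
  · rintro ⟨x, y, z⟩ ⟨x', y', z'⟩ - - e
    have h0 := congrFun e 0
    have h1 := congrFun e 1
    have h2 := congrFun e 2
    simp_all
  · have e : ![v 0, v 1, v 2] = v := by
      ext i; fin_cases i <;> rfl
    rw [Set.mem_ofPred_eq] at hv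
    have := h.mem_Icc (v := v) (by rw [hv]; exact_mod_cast hm)
    refine ⟨(v 0, v 1, v 2), ?_, e⟩
    rw [Finset.mem_coe, Finset.mem_filter]
    exact ⟨Finset.mem_product.2 ⟨this.1, Finset.mem_product.2 this.2⟩, by rw [e, hv]⟩

lemma count_le (h : T.IsBox N X Y Z) {m : ℕ} (hm : m < N) :
    T.count m ≤ (2 * X + 1) * ((2 * Y + 1) * (2 * Z + 1)) := by
  rw [h.count_eq hm]
  refine (Finset.card_filter_le _ _).trans (le_of_eq ?_)
  rw [Finset.card_product, Finset.card_product, Int.card_Icc, Int.card_Icc, Int.card_Icc]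
  congr 1
  · omega
  · congr 1 <;> omega

lemma sum_count_mul_pow (h : T.IsBox N X Y Z) (B : ℕ) :
    ∑ m ∈ Finset.range N, T.count m * B ^ m = T.boxSum N X Y Z B := by
  rw [boxSum, ← Finset.sum_congr rfl fun x _ => Finset.sum_product' (Finset.Icc (-Y : ℤ) Y) _ _, ← Finset.sum_product',
    Finset.sum_congr rfl fun m hm => by
      rw [h.count_eq (Finset.mem_range.1 hm), Finset.card_filter, Finset.sum_mul], Finset.sum_comm]
  refine Finset.sum_congr rfl fun w _ => ?_
  have h0 := h.eval_nonneg ![w.1, w.2.1, w.2.2]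
  change _ = if T.eval ![w.1, w.2.1, w.2.2] < N then B ^ (T.eval ![w.1, w.2.1, w.2.2]).toNat else 0
  generalize T.eval ![w.1, w.2.1, w.2.2] = q at *
  lift q to ℕ using h0
  simp only [Int.toNat_natCast, Nat.cast_inj, Nat.cast_lt, ite_mul, one_mul, zero_mul]
  rw [Finset.sum_ite_eq]
  simp only [Finset.mem_range]

end IsBox

/-- Vanishing of the first coefficients of a linear combination of theta series of ternary forms
from a single evaluation. -/
lemma sum_count_eq_zero_of_boxSum {ι : Type*} [Fintype ι] {T : ι → TernaryForm} {N : ℕ}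
    {X Y Z : ι → ℕ} (hT : ∀ i, (T i).IsBox N (X i) (Y i) (Z i)) (c : ι → ℤ) {B : ℕ}
    (hB : ∑ i, |c i| * ((2 * X i + 1) * ((2 * Y i + 1) * (2 * Z i + 1))) < B)
    (h : ∑ i, c i * (T i).boxSum N (X i) (Y i) (Z i) B = 0) :
    ∀ m < N, ∑ i, c i * ((T i).count m : ℤ) = 0 := by
  refine eq_zero_of_sum_mul_pow (a := fun m => ∑ i, c i * ((T i).count m : ℤ)) (B := B) (fun m hm => ?_) ?_
  · refine (Finset.abs_sum_le_sum_abs _ _).trans_lt (lt_of_le_of_lt (Finset.sum_le_sum fun i _ => ?_) hB)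
    rw [abs_mul, Nat.abs_cast]
    exact mul_le_mul_of_nonneg_left (by exact_mod_cast (hT i).count_le hm) (abs_nonneg _)
  · rw [← h]
    simp only [← (hT _).sum_count_mul_pow, Finset.sum_mul]
    rw [Finset.sum_comm]
    refine Finset.sum_congr rfl fun i _ => ?_
    push_cast
    rw [Finset.mul_sum]
    exact Finset.sum_congr rfl fun m _ => mul_assoc _ _ _

end TernaryForm

end FirstCoefficients

section LinearCombination

namespace TernaryForm

lemma IsLevel.eval_nonneg {T T' : TernaryForm} {M : ℕ} (h : T.IsLevel T' M) (v : Fin 3 → ℤ) :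
    0 ≤ T.eval v := by
  have := disc_mul_sq_le (c := T.c) (d := T.d) (e := T.e) h.pos_one h.pos_two (v 0) (v 1) (v 2)
  exact nonneg_of_mul_nonneg_right ((mul_nonneg h.pos_disc.le (sq_nonneg (v 2))).trans this) h.pos_two

lemma IsLevel.extendCount_eq {T T' : TernaryForm} {M : ℕ} (h : T.IsLevel T' M) (n : ℕ) :
    T.extendCount n = ∑ t ∈ Finset.Icc (-n : ℤ) n, T.count (n - t ^ 2) := by
  classical
  obtain ⟨S, hS⟩ : ∃ S : Finset (Fin 4 → ℤ), ∀ x, x ∈ S ↔ T.extend 1 x = n :=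
    ⟨(h.finite_extend_eq n).toFinset, by simp⟩
  have hcard : T.extendCount n = S.card := by
    rw [extendCount, ← Set.ncard_coe_finset]
    congr 1
    ext x
    simp [hS]
  have hx (x : Fin 4 → ℤ) : T.extend 1 x = T.eval ![x 0, x 1, x 2] + x 3 ^ 2 := by
    simp [extend, eval]
  rw [hcard, Finset.card_eq_sum_card_fiberwise (f := fun x => x 3) (t := Finset.Icc (-n : ℤ) n)]
  · refine Finset.sum_congr rfl fun t _ => ?_
    rw [← Set.ncard_coe_finset, count]
    refine Set.ncard_congr (fun x _ => ![x 0, x 1, x 2]) ?_ ?_ ?_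
    · intro x hx'
      simp only [Finset.coe_filter, hS, Set.mem_ofPred_eq, hx] at hx' ⊢
      rw [← hx'.1, ← hx'.2]
      ring
    · intro x y hx' hy' e
      simp only [Finset.coe_filter, Set.mem_ofPred_eq] at hx' hy'
      have h0 := congrFun e 0
      have h1 := congrFun e 1
      have h2 := congrFun e 2
      ext i
      fin_cases i
      exacts [h0, h1, h2, hx'.2.trans hy'.2.symm]
    · intro v hv
      have e : ![v 0, v 1, v 2] = v := by
        ext i; fin_cases i <;> rfl
      refine ⟨![v 0, v 1, v 2, t], ?_, e⟩
      simp only [Finset.coe_filter, hS, Set.mem_ofPred_eq, hx]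
      refine ⟨?_, rfl⟩
      change T.eval ![v 0, v 1, v 2] + t ^ 2 = n
      rw [e, hv.out]
      ring
  · intro x hx'
    rw [Finset.mem_coe, hS, hx] at hx'
    have := h.eval_nonneg ![x 0, x 1, x 2]
    simp only [Finset.coe_Icc, Set.mem_Icc]
    constructor <;> nlinarith [sq_nonneg (x 3 - 1), sq_nonneg (x 3 + 1), sq_nonneg (x 3)]

lemma IsLevel.count_eq_zero {T T' : TernaryForm} {M : ℕ} (h : T.IsLevel T' M) {m : ℤ} (hm : m < 0) :
    T.count m = 0 := by
  have : {v : Fin 3 → ℤ | T.eval v = m} = ∅ :=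
    Set.eq_empty_of_forall_notMem fun v hv => (h.eval_nonneg v).not_gt (by rw [hv.out]; exact hm)
  rw [count, this, Set.ncard_empty]

open UpperHalfPlane hiding I
open CongruenceSubgroup
open scoped MatrixGroups

/-- A linear combination of theta series of positive definite ternary forms of square discriminant
and level dividing `4p` vanishes once its coefficients up to `p + 1` vanish. -/
theorem sum_count_eq_zero {ι : Type*} [Fintype ι] {T T' : ι → TernaryForm} {p : ℕ} [hp : Fact p.Prime]
    (hp2 : p ≠ 2) (hT : ∀ i, (T i).IsLevel (T' i) p) (c : ι → ℤ)
    (h : ∀ m < p + 2, ∑ i, c i * ((T i).count (m : ℕ) : ℤ) = 0) (m : ℕ) :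
    ∑ i, c i * ((T i).count m : ℤ) = 0 := by
  have hconv (n : ℕ) : ∑ i, c i * ((T i).extendCount n : ℤ) =
      ∑ t ∈ Finset.Icc (-n : ℤ) n, ∑ i, c i * ((T i).count (n - t ^ 2) : ℤ) := by
    rw [Finset.sum_comm]
    refine Finset.sum_congr rfl fun i _ => ?_
    rw [(hT i).extendCount_eq, Nat.cast_sum, Finset.mul_sum]
  have hneg {k : ℤ} (hk : k < 0) : ∑ i, c i * ((T i).count k : ℤ) = 0 :=
    Finset.sum_eq_zero fun i _ => by rw [(hT i).count_eq_zero hk, Nat.cast_zero, mul_zero]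
  have : NeZero (4 * p) := ⟨mul_ne_zero (by norm_num) hp.out.ne_zero⟩
  have hext (n : ℕ) : ∑ i, c i * ((T i).extendCount n : ℤ) = 0 := by
    let g : ModularForm (Gamma0 (4 * p) : Subgroup (GL (Fin 2) ℝ)) 2 :=
      ∑ i, (c i : ℂ) • (hT i).thetaForm
    have hg (τ : ℍ) : HasSum (fun n : ℕ => (∑ i, (c i : ℂ) * ((T i).extendCount n : ℂ)) •
        Function.Periodic.qParam 1 τ ^ n) (g τ) := by
      have e : g τ = ∑ i, (c i : ℂ) • (T i).theta τ := by
        rw [show g τ = (⇑g) τ from rfl, FunLike.coe_sum, Finset.sum_apply]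
        exact Finset.sum_congr rfl fun i _ => rfl
      rw [e]
      convert hasSum_sum fun i (_ : i ∈ Finset.univ) => ((hT i).hasSum_theta τ).const_smul (c i : ℂ) using 1
      ext n
      simp only [smul_eq_mul, Finset.sum_mul, mul_assoc]
    have hindex := index_Gamma0_four_mul_prime_le p hp2
    have := g.coeff_eq_zero hg (m := p + 2) (by omega) (fun n hn => ?_) n
    · exact_mod_cast this
    · have h1 := (hconv n).trans (Finset.sum_eq_zero fun t _ => by
        rcases lt_or_ge ((n : ℤ) - t ^ 2) 0 with hk | hk
        · exact hneg hk
        · obtain ⟨k, hk'⟩ := Int.eq_ofNat_of_zero_le hk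
          rw [hk']
          exact h k (by have := sq_nonneg t; omega))
      exact_mod_cast h1
  induction m using Nat.strong_induction_on with
  | _ m ih =>
    have h1 := hconv m
    rw [hext, Finset.sum_eq_single_of_mem 0 (by simp)] at h1
    · simpa using h1.symm
    · intro t _ ht
      have ht2 : 0 < t ^ 2 := by positivity
      rcases lt_or_ge ((m : ℤ) - t ^ 2) 0 with hk | hk
      · exact hneg hk
      · obtain ⟨k, hk'⟩ := Int.eq_ofNat_of_zero_le hk
        rw [hk']
        exact ih k (by omega)

end TernaryForm

end LinearCombination

section SeventyThree

namespace TernaryForm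

/-- The ternary forms whose theta series are compared at level `73`. -/
def formsSeventyThree : Fin 14 → TernaryForm :=
  ![⟨1, 1, 1, 0, 0, 0⟩, ⟨1, 73, 73, 0, 0, 0⟩, ⟨2, 37, 73, 0, 0, 2⟩, ⟨6, 25, 38, 2, 6, 4⟩,
    ⟨3, 49, 49, 48, -2, 2⟩, ⟨9, 18, 41, 18, 4, 8⟩, ⟨31, 5, 11, 1, -14, 6⟩, ⟨15, 14, 10, 7, 4, 16⟩,
    ⟨11, 7, 20, 7, 2, 4⟩, ⟨7, 11, 21, 11, 2, 4⟩, ⟨31, 20, 44, 4, -28, 12⟩,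
    ⟨15, 56, 40, 28, 8, 32⟩, ⟨11, 28, 80, 28, 4, 8⟩, ⟨7, 44, 84, 44, 4, 8⟩]

/-- The duals at level `73` of the forms in `formsSeventyThree`. -/
def dualsSeventyThree : Fin 14 → TernaryForm :=
  ![⟨73, 73, 73, 0, 0, 0⟩, ⟨73, 1, 1, 0, 0, 0⟩, ⟨37, 2, 1, 0, 0, -2⟩, ⟨13, 3, 2, 0, -2, -2⟩,
    ⟨25, 2, 2, -2, 2, -2⟩, ⟨9, 5, 2, -2, 0, -4⟩, ⟨3, 16, 8, -4, 4, -4⟩, ⟨7, 8, 8, -4, 0, -8⟩,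
    ⟨7, 12, 4, -4, 0, -4⟩, ⟨11, 8, 4, -4, 0, -4⟩, ⟨3, 4, 2, -1, 2, -2⟩,
    ⟨7, 2, 2, -1, 0, -4⟩, ⟨7, 3, 1, -1, 0, -2⟩, ⟨11, 2, 1, -1, 0, -2⟩]

/-- The coefficients of the linear relation between the theta series of `formsSeventyThree`. -/
def coeffsSeventyThree : Fin 14 → ℤ :=
  ![2, -6, -12, -24, -8, -24, -24, -24, -12, -12, 48, 48, 24, 24]

lemma isLevel_formsSeventyThree (i : Fin 14) :
    (formsSeventyThree i).IsLevel (dualsSeventyThree i) 73 := by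
  have hsq (i : Fin 14) : (formsSeventyThree i).disc =
      ![2, 146, 146, 146, 146, 146, 73, 73, 73, 73, 292, 292, 292, 292] i *
        ![2, 146, 146, 146, 146, 146, 73, 73, 73, 73, 292, 292, 292, 292] i := by
    revert i; decide
  constructor
  case square => exact ⟨_, hsq i⟩
  all_goals revert i; decide

/-- Half-sides in the first direction of boxes for `formsSeventyThree`. -/
def sidesX : Fin 14 → ℕ := ![8, 8, 6, 3, 5, 3, 1, 2, 2, 3, 1, 2, 2, 3]

/-- Half-sides in the second direction of boxes for `formsSeventyThree`. -/
def sidesY : Fin 14 → ℕ := ![8, 1, 1, 1, 1, 2, 4, 2, 3, 2, 2, 1, 1, 1]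

/-- Half-sides in the third direction of boxes for `formsSeventyThree`. -/
def sidesZ : Fin 14 → ℕ := ![8, 1, 1, 1, 1, 1, 2, 2, 2, 2, 1, 1, 1, 1]

lemma isBox_formsSeventyThree (i : Fin 14) :
    (formsSeventyThree i).IsBox 75 (sidesX i) (sidesY i) (sidesZ i) := by
  constructor <;> revert i <;> decide

lemma sum_boxSum_formsSeventyThree :
    ∑ i, coeffsSeventyThree i *
      ((formsSeventyThree i).boxSum 75 (sidesX i) (sidesY i) (sidesZ i) (2 ^ 16) : ℤ) = 0 := by
  decide +kernel

theorem sum_count_formsSeventyThree (m : ℕ) :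
    ∑ i, coeffsSeventyThree i * ((formsSeventyThree i).count m : ℤ) = 0 :=
  sum_count_eq_zero (by norm_num) isLevel_formsSeventyThree _
    (sum_count_eq_zero_of_boxSum isBox_formsSeventyThree _ (B := 2 ^ 16) (by decide +kernel)
      sum_boxSum_formsSeventyThree) m

end TernaryForm

end SeventyThree

lemma ncard_triple {p : ℤ → ℤ → ℤ → Prop} :
    Set.ncard {v : ℤ × ℤ × ℤ | p v.1 v.2.1 v.2.2} =
      Set.ncard {v : Fin 3 → ℤ | p (v 0) (v 1) (v 2)} := by
  refine Set.ncard_congr (fun w _ => ![w.1, w.2.1, w.2.2]) (fun w hw => hw) ?_ fun v hv => ?_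
  · rintro ⟨x, y, z⟩ ⟨x', y', z'⟩ - - e
    have h0 := congrFun e 0
    have h1 := congrFun e 1
    have h2 := congrFun e 2
    simp_all
  · refine ⟨(v 0, v 1, v 2), hv, ?_⟩
    ext i; fin_cases i <;> rfl

lemma R_eq_count (a b c d e f : ℤ) (n : ℕ) : R a b c d e f n = TernaryForm.count ⟨a, b, c, d, e, f⟩ n := by
  rw [R, ncard_triple (p := fun x y z => a * x ^ 2 + b * y ^ 2 + c * z ^ 2 + d * y * z +
      e * z * x + f * x * y = (n : ℤ))]
  rfl

lemma s_eq_ncard_dotProduct (n : ℕ) : s n = Set.ncard {v : Fin 3 → ℤ | v ⬝ᵥ v = n} := by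
  rw [s, ncard_triple (p := fun x y z => x ^ 2 + y ^ 2 + z ^ 2 = (n : ℤ))]
  congr 1
  ext v
  simp only [Set.mem_ofPred_eq, dotProduct, Fin.sum_univ_three, sq]

lemma s_eq_R (n : ℕ) : s n = R 1 1 1 0 0 0 n := by
  simp [s, R]

theorem sum_three_squares_73 (n : ℕ) :
    (s (73 ^ 2 * n) : ℤ) - 73 * (s n : ℤ) =
      24 * (R 31 5 11 1 (-14) 6 n : ℤ) + 24 * (R 15 14 10 7 4 16 n : ℤ) +
        12 * (R 11 7 20 7 2 4 n : ℤ) + 12 * (R 7 11 21 11 2 4 n : ℤ) -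
        48 * (R 31 20 44 4 (-28) 12 n : ℤ) - 48 * (R 15 56 40 28 8 32 n : ℤ) -
        24 * (R 11 28 80 28 4 8 n : ℤ) - 24 * (R 7 44 84 44 4 8 n : ℤ) := by
  have hecke := ncard_dotProduct_seventyThree n
  have theta := TernaryForm.sum_count_formsSeventyThree n
  simp only [TernaryForm.coeffsSeventyThree, TernaryForm.formsSeventyThree, Fin.sum_univ_succ,
    Matrix.cons_val_zero, Matrix.cons_val_succ, Finset.univ_eq_empty, Finset.sum_empty,
    ← R_eq_count, ← s_eq_R] at theta
  rw [← s_eq_ncard_dotProduct, show (73 ^ 2 * n : ℤ) = ((73 ^ 2 * n : ℕ) : ℤ) by push_cast; rfl,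
    ← s_eq_ncard_dotProduct] at hecke
  simp only [← R_eq_count] at hecke
  omega
end

section
/- Let p be an odd prime and u an integer with Legendre symbol (−u | p) = −1. Let n be a positive integer, and write n = m·p^j with p ∤ m. Then for every integer t ≥ j + 2, the number N of triples (x,y,z) ∈ (ℤ/p^tℤ)³ with u·x² + p·y² + p·u·z² = n satisfies: if j = 2k is even, then N = p^{2t−k}·(1 − (−m | p)); if j = 2k+1 is odd, then N = p^{2t−k} + p^{2t−k−1}. -/
/-- The number of solutions `(x,y,z)` in `ℤ/p^tℤ` of
`u x² + p y² + p u z² = n`. -/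
noncomputable def cnt (p t : ℕ) (u n : ℤ) : ℕ :=
  Nat.card {v : ZMod (p ^ t) × ZMod (p ^ t) × ZMod (p ^ t) |
    (u : ZMod (p ^ t)) * v.1 ^ 2 + (p : ZMod (p ^ t)) * v.2.1 ^ 2 +
      (p : ZMod (p ^ t)) * (u : ZMod (p ^ t)) * v.2.2 ^ 2 = (n : ZMod (p ^ t))}

open Finset in
theorem sum_range_mul_block (f : ℕ → ℤ) (M d : ℕ) :
    ∑ x ∈ range (M * d), f x = ∑ w ∈ range d, ∑ x ∈ range M, f (x + M * w) := by
  induction d with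
  | zero => simp
  | succ d ih =>
    rw [mul_add_one, sum_range_succ, ← ih, sum_range_add]
    simp [add_comm]

open Finset in
theorem sum_range_mul_of_periodic (f : ℤ → ℤ) (M d : ℕ) (hf : ∀ x w, f (x + M * w) = f x) :
    ∑ x ∈ range (M * d), f x = d * ∑ x ∈ range M, f x := by
  rw [sum_range_mul_block (fun x => f x)]
  simp [hf]

open Finset in
theorem sum_range_mul_of_dvd (f : ℤ → ℤ) (p M : ℕ) (hp : 0 < p)
    (hf : ∀ x, f x ≠ 0 → (p : ℤ) ∣ x) :
    ∑ x ∈ range (p * M), f x = ∑ x ∈ range M, f (p * x) := by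
  rw [sum_range_mul_block (fun x => f x)]
  refine sum_congr rfl fun w _ => ?_
  rw [sum_eq_single_of_mem 0 (by simpa using hp)]
  · simp
  · intro r hr h0
    by_contra h
    have h1 := hf _ h
    push_cast at h1
    rw [Int.dvd_add_left (dvd_mul_right _ _)] at h1
    have h2 := Nat.le_of_dvd (Nat.pos_of_ne_zero h0) (by exact_mod_cast h1)
    simp at hr; omega

theorem sum_zmod_eq_sum_range (q : ℕ) [NeZero q] (g : ZMod q → ℤ) :
    ∑ x, g x = ∑ x ∈ Finset.range q, g ((x : ℤ) : ZMod q) := by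
  refine Finset.sum_nbij' (fun x => x.val) (fun i => (i : ZMod q)) ?_ ?_ ?_ ?_ ?_
  · intro x _; simpa using x.val_lt
  · simp
  · simp
  · intro i hi; exact ZMod.val_cast_of_lt (by simpa using hi)
  · simp

/-- The number of `(x, y, z)` in the box `[0, A) × [0, B) × [0, C)` with
`a x² + b y² + c z² ≡ n` modulo `q`. -/
def boxCount (q : ℕ) (a b c n : ℤ) (A B C : ℕ) : ℤ :=
  ∑ x ∈ Finset.range A, ∑ y ∈ Finset.range B, ∑ z ∈ Finset.range C,
    if (q : ℤ) ∣ a * (x : ℤ) ^ 2 + b * (y : ℤ) ^ 2 + c * (z : ℤ) ^ 2 - n then 1 else 0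

theorem boxCount_eq_sum_zmod (q : ℕ) [NeZero q] (a b c n : ℤ) :
    boxCount q a b c n q q q = ∑ x : ZMod q, ∑ y : ZMod q, ∑ z : ZMod q,
      if (a : ZMod q) * x ^ 2 + b * y ^ 2 + c * z ^ 2 = n then 1 else 0 := by
  simp only [sum_zmod_eq_sum_range, boxCount]
  refine Finset.sum_congr rfl fun x _ => Finset.sum_congr rfl fun y _ =>
    Finset.sum_congr rfl fun z _ => if_congr ?_ rfl rfl
  rw [← ZMod.intCast_zmod_eq_zero_iff_dvd]
  push_cast
  rw [sub_eq_zero]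

theorem cnt_eq_boxCount (p t : ℕ) [Fact p.Prime] (u n : ℤ) :
    (cnt p t u n : ℤ) = boxCount (p ^ t) u p (p * u) n (p ^ t) (p ^ t) (p ^ t) := by
  have : NeZero p := ⟨(Fact.out : p.Prime).ne_zero⟩
  rw [boxCount_eq_sum_zmod, cnt]
  simp only [← Fintype.sum_prod_type']
  rw [Finset.sum_boole, ← Nat.subtype_card]
  simp

theorem boxCount_congr (q q' : ℕ) (a b c n a' b' c' n' : ℤ) (A B C : ℕ)
    (h : ∀ x y z : ℤ, (q : ℤ) ∣ a * x ^ 2 + b * y ^ 2 + c * z ^ 2 - n ↔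
      (q' : ℤ) ∣ a' * x ^ 2 + b' * y ^ 2 + c' * z ^ 2 - n') :
    boxCount q a b c n A B C = boxCount q' a' b' c' n' A B C := by
  unfold boxCount
  simp only [h]

theorem boxCount_cycle (q : ℕ) (a b c n : ℤ) (A B C : ℕ) :
    boxCount q a b c n A B C = boxCount q b c a n B C A := by
  unfold boxCount
  rw [Finset.sum_comm]
  refine Finset.sum_congr rfl fun y _ => ?_
  rw [Finset.sum_comm]
  refine Finset.sum_congr rfl fun z _ => Finset.sum_congr rfl fun x _ => ?_
  rw [show a * (x : ℤ) ^ 2 + b * (y : ℤ) ^ 2 + c * (z : ℤ) ^ 2 - n =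
    b * (y : ℤ) ^ 2 + c * (z : ℤ) ^ 2 + a * (x : ℤ) ^ 2 - n by ring]

theorem boxCount_mul_left (q d : ℕ) (a b c n : ℤ) (B C : ℕ) :
    boxCount q a b c n (q * d) B C = d * boxCount q a b c n q B C := by
  unfold boxCount
  rw [sum_range_mul_of_periodic (fun x => ∑ y ∈ Finset.range B, ∑ z ∈ Finset.range C,
    if (q : ℤ) ∣ a * x ^ 2 + b * (y : ℤ) ^ 2 + c * (z : ℤ) ^ 2 - n then 1 else 0)]
  intro x w
  refine Finset.sum_congr rfl fun y _ => Finset.sum_congr rfl fun z _ => if_congr ?_ rfl rfl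
  rw [show a * (x + q * w) ^ 2 + b * (y : ℤ) ^ 2 + c * (z : ℤ) ^ 2 - n =
    a * x ^ 2 + b * (y : ℤ) ^ 2 + c * (z : ℤ) ^ 2 - n + q * (a * (2 * x * w + q * w ^ 2)) by ring,
    Int.dvd_add_left (dvd_mul_right _ _)]

theorem boxCount_of_dvd_left (p q : ℕ) (hp : 0 < p) (a b c n : ℤ) (A B C : ℕ)
    (h : ∀ x y z : ℤ, (q : ℤ) ∣ a * x ^ 2 + b * y ^ 2 + c * z ^ 2 - n → (p : ℤ) ∣ x) :
    boxCount q a b c n (p * A) B C = boxCount q (a * p ^ 2) b c n A B C := by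
  unfold boxCount
  rw [sum_range_mul_of_dvd (fun x => ∑ y ∈ Finset.range B, ∑ z ∈ Finset.range C,
    if (q : ℤ) ∣ a * x ^ 2 + b * (y : ℤ) ^ 2 + c * (z : ℤ) ^ 2 - n then 1 else 0) p A hp]
  · simp only [mul_pow, mul_assoc]
  · intro x hx
    obtain ⟨y, _, hy⟩ := Finset.exists_ne_zero_of_sum_ne_zero hx
    obtain ⟨z, _, hz⟩ := Finset.exists_ne_zero_of_sum_ne_zero hy
    exact h x y z (by by_contra h0; exact hz (if_neg h0))

theorem boxCount_mul (q : ℕ) (a b c n : ℤ) (A B C : ℕ) :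
    boxCount q a b c n (q * A) (q * B) (q * C) = A * B * C * boxCount q a b c n q q q := by
  rw [boxCount_mul_left, boxCount_cycle, boxCount_mul_left, boxCount_cycle, boxCount_mul_left,
    boxCount_cycle]
  ring

open Finset in
theorem sum_range_mul_block₃ (f : ℕ → ℕ → ℕ → ℤ) (M d : ℕ) :
    ∑ x ∈ range (M * d), ∑ y ∈ range (M * d), ∑ z ∈ range (M * d), f x y z =
      ∑ x ∈ range M, ∑ y ∈ range M, ∑ z ∈ range M,
        ∑ r ∈ range d, ∑ s ∈ range d, ∑ w ∈ range d, f (x + M * r) (y + M * s) (z + M * w) := by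
  have block (g : ℕ → ℤ) : ∑ x ∈ range (M * d), g x =
      ∑ x ∈ range M, ∑ w ∈ range d, g (x + M * w) := by
    rw [sum_range_mul_block, sum_comm]
  simp only [block]
  refine sum_congr rfl fun x _ => ?_
  rw [sum_comm]
  refine sum_congr rfl fun y _ => ?_
  rw [sum_comm (s := range M)]
  exact sum_congr rfl fun r _ => sum_comm

theorem sum_affine_eq_zero {F : Type*} [Field F] [Fintype F] [DecidableEq F] (e a b c : F)
    (h : a ≠ 0 ∨ b ≠ 0 ∨ c ≠ 0) :
    ∑ x : F, ∑ y : F, ∑ z : F, (if e + a * x + b * y + c * z = 0 then (1 : ℤ) else 0) =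
      (Fintype.card F : ℤ) ^ 2 := by
  have one (e a : F) (ha : a ≠ 0) : ∑ x : F, (if e + a * x = 0 then (1 : ℤ) else 0) = 1 := by
    rw [Finset.sum_eq_single_of_mem (-e / a) (Finset.mem_univ _)]
    · rw [if_pos (by field_simp; ring)]
    · intro x _ hx
      rw [if_neg]
      intro h0
      exact hx (by rw [eq_div_iff ha]; linear_combination h0)
  have two (e a b c : F) (hc : c ≠ 0) :
      ∑ x : F, ∑ y : F, ∑ z : F, (if e + a * x + b * y + c * z = 0 then (1 : ℤ) else 0) =
        (Fintype.card F : ℤ) ^ 2 := by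
    simp [one _ c hc, sq]
  have cycle (e a b c : F) :
      ∑ x : F, ∑ y : F, ∑ z : F, (if e + a * x + b * y + c * z = 0 then (1 : ℤ) else 0) =
      ∑ x : F, ∑ y : F, ∑ z : F, (if e + b * x + c * y + a * z = 0 then (1 : ℤ) else 0) := by
    rw [Finset.sum_comm]
    refine Finset.sum_congr rfl fun y _ => ?_
    rw [Finset.sum_comm]
    refine Finset.sum_congr rfl fun z _ => Finset.sum_congr rfl fun x _ => ?_
    rw [show e + a * x + b * y + c * z = e + b * y + c * z + a * x by ring]
  rcases h with h | h | h
  · rw [cycle]; exact two _ _ _ _ h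
  · rw [cycle, cycle]; exact two _ _ _ _ h
  · exact two _ _ _ _ h

theorem boxCount_pow_succ (p : ℕ) [Fact p.Prime] (hp : p ≠ 2) (a b c n : ℤ) (hn : ¬ (p : ℤ) ∣ n)
    (t : ℕ) (ht : 1 ≤ t) :
    boxCount (p ^ (t + 1)) a b c n (p ^ (t + 1)) (p ^ (t + 1)) (p ^ (t + 1)) =
      p ^ 2 * boxCount (p ^ t) a b c n (p ^ t) (p ^ t) (p ^ t) := by
  unfold boxCount
  rw [pow_succ, sum_range_mul_block₃]
  simp only [Finset.mul_sum]
  refine Finset.sum_congr rfl fun x _ => Finset.sum_congr rfl fun y _ =>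
    Finset.sum_congr rfl fun z _ => ?_
  obtain ⟨s, rfl⟩ : ∃ s, t = s + 1 := ⟨t - 1, by omega⟩
  have hp0 : (p : ℤ) ≠ 0 := by exact_mod_cast (Fact.out : p.Prime).ne_zero
  have expand (X Y Z : ℤ) :
      a * (x + p ^ (s + 1) * X) ^ 2 + b * (y + p ^ (s + 1) * Y) ^ 2 +
        c * (z + p ^ (s + 1) * Z) ^ 2 - n =
      (a * (x : ℤ) ^ 2 + b * (y : ℤ) ^ 2 + c * (z : ℤ) ^ 2 - n) + p ^ (s + 1) *
        (2 * a * x * X + 2 * b * y * Y + 2 * c * z * Z +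
          p * (p ^ s * (a * X ^ 2 + b * Y ^ 2 + c * Z ^ 2))) := by ring
  push_cast
  simp only [expand]
  by_cases hd : (p : ℤ) ^ (s + 1) ∣ a * (x : ℤ) ^ 2 + b * (y : ℤ) ^ 2 + c * (z : ℤ) ^ 2 - n
  · obtain ⟨e, he⟩ := hd
    rw [he, if_pos (dvd_mul_right _ _), mul_one]
    have key (X Y Z : ℤ) : ((p : ℤ) ^ (s + 1) * p ∣ p ^ (s + 1) * e + p ^ (s + 1) *
        (2 * a * x * X + 2 * b * y * Y + 2 * c * z * Z +
          p * (p ^ s * (a * X ^ 2 + b * Y ^ 2 + c * Z ^ 2)))) ↔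
        (e : ZMod p) + ((2 * a * x : ℤ) : ZMod p) * X + ((2 * b * y : ℤ) : ZMod p) * Y +
          ((2 * c * z : ℤ) : ZMod p) * Z = 0 := by
      rw [← mul_add, mul_dvd_mul_iff_left (pow_ne_zero _ hp0), ← add_assoc,
        Int.dvd_add_left (dvd_mul_right _ _), ← ZMod.intCast_zmod_eq_zero_iff_dvd]
      push_cast
      simp only [add_assoc]
    simp only [key]
    have := sum_affine_eq_zero (e : ZMod p) ((2 * a * x : ℤ) : ZMod p) ((2 * b * y : ℤ) : ZMod p)
      ((2 * c * z : ℤ) : ZMod p) ?_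
    · simp only [sum_zmod_eq_sum_range, ZMod.card] at this
      exact this
    · by_contra! h
      simp only [ZMod.intCast_zmod_eq_zero_iff_dvd] at h
      obtain ⟨h1, h2, h3⟩ := h
      have h4 : (p : ℤ) ∣ 2 * n := by
        have : 2 * n = 2 * a * x * x + 2 * b * y * y + 2 * c * z * z - p * (2 * p ^ s * e) := by
          linear_combination -2 * he
        rw [this]
        exact dvd_sub (dvd_add (dvd_add (h1.mul_right _) (h2.mul_right _)) (h3.mul_right _))
          (dvd_mul_right _ _)
      rcases (Nat.prime_iff_prime_int.mp Fact.out).dvd_or_dvd h4 with h5 | h5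
      · exact hp ((Nat.prime_dvd_prime_iff_eq Fact.out Nat.prime_two).mp (by exact_mod_cast h5))
      · exact hn h5
  · rw [if_neg hd, mul_zero]
    refine Finset.sum_eq_zero fun X _ => Finset.sum_eq_zero fun Y _ =>
      Finset.sum_eq_zero fun Z _ => if_neg fun h => hd ?_
    exact (Int.dvd_add_left (dvd_mul_right _ _)).mp ((dvd_mul_right _ _).trans h)

theorem boxCount_pow (p : ℕ) [Fact p.Prime] (hp : p ≠ 2) (a b c n : ℤ) (hn : ¬ (p : ℤ) ∣ n)
    (t : ℕ) :
    boxCount (p ^ (t + 1)) a b c n (p ^ (t + 1)) (p ^ (t + 1)) (p ^ (t + 1)) =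
      p ^ (2 * t) * boxCount p a b c n p p p := by
  induction t with
  | zero => simp
  | succ t ih => rw [boxCount_pow_succ p hp a b c n hn _ (by omega), ih]; ring

theorem boxCount_prime_of_sq (p : ℕ) [Fact p.Prime] (hp : p ≠ 2) (u m : ℤ)
    (hu : legendreSym p (-u) = -1) :
    boxCount p u p (p * u) m p p p = p ^ 2 * (1 - legendreSym p (-m)) := by
  have hu0 : (u : ZMod p) ≠ 0 := by
    intro h
    have : legendreSym p (-u) = 0 := by rw [legendreSym.eq_zero_iff]; simp [h]
    omega
  have h1 : ∑ x : ZMod p, (if (u : ZMod p) * x ^ 2 = m then (1 : ℤ) else 0) =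
      legendreSym p (u * m) + 1 := by
    rw [← legendreSym.card_sqrts p hp, Finset.sum_boole]
    norm_cast
    refine Finset.card_bij (fun x _ => u * x) ?_ ?_ ?_
    · intro x hx
      simp at hx ⊢
      rw [← hx]; ring
    · intro x _ y _ h
      exact mul_left_cancel₀ hu0 h
    · intro x hx
      refine ⟨x / u, ?_, by field_simp⟩
      simp at hx ⊢
      field_simp
      exact hx
  have h2 : legendreSym p (u * m) = - legendreSym p (-m) := by
    rw [← neg_mul_neg, legendreSym.mul, hu, neg_one_mul]
  rw [boxCount_eq_sum_zmod]
  simp only [Finset.sum_const, Finset.card_univ, ZMod.card, nsmul_eq_mul, Int.cast_natCast,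
    Int.cast_mul, CharP.cast_eq_zero, zero_mul, add_zero, ← Finset.mul_sum, h1, h2]
  ring

theorem card_norm_form {F : Type*} [Field F] [Fintype F] [DecidableEq F] (hF : ringChar F ≠ 2)
    (u : F) (hu : ∀ y z : F, y ^ 2 + u * z ^ 2 = 0 → y = 0 ∧ z = 0) (m : F) (hm : m ≠ 0) :
    (Finset.univ.filter fun v : F × F => v.1 ^ 2 + u * v.2 ^ 2 = m).card = Fintype.card F + 1 := by
  set N : F → ℕ := fun m => (Finset.univ.filter fun v : F × F => v.1 ^ 2 + u * v.2 ^ 2 = m).card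
    with hN
  have hu0 : u ≠ 0 := fun h => one_ne_zero (hu 0 1 (by simp [h])).2
  have surj (m : F) : ∃ y z : F, y ^ 2 + u * z ^ 2 = m := by
    obtain ⟨y, z, h⟩ := FiniteField.exists_root_sum_quadratic
      (f := Polynomial.X ^ 2 - Polynomial.C m) (g := Polynomial.C u * Polynomial.X ^ 2)
      (by compute_degree!) (by compute_degree!)
      (FiniteField.odd_card_of_char_ne_two hF)
    simp at h
    exact ⟨y, z, by linear_combination h⟩
  have mono (m d : F) (hd : d ≠ 0) : N m ≤ N (d * m) := by
    obtain ⟨y, z, h⟩ := surj d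
    refine Finset.card_le_card_of_injOn
      (fun v => (y * v.1 - u * z * v.2, y * v.2 + z * v.1)) ?_ ?_
    · intro v hv
      simp at hv ⊢
      rw [← hv, ← h]; ring
    · rintro ⟨a, b⟩ _ ⟨a', b'⟩ _ hv
      simp at hv
      obtain ⟨h1, h2⟩ := hv
      ext
      · apply mul_left_cancel₀ hd
        simp only [← h]
        linear_combination y * h1 + u * z * h2
      · apply mul_left_cancel₀ hd
        simp only [← h]
        linear_combination y * h2 - z * h1
  have const (d : F) (hd : d ≠ 0) : N d = N m := by
    apply le_antisymm
    · simpa [hd] using mono d (m / d) (div_ne_zero hm hd)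
    · simpa [hm] using mono m (d / m) (div_ne_zero hd hm)
  have zero : N 0 = 1 := by
    rw [hN, Finset.card_eq_one]
    refine ⟨(0, 0), ?_⟩
    ext ⟨y, z⟩
    simp
    exact ⟨hu y z, by rintro ⟨rfl, rfl⟩; simp⟩
  have total : ∑ d : F, N d = Fintype.card F ^ 2 := by
    rw [← Finset.card_eq_sum_card_fiberwise (s := Finset.univ)
      (f := fun v : F × F => v.1 ^ 2 + u * v.2 ^ 2) (by simp)]
    simp [sq]
  rw [← Finset.add_sum_erase _ _ (Finset.mem_univ 0), zero,
    Finset.sum_congr rfl fun d hd => const d (Finset.ne_of_mem_erase hd)] at total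
  simp [Finset.card_erase_of_mem] at total
  have h1 : 1 < Fintype.card F := Fintype.one_lt_card
  obtain ⟨k, hk⟩ : ∃ k, Fintype.card F = k + 2 := ⟨_, (Nat.sub_add_cancel h1).symm⟩
  change N m = _
  rw [hk] at total ⊢
  apply Nat.eq_of_mul_eq_mul_left (show 0 < k + 1 by omega)
  simp at total
  nlinarith

theorem dvd_of_dvd_sq_add (p : ℕ) [Fact p.Prime] (u : ℤ) (hu : legendreSym p (-u) = -1)
    (y z : ℤ) (h : (p : ℤ) ∣ y ^ 2 + u * z ^ 2) : (p : ℤ) ∣ y ∧ (p : ℤ) ∣ z :=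
  legendreSym.prime_dvd_of_eq_neg_one hu (by simpa using h)

theorem boxCount_prime_of_norm (p : ℕ) [Fact p.Prime] (hp : p ≠ 2) (u m : ℤ)
    (hu : legendreSym p (-u) = -1) (hm : ¬ (p : ℤ) ∣ m) :
    boxCount p (p * u) 1 u m p p p = p * (p + 1) := by
  rw [boxCount_eq_sum_zmod]
  have h := card_norm_form (F := ZMod p) (by rwa [ZMod.ringChar_zmod_n]) u ?_ m
    (by rwa [Ne, ZMod.intCast_zmod_eq_zero_iff_dvd])
  · have h' := congrArg (Nat.cast : ℕ → ℤ) h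
    rw [← Finset.sum_boole, Fintype.sum_prod_type] at h'
    simp at h' ⊢
    simp [h']
  · intro y z hyz
    obtain ⟨y, rfl⟩ := ZMod.intCast_surjective y
    obtain ⟨z, rfl⟩ := ZMod.intCast_surjective z
    simp only [ZMod.intCast_zmod_eq_zero_iff_dvd]
    exact dvd_of_dvd_sq_add p u hu y z
      ((ZMod.intCast_zmod_eq_zero_iff_dvd _ _).mp (by simpa using hyz))

/-- Dividing a solution of `u x² + p y² + p u z² ≡ p n` through by `p`, using `p ∣ x`. -/
theorem boxCount_mul_prime (p : ℕ) [Fact p.Prime] (u n : ℤ) (hu : legendreSym p (-u) = -1)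
    (t A B C : ℕ) :
    boxCount (p ^ (t + 1)) u p (p * u) (p * n) (p * A) B C =
      boxCount (p ^ t) (p * u) 1 u n A B C := by
  have hP : Prime (p : ℤ) := Nat.prime_iff_prime_int.mp Fact.out
  have hu0 : ¬ (p : ℤ) ∣ u := by
    intro h
    have : legendreSym p (-u) = 0 := by
      rw [legendreSym.eq_zero_iff, ZMod.intCast_zmod_eq_zero_iff_dvd]; simpa using h
    omega
  rw [boxCount_of_dvd_left p _ (Fact.out : p.Prime).pos]
  · refine boxCount_congr _ _ _ _ _ _ _ _ _ _ _ _ _ fun x y z => ?_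
    rw [show u * (p : ℤ) ^ 2 * x ^ 2 + p * y ^ 2 + p * u * z ^ 2 - p * n =
      p * (p * u * x ^ 2 + 1 * y ^ 2 + u * z ^ 2 - n) by ring]
    push_cast
    rw [pow_succ', mul_dvd_mul_iff_left hP.ne_zero]
  · intro x y z h
    push_cast at h
    have h1 := (dvd_pow_self (p : ℤ) t.succ_ne_zero).trans h
    rw [show u * x ^ 2 + p * y ^ 2 + p * u * z ^ 2 - p * n =
      u * x ^ 2 + p * (y ^ 2 + u * z ^ 2 - n) by ring, Int.dvd_add_left (dvd_mul_right _ _)] at h1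
    exact hP.dvd_of_dvd_pow ((hP.dvd_or_dvd h1).resolve_left hu0)

/-- Dividing a solution of `p u x² + y² + u z² ≡ p n` through by `p`, using `p ∣ y` and `p ∣ z`. -/
theorem boxCount_norm_mul_prime (p : ℕ) [Fact p.Prime] (u n : ℤ) (hu : legendreSym p (-u) = -1)
    (t A B C : ℕ) :
    boxCount (p ^ (t + 1)) (p * u) 1 u (p * n) A (p * B) (p * C) =
      boxCount (p ^ t) u p (p * u) n A B C := by
  have hP : Prime (p : ℤ) := Nat.prime_iff_prime_int.mp Fact.out
  have hdvd (x y z : ℤ)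
      (h : ((p ^ (t + 1) : ℕ) : ℤ) ∣ p * u * x ^ 2 + 1 * y ^ 2 + u * z ^ 2 - p * n) :
      (p : ℤ) ∣ y ∧ (p : ℤ) ∣ z := by
    push_cast at h
    have h1 := (dvd_pow_self (p : ℤ) t.succ_ne_zero).trans h
    rw [show p * u * x ^ 2 + 1 * y ^ 2 + u * z ^ 2 - p * n =
      y ^ 2 + u * z ^ 2 + p * (u * x ^ 2 - n) by ring, Int.dvd_add_left (dvd_mul_right _ _)] at h1
    exact dvd_of_dvd_sq_add p u hu y z h1
  rw [boxCount_cycle, boxCount_of_dvd_left p _ (Fact.out : p.Prime).pos, boxCount_cycle,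
    boxCount_of_dvd_left p _ (Fact.out : p.Prime).pos, boxCount_cycle]
  · refine boxCount_congr _ _ _ _ _ _ _ _ _ _ _ _ _ fun x y z => ?_
    rw [show p * u * x ^ 2 + 1 * (p : ℤ) ^ 2 * y ^ 2 + u * (p : ℤ) ^ 2 * z ^ 2 - p * n =
      p * (u * x ^ 2 + p * y ^ 2 + p * u * z ^ 2 - n) by ring]
    push_cast
    rw [pow_succ', mul_dvd_mul_iff_left hP.ne_zero]
  · intro z x y h
    exact (hdvd x (p * y) z (by convert h using 1; ring)).2
  · intro y z x h
    exact (hdvd x y z (by convert h using 1; ring)).1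

theorem boxCount_mul_prime_sq (p : ℕ) [Fact p.Prime] (u n : ℤ) (hu : legendreSym p (-u) = -1)
    (t : ℕ) :
    boxCount (p ^ (t + 2)) u p (p * u) (p ^ 2 * n) (p ^ (t + 2)) (p ^ (t + 2)) (p ^ (t + 2)) =
      p ^ 3 * boxCount (p ^ t) u p (p * u) n (p ^ t) (p ^ t) (p ^ t) := by
  have h1 := boxCount_mul_prime p u (p * n) hu (t + 1) (p ^ (t + 1)) (p ^ (t + 2)) (p ^ (t + 2))
  have h2 := boxCount_norm_mul_prime p u n hu t (p ^ t * p) (p ^ t * p) (p ^ t * p)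
  rw [boxCount_mul] at h2
  rw [← pow_succ', ← mul_assoc, ← sq] at h1
  rw [← pow_succ, ← pow_succ'] at h2
  rw [h1, h2]
  ring

theorem boxCount_even (p : ℕ) [Fact p.Prime] (hp : p ≠ 2) (u m : ℤ)
    (hu : legendreSym p (-u) = -1) (hm : ¬ (p : ℤ) ∣ m) (k s : ℕ) :
    boxCount (p ^ (2 * k + s + 1)) u p (p * u) (m * p ^ (2 * k)) (p ^ (2 * k + s + 1))
      (p ^ (2 * k + s + 1)) (p ^ (2 * k + s + 1)) =
      p ^ (3 * k + 2 * s + 2) * (1 - legendreSym p (-m)) := by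
  induction k with
  | zero =>
    simp only [mul_zero, zero_add, pow_zero, mul_one]
    rw [boxCount_pow p hp _ _ _ _ hm, boxCount_prime_of_sq p hp u m hu]
    ring
  | succ k ih =>
    rw [show m * (p : ℤ) ^ (2 * (k + 1)) = p ^ 2 * (m * p ^ (2 * k)) by ring,
      show 2 * (k + 1) + s + 1 = 2 * k + s + 1 + 2 by ring, boxCount_mul_prime_sq p u _ hu, ih]
    ring

theorem boxCount_odd (p : ℕ) [Fact p.Prime] (hp : p ≠ 2) (u m : ℤ)
    (hu : legendreSym p (-u) = -1) (hm : ¬ (p : ℤ) ∣ m) (k s : ℕ) :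
    boxCount (p ^ (2 * k + s + 2)) u p (p * u) (m * p ^ (2 * k + 1)) (p ^ (2 * k + s + 2))
      (p ^ (2 * k + s + 2)) (p ^ (2 * k + s + 2)) =
      p ^ (3 * k + 2 * s + 3) * (p + 1) := by
  induction k with
  | zero =>
    have h1 := boxCount_mul_prime p u m hu (s + 1) (p ^ (s + 1) * 1) (p ^ (s + 1) * p)
      (p ^ (s + 1) * p)
    rw [boxCount_mul, boxCount_pow p hp _ _ _ _ hm, boxCount_prime_of_norm p hp u m hu hm,
      mul_one, ← pow_succ, ← pow_succ'] at h1
    simp only [mul_zero, zero_add, pow_one]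
    rw [mul_comm m, h1]
    push_cast
    ring
  | succ k ih =>
    rw [show m * (p : ℤ) ^ (2 * (k + 1) + 1) = p ^ 2 * (m * p ^ (2 * k + 1)) by ring,
      show 2 * (k + 1) + s + 2 = 2 * k + s + 2 + 2 by ring, boxCount_mul_prime_sq p u _ hu, ih]
    ring

theorem local_count (p : ℕ) [Fact p.Prime] (hp : p ≠ 2) (u : ℤ)
    (hu : legendreSym p (-u) = -1) (n : ℤ) (hn : 0 < n) (m : ℤ) (j : ℕ)
    (hnm : n = m * (p : ℤ) ^ j) (hm : ¬ ((p : ℤ) ∣ m)) (t : ℕ) (ht : j + 2 ≤ t) :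
    (∀ k : ℕ, j = 2 * k →
      (cnt p t u n : ℤ) = (p : ℤ) ^ (2 * t - k) * (1 - legendreSym p (-m))) ∧
    (∀ k : ℕ, j = 2 * k + 1 →
      (cnt p t u n : ℤ) = (p : ℤ) ^ (2 * t - k) + (p : ℤ) ^ (2 * t - k - 1)) := by
  subst hnm
  rw [cnt_eq_boxCount]
  constructor
  · rintro k rfl
    obtain ⟨s, rfl⟩ : ∃ s, t = 2 * k + s + 1 := ⟨t - (2 * k + 1), by omega⟩
    rw [boxCount_even p hp u m hu hm,
      show 2 * (2 * k + s + 1) - k = 3 * k + 2 * s + 2 by omega]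
  · rintro k rfl
    obtain ⟨s, rfl⟩ : ∃ s, t = 2 * k + s + 2 := ⟨t - (2 * k + 2), by omega⟩
    rw [boxCount_odd p hp u m hu hm,
      show 2 * (2 * k + s + 2) - k = 3 * k + 2 * s + 3 + 1 by omega, Nat.add_sub_cancel]
    ring
end

section
/- Let n = 4^a·k be a positive integer with 4 ∤ k. Then there exists T such that for all integers t ≥ T, the number of triples (x,y,z) ∈ (ℤ/2^tℤ)³ with 4·y·z − x² = n equals: 3·2^{2t} if k ≡ 7 (mod 8); 3·2^{2t} − 2^{2t+1−a} if k ≡ 3 (mod 8); and 3·2^{2t} − 3·2^{2t−a} if k ≡ 1 or 2 (mod 4). -/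
/-- The number of solutions `(x,y,z)` in `ℤ/2^tℤ` of `y z - x² = n`. -/
noncomputable def cntG1 (t : ℕ) (n : ℤ) : ℕ :=
  Nat.card {v : ZMod (2 ^ t) × ZMod (2 ^ t) × ZMod (2 ^ t) |
    v.2.1 * v.2.2 - v.1 ^ 2 = (n : ZMod (2 ^ t))}

/-- The number of solutions `(x,y,z)` in `ℤ/2^tℤ` of `4 y z - x² = n`. -/
noncomputable def cntG2 (t : ℕ) (n : ℤ) : ℕ :=
  Nat.card {v : ZMod (2 ^ t) × ZMod (2 ^ t) × ZMod (2 ^ t) |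
    4 * v.2.1 * v.2.2 - v.1 ^ 2 = (n : ZMod (2 ^ t))}

/-- A map all of whose fibres over `T` have `c` elements multiplies cardinality by `c`. -/
lemma ncard_eq_mul_of_fibers {A B : Type*} [Finite A] [Finite B] (f : A → B) {S : Set A}
    {T : Set B} (c : ℕ) (hf : ∀ a ∈ S, f a ∈ T)
    (hc : ∀ b ∈ T, {a | a ∈ S ∧ f a = b}.ncard = c) : S.ncard = c * T.ncard := by
  classical
  have := Fintype.ofFinite A
  have := Fintype.ofFinite B
  rw [Set.ncard_eq_toFinset_card' S, Set.ncard_eq_toFinset_card' T,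
    Finset.card_eq_sum_card_fiberwise (f := f) (t := T.toFinset) (by intro a; simpa using hf a),
    Finset.sum_const_nat (m := c), mul_comm]
  intro b hb
  rw [← hc b (by simpa using hb), Set.ncard_eq_toFinset_card']
  congr 1
  ext a
  simp

lemma ncard_preimage_mul_card {A B : Type*} [AddGroup A] [AddGroup B] [Finite A] [Finite B]
    (f : A →+ B) (hf : Function.Surjective f) (S : Set B) :
    (f ⁻¹' S).ncard * Nat.card B = Nat.card A * S.ncard := by
  have key (S : Set B) : (f ⁻¹' S).ncard = {a | f a = 0}.ncard * S.ncard := by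
    refine ncard_eq_mul_of_fibers f _ (fun a ha => ha) fun b hb => ?_
    obtain ⟨a, rfl⟩ := hf b
    rw [← Set.ncard_image_of_injective {x | f x = 0} (add_right_injective a)]
    congr 1
    ext x
    simp only [Set.mem_preimage, Set.mem_ofPred_eq, Set.mem_image]
    constructor
    · rintro ⟨-, h⟩
      exact ⟨-a + x, by simp [h], by simp⟩
    · rintro ⟨y, hy, rfl⟩
      simp [hy, hb]
  have huniv := key Set.univ
  rw [Set.preimage_univ, Set.ncard_univ, Set.ncard_univ] at huniv
  rw [key S, huniv]
  ring

namespace ZMod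

lemma even_or_odd_two_pow {t : ℕ} (x : ZMod (2 ^ t)) : Even x ∨ Odd x := by
  obtain ⟨a, rfl⟩ := ZMod.intCast_surjective x
  exact (Int.even_or_odd a).imp (fun h => h.map (Int.castRingHom _))
    (fun h => h.map (Int.castRingHom _))

lemma isNilpotent_two_two_pow (t : ℕ) : IsNilpotent (2 : ZMod (2 ^ t)) :=
  ⟨t, by exact_mod_cast ZMod.natCast_self (2 ^ t)⟩

lemma isUnit_of_odd_two_pow {t : ℕ} {x : ZMod (2 ^ t)} (h : Odd x) : IsUnit x := by
  obtain ⟨r, rfl⟩ := h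
  exact ((Commute.all _ _).isNilpotent_mul_right (isNilpotent_two_two_pow t)).isUnit_add_one

lemma not_odd_of_even_two_pow {m : ℕ} {x : ZMod (2 ^ (m + 1))} (h : Even x) : ¬ Odd x := by
  intro h'
  have : Fact (1 < 2 ^ (m + 1)) := ⟨Nat.one_lt_two_pow (by omega)⟩
  obtain ⟨r, hr⟩ := h
  have hn : IsNilpotent x := by
    rw [hr, ← two_mul]
    exact (Commute.all _ _).isNilpotent_mul_right (isNilpotent_two_two_pow _)
  obtain ⟨k, hk⟩ := hn
  exact ((isUnit_of_odd_two_pow h').pow k).ne_zero hk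

lemma not_even_iff_odd_two_pow {m : ℕ} {x : ZMod (2 ^ (m + 1))} : ¬ Even x ↔ Odd x :=
  ⟨(even_or_odd_two_pow x).resolve_left, fun h h' => not_odd_of_even_two_pow h' h⟩

lemma two_mul_eq_zero_two_pow {m : ℕ} {d : ZMod (2 ^ (m + 1))} :
    2 * d = 0 ↔ d = 0 ∨ d = 2 ^ m := by
  constructor
  · intro h
    obtain ⟨a, rfl⟩ := ZMod.intCast_surjective d
    have h1 : ((2 * a : ℤ) : ZMod (2 ^ (m + 1))) = 0 := by push_cast; exact h
    rw [ZMod.intCast_zmod_eq_zero_iff_dvd] at h1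
    obtain ⟨q, hq⟩ := h1
    push_cast at hq
    have ha : a = 2 ^ m * q := by rw [pow_succ] at hq; linarith
    have h0 : (2 : ZMod (2 ^ (m + 1))) ^ m * 2 = 0 := by
      rw [← pow_succ]; exact_mod_cast ZMod.natCast_self (2 ^ (m + 1))
    obtain ⟨r, rfl⟩ | ⟨r, rfl⟩ := Int.even_or_odd q
    · left
      rw [ha]; push_cast
      linear_combination (r : ZMod (2 ^ (m + 1))) * h0
    · right
      rw [ha]; push_cast
      linear_combination (r : ZMod (2 ^ (m + 1))) * h0
  · rintro (rfl | rfl)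
    · simp
    · rw [← pow_succ']; exact_mod_cast ZMod.natCast_self (2 ^ (m + 1))

lemma two_pow_ne_zero_two_pow (m : ℕ) : (2 : ZMod (2 ^ (m + 1))) ^ m ≠ 0 := by
  intro h
  have h1 : ((2 ^ m : ℕ) : ZMod (2 ^ (m + 1))) = 0 := by exact_mod_cast h
  rw [ZMod.natCast_eq_zero_iff, Nat.pow_dvd_pow_iff_le_right (by norm_num)] at h1
  omega

/-- The substitution `x = 2 w + e` in one coordinate doubles the number of points. -/
lemma ncard_two_mul_add {m : ℕ} {B C : Type*} [Finite B] [Finite C]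
    (g : ZMod (2 ^ (m + 1)) × B ≃ C) (e : ZMod (2 ^ (m + 1))) (T : Set C)
    (hT : ∀ c ∈ T, ∃ w, (g.symm c).1 = 2 * w + e) :
    {v : ZMod (2 ^ (m + 1)) × B | g (2 * v.1 + e, v.2) ∈ T}.ncard = 2 * T.ncard := by
  refine ncard_eq_mul_of_fibers (fun v : ZMod (2 ^ (m + 1)) × B => g (2 * v.1 + e, v.2)) _
    (fun v hv => hv) ?_
  intro c hc
  obtain ⟨w, hw⟩ := hT c hc
  have hc' : c = g (2 * w + e, (g.symm c).2) := by rw [← hw]; simp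
  refine Eq.trans ?_ (Set.ncard_pair (a := (w, (g.symm c).2)) (b := (w + 2 ^ m, (g.symm c).2)) ?_)
  · congr 1
    ext ⟨u, b⟩
    simp only [Set.mem_ofPred_eq, Set.mem_insert_iff, Set.mem_singleton_iff, Prod.mk.injEq]
    have hiff : g (2 * u + e, b) = c ↔ (u = w ∨ u = w + 2 ^ m) ∧ b = (g.symm c).2 := by
      conv_lhs => rw [hc']
      rw [g.apply_eq_iff_eq, Prod.mk.injEq, add_left_inj, ← sub_eq_zero, ← mul_sub,
        two_mul_eq_zero_two_pow, sub_eq_zero, sub_eq_iff_eq_add']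
    rw [← or_and_right, ← hiff]
    exact ⟨fun h => h.2, fun h => ⟨h ▸ hc, h⟩⟩
  · simpa using two_pow_ne_zero_two_pow m

lemma two_mul_ncard_even (m : ℕ) : 2 * {x : ZMod (2 ^ (m + 1)) | Even x}.ncard = 2 ^ (m + 1) := by
  rw [← ncard_two_mul_add (Equiv.prodPUnit.{0} (ZMod (2 ^ (m + 1)))) 0]
  · simp [Set.ncard_univ]
  · rintro c ⟨w, rfl⟩
    exact ⟨w, by simp [two_mul]⟩

lemma two_mul_ncard_odd (m : ℕ) : 2 * {x : ZMod (2 ^ (m + 1)) | Odd x}.ncard = 2 ^ (m + 1) := by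
  rw [← ncard_two_mul_add (Equiv.prodPUnit.{0} (ZMod (2 ^ (m + 1)))) 1]
  · simp [Set.ncard_univ]
  · rintro c ⟨w, rfl⟩
    exact ⟨w, by simp⟩

lemma four_mul_eq_four_mul_iff {s : ℕ} (u v : ZMod (2 ^ (s + 2))) :
    4 * u = 4 * v ↔ ZMod.castHom (pow_dvd_pow 2 (Nat.le_add_right s 2)) (ZMod (2 ^ s)) u =
      ZMod.castHom (pow_dvd_pow 2 (Nat.le_add_right s 2)) (ZMod (2 ^ s)) v := by
  obtain ⟨a, rfl⟩ := ZMod.intCast_surjective u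
  obtain ⟨b, rfl⟩ := ZMod.intCast_surjective v
  rw [map_intCast, map_intCast]
  have h : ((4 * a : ℤ) : ZMod (2 ^ (s + 2))) = ((4 * b : ℤ) : ZMod (2 ^ (s + 2))) ↔
      (a : ZMod (2 ^ s)) = b := by
    rw [ZMod.intCast_eq_intCast_iff_dvd_sub, ZMod.intCast_eq_intCast_iff_dvd_sub, ← mul_sub]
    push_cast
    rw [pow_add, mul_comm (2 ^ s : ℤ)]
    exact mul_dvd_mul_iff_left (by norm_num : (4 : ℤ) ≠ 0)
  push_cast at h
  exact h

/-- Reducing three coordinates from `2 ^ (s + 2)` to `2 ^ s` divides point counts by `64`. -/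
lemma ncard_castHom_triple (s : ℕ) (Q : Set (ZMod (2 ^ s) × ZMod (2 ^ s) × ZMod (2 ^ s))) :
    {v : ZMod (2 ^ (s + 2)) × ZMod (2 ^ (s + 2)) × ZMod (2 ^ (s + 2)) |
      (ZMod.castHom (pow_dvd_pow 2 (Nat.le_add_right s 2)) (ZMod (2 ^ s)) v.1,
       ZMod.castHom (pow_dvd_pow 2 (Nat.le_add_right s 2)) (ZMod (2 ^ s)) v.2.1,
       ZMod.castHom (pow_dvd_pow 2 (Nat.le_add_right s 2)) (ZMod (2 ^ s)) v.2.2) ∈ Q}.ncard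
      = 64 * Q.ncard := by
  set π := (ZMod.castHom (pow_dvd_pow 2 (Nat.le_add_right s 2)) (ZMod (2 ^ s)))
  have hπ : Function.Surjective π := ZMod.castHom_surjective _
  have h := ncard_preimage_mul_card
    (π.toAddMonoidHom.prodMap (π.toAddMonoidHom.prodMap π.toAddMonoidHom))
    (hπ.prodMap (hπ.prodMap hπ)) Q
  simp only [Nat.card_prod, Nat.card_zmod] at h
  have hpos : 0 < 2 ^ s * (2 ^ s * 2 ^ s) := by positivity
  refine Nat.eq_of_mul_eq_mul_right hpos (h.trans ?_)
  ring

lemma ncard_sq_add_self {m : ℕ} {e : ZMod (2 ^ (m + 1))} (he : Even e) :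
    {w : ZMod (2 ^ (m + 1)) | w ^ 2 + w = e}.ncard = 2 := by
  have hinj : Function.Injective fun u : ZMod (2 ^ (m + 1)) => 2 * u ^ 2 + u := by
    intro u v huv
    have hu : IsUnit (2 * (u + v) + 1) := isUnit_of_odd_two_pow ⟨_, rfl⟩
    have : (2 * (u + v) + 1) * (u - v) = 0 := by linear_combination huv
    exact sub_eq_zero.mp ((hu.mul_right_eq_zero).mp this)
  obtain ⟨r, rfl⟩ := he
  obtain ⟨u, rfl⟩ := Finite.surjective_of_injective hinj r
  refine Eq.trans ?_ (Set.ncard_pair (a := 2 * u) (b := -1 - 2 * u) ?_)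
  · congr 1
    ext w
    simp only [Set.mem_ofPred_eq, Set.mem_insert_iff, Set.mem_singleton_iff]
    constructor
    · intro h
      have h0 : (w - 2 * u) * (w + 2 * u + 1) = 0 := by linear_combination h
      obtain ⟨q, hq⟩ | hw := even_or_odd_two_pow w
      · left
        have : IsUnit (w + 2 * u + 1) := isUnit_of_odd_two_pow ⟨q + u, by rw [hq]; ring⟩
        exact sub_eq_zero.mp ((this.mul_left_eq_zero).mp h0)
      · right
        obtain ⟨q, hq⟩ := hw
        have : IsUnit (w - 2 * u) := isUnit_of_odd_two_pow ⟨q - u, by rw [hq]; ring⟩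
        linear_combination (this.mul_right_eq_zero).mp h0
    · rintro (rfl | rfl) <;> ring
  · intro h
    exact not_odd_of_even_two_pow (x := (0 : ZMod (2 ^ (m + 1)))) ⟨0, by simp⟩
      ⟨2 * u, by linear_combination -h⟩

lemma odd_mul_iff_two_pow {m : ℕ} {y z : ZMod (2 ^ (m + 1))} :
    Odd (y * z) ↔ Odd y ∧ Odd z := by
  refine ⟨fun h => ⟨?_, ?_⟩, fun h => h.1.mul h.2⟩
  · exact not_even_iff_odd_two_pow.mp fun hy => not_odd_of_even_two_pow (hy.mul_right z) h
  · exact not_even_iff_odd_two_pow.mp fun hz => not_odd_of_even_two_pow (hz.mul_left y) h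

lemma four_mul_ncard_odd_mul (m : ℕ) :
    4 * {v : ZMod (2 ^ (m + 1)) × ZMod (2 ^ (m + 1)) | Odd (v.1 * v.2)}.ncard
      = 4 ^ (m + 1) := by
  have : {v : ZMod (2 ^ (m + 1)) × ZMod (2 ^ (m + 1)) | Odd (v.1 * v.2)}
      = {x | Odd x} ×ˢ {x | Odd x} := by
    ext v
    simp [odd_mul_iff_two_pow]
  rw [this, Set.ncard_prod]
  have h := two_mul_ncard_odd m
  calc _ = (2 * {x : ZMod (2 ^ (m + 1)) | Odd x}.ncard)
        * (2 * {x : ZMod (2 ^ (m + 1)) | Odd x}.ncard) := by ring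
    _ = _ := by rw [h, ← mul_pow]; norm_num

lemma four_mul_ncard_even_mul (m : ℕ) :
    4 * {v : ZMod (2 ^ (m + 1)) × ZMod (2 ^ (m + 1)) | Even (v.1 * v.2)}.ncard
      = 3 * 4 ^ (m + 1) := by
  have hc : {v : ZMod (2 ^ (m + 1)) × ZMod (2 ^ (m + 1)) | Odd (v.1 * v.2)}ᶜ
      = {v | Even (v.1 * v.2)} := by
    ext v
    simp [← not_even_iff_odd_two_pow]
  have h := Set.ncard_add_ncard_compl
    {v : ZMod (2 ^ (m + 1)) × ZMod (2 ^ (m + 1)) | Odd (v.1 * v.2)}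
  rw [hc, Nat.card_prod, Nat.card_zmod, ← mul_pow] at h
  have h' := four_mul_ncard_odd_mul m
  norm_num at h
  omega

/-- The number of points of `y z - (w ^ 2 + w) = d`, by the fibration over `(y, z)`. -/
lemma ncard_mul_sub_sq_add_self {m : ℕ} (d : ZMod (2 ^ (m + 1))) :
    {v : ZMod (2 ^ (m + 1)) × ZMod (2 ^ (m + 1)) × ZMod (2 ^ (m + 1)) |
      v.2.1 * v.2.2 - (v.1 ^ 2 + v.1) = d}.ncard
      = 2 * {v : ZMod (2 ^ (m + 1)) × ZMod (2 ^ (m + 1)) | Even (v.1 * v.2 - d)}.ncard := by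
  refine ncard_eq_mul_of_fibers Prod.snd _ ?_ ?_
  · rintro ⟨w, y, z⟩ h
    have h' : y * z - (w ^ 2 + w) = d := h
    have h2 : y * z - d = w * (w + 1) := by linear_combination h'
    change Even (y * z - d)
    rw [h2]
    obtain hw | hw := even_or_odd_two_pow w
    · exact hw.mul_right _
    · exact hw.add_one.mul_left _
  · rintro ⟨y, z⟩ h
    refine Eq.trans ?_ ((Set.ncard_image_of_injective _ (Prod.mk_left_injective (y, z))).trans
      (ncard_sq_add_self h))
    congr 1
    ext ⟨w, y', z'⟩
    simp only [Set.mem_ofPred_eq, Set.mem_image, Prod.mk.injEq]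
    constructor
    · rintro ⟨h1, rfl, rfl⟩
      exact ⟨w, by linear_combination -h1, rfl, rfl, rfl⟩
    · rintro ⟨w, h1, rfl, rfl, rfl⟩
      exact ⟨by linear_combination -h1, rfl, rfl⟩

end ZMod

open ZMod

lemma cntG2_eq_ncard (t : ℕ) (n : ℤ) : cntG2 t n =
    {v : ZMod (2 ^ t) × ZMod (2 ^ t) × ZMod (2 ^ t) |
      4 * v.2.1 * v.2.2 - v.1 ^ 2 = (n : ZMod (2 ^ t))}.ncard := rfl

lemma cntG1_eq_ncard (t : ℕ) (n : ℤ) : cntG1 t n =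
    {v : ZMod (2 ^ t) × ZMod (2 ^ t) × ZMod (2 ^ t) |
      v.2.1 * v.2.2 - v.1 ^ 2 = (n : ZMod (2 ^ t))}.ncard := rfl

lemma cntG2_four_mul (s : ℕ) (n : ℤ) : cntG2 (s + 2) (4 * n) = 32 * cntG1 s n := by
  suffices 2 * cntG2 (s + 2) (4 * n) = 64 * cntG1 s n by omega
  rw [cntG2_eq_ncard, cntG1_eq_ncard, ← ncard_castHom_triple,
    ← ncard_two_mul_add (Equiv.refl _) 0]
  · congr 1
    ext ⟨w, y, z⟩
    simp only [Set.mem_ofPred_eq, Equiv.refl_apply]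
    rw [← map_mul, ← map_pow, ← map_sub,
      ← map_intCast (ZMod.castHom (pow_dvd_pow 2 (Nat.le_add_right s 2)) (ZMod (2 ^ s))) n,
      ← four_mul_eq_four_mul_iff]
    push_cast
    constructor <;> intro h <;> linear_combination h
  · rintro ⟨x, y, z⟩ h
    have h' : 4 * y * z - x ^ 2 = ((4 * n : ℤ) : ZMod (2 ^ (s + 2))) := h
    push_cast at h'
    obtain ⟨w, hw⟩ | hx := even_or_odd_two_pow x
    · exact ⟨w, by simp [hw, two_mul]⟩
    · exact (not_odd_of_even_two_pow (m := s + 1) (x := x ^ 2)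
        ⟨2 * (y * z - n), by linear_combination -h'⟩ hx.pow).elim

lemma cntG2_four_mul_add_three (s : ℕ) (c : ℤ) : cntG2 (s + 2) (4 * c + 3) =
    32 * {v : ZMod (2 ^ s) × ZMod (2 ^ s) × ZMod (2 ^ s) |
      v.2.1 * v.2.2 - (v.1 ^ 2 + v.1) = ((c + 1 : ℤ) : ZMod (2 ^ s))}.ncard := by
  suffices 2 * cntG2 (s + 2) (4 * c + 3) = 64 * {v : ZMod (2 ^ s) × ZMod (2 ^ s) × ZMod (2 ^ s) |
      v.2.1 * v.2.2 - (v.1 ^ 2 + v.1) = ((c + 1 : ℤ) : ZMod (2 ^ s))}.ncard by omega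
  rw [cntG2_eq_ncard, ← ncard_castHom_triple, ← ncard_two_mul_add (Equiv.refl _) 1]
  · congr 1
    ext ⟨w, y, z⟩
    simp only [Set.mem_ofPred_eq, Equiv.refl_apply]
    rw [← map_mul, ← map_pow, ← map_add, ← map_sub,
      ← map_intCast (ZMod.castHom (pow_dvd_pow 2 (Nat.le_add_right s 2)) (ZMod (2 ^ s))) (c + 1),
      ← four_mul_eq_four_mul_iff]
    push_cast
    constructor <;> intro h <;> linear_combination h
  · rintro ⟨x, y, z⟩ h
    have h' : 4 * y * z - x ^ 2 = ((4 * c + 3 : ℤ) : ZMod (2 ^ (s + 2))) := h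
    push_cast at h'
    obtain hx | ⟨w, hw⟩ := even_or_odd_two_pow x
    · refine (not_odd_of_even_two_pow (m := s + 1) (x := x ^ 2) (hx.pow_of_ne_zero two_ne_zero)
        ⟨2 * (y * z - c - 1), by linear_combination -h'⟩).elim
    · exact ⟨w, by simp [hw]⟩

/-- Splitting the solutions of `y z - x ^ 2 = n` by the parities of `y` and `z`. -/
lemma four_mul_cntG1 (m : ℕ) (n : ℤ) :
    4 * cntG1 (m + 1) n = 3 * 4 ^ (m + 1) + cntG2 (m + 1) n := by
  set R := ZMod (2 ^ (m + 1))
  set S : Set (R × R × R) := {v | v.2.1 * v.2.2 - v.1 ^ 2 = (n : R)} with hS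
  set Sz : Set (R × R × R) := {v | v ∈ S ∧ Odd v.2.2}
  set Sy : Set (R × R × R) := {v | v ∈ S ∧ Even v.2.2 ∧ Odd v.2.1}
  set Se : Set (R × R × R) := {v | v ∈ S ∧ Even v.2.2 ∧ Even v.2.1}
  have hsplit : S.ncard = Sz.ncard + (Sy.ncard + Se.ncard) := by
    rw [← Set.ncard_union_eq, ← Set.ncard_union_eq]
    · congr 1
      ext v
      have h1 := even_or_odd_two_pow v.2.1
      have h2 := even_or_odd_two_pow v.2.2
      simp only [Sz, Sy, Se, Set.mem_union, Set.mem_ofPred_eq]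
      tauto
    · rw [Set.disjoint_left]
      rintro v ⟨-, h⟩ (⟨-, h', -⟩ | ⟨-, h', -⟩) <;> exact not_odd_of_even_two_pow h' h
    · rw [Set.disjoint_left]
      rintro v ⟨-, -, h⟩ ⟨-, -, h'⟩
      exact not_odd_of_even_two_pow h' h
  have hodd := two_mul_ncard_odd m
  have hpow : (2 : ℕ) ^ (m + 1) * 2 ^ (m + 1) = 4 ^ (m + 1) := by rw [← mul_pow]; norm_num
  have hz : 2 * Sz.ncard = 4 ^ (m + 1) := by
    have : Sz.ncard = 1 * ((Set.univ : Set R) ×ˢ {z : R | Odd z}).ncard := by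
      refine ncard_eq_mul_of_fibers (fun v => (v.1, v.2.2)) _ ?_ ?_
      · rintro v ⟨-, h⟩
        simpa using h
      · rintro ⟨x, z⟩ ⟨-, hz⟩
        obtain ⟨u, rfl⟩ := isUnit_of_odd_two_pow hz
        rw [Set.ncard_eq_one]
        refine ⟨(x, (n + x ^ 2) * ↑u⁻¹, ↑u), ?_⟩
        ext ⟨x', y', z'⟩
        simp only [Sz, hS, Set.mem_ofPred_eq, Set.mem_singleton_iff, Prod.mk.injEq,
          Units.eq_mul_inv_iff_mul_eq]
        constructor
        · rintro ⟨⟨h, -⟩, rfl, rfl⟩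
          exact ⟨rfl, by linear_combination h, rfl⟩
        · rintro ⟨rfl, h, rfl⟩
          exact ⟨⟨by linear_combination h, hz⟩, rfl, rfl⟩
    rw [this, Set.ncard_prod, Set.ncard_univ, Nat.card_zmod]
    linear_combination 2 ^ (m + 1) * hodd + hpow
  have hy : 4 * Sy.ncard = 4 ^ (m + 1) := by
    have : Sy.ncard = 1 * ({x : R | Even (n + x ^ 2)} ×ˢ {y : R | Odd y}).ncard := by
      refine ncard_eq_mul_of_fibers (fun v => (v.1, v.2.1)) _ ?_ ?_
      · rintro ⟨x, y, z⟩ ⟨h, h1, h2⟩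
        refine ⟨?_, h2⟩
        have h' : y * z - x ^ 2 = (n : R) := h
        have h3 : (n : R) + x ^ 2 = y * z := by linear_combination -h'
        change Even ((n : R) + x ^ 2)
        rw [h3]
        exact h1.mul_left y
      · rintro ⟨x, y⟩ ⟨hx, hy⟩
        obtain ⟨u, rfl⟩ := isUnit_of_odd_two_pow hy
        rw [Set.ncard_eq_one]
        refine ⟨(x, ↑u, (n + x ^ 2) * ↑u⁻¹), ?_⟩
        ext ⟨x', y', z'⟩
        simp only [Sy, hS, Set.mem_ofPred_eq, Set.mem_singleton_iff, Prod.mk.injEq]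
        constructor
        · rintro ⟨⟨h, -⟩, rfl, rfl⟩
          exact ⟨rfl, rfl, (Units.eq_mul_inv_iff_mul_eq u).mpr (by linear_combination h)⟩
        · rintro ⟨rfl, rfl, h⟩
          refine ⟨⟨?_, h ▸ Even.mul_right hx _, hy⟩, rfl, rfl⟩
          linear_combination (Units.eq_mul_inv_iff_mul_eq u).mp h
    have hx : 2 * {x : R | Even (n + x ^ 2)}.ncard = 2 ^ (m + 1) := by
      refine Eq.trans ?_ (two_mul_ncard_even m)
      rw [← Set.ncard_image_of_injective {x : R | Even x} (add_left_injective (n : R))]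
      congr 2
      ext x
      have hdiff : Even (x * (x + 1)) := by
        obtain hw | hw := even_or_odd_two_pow x
        · exact hw.mul_right _
        · exact hw.add_one.mul_left _
      simp only [Set.mem_ofPred_eq, Set.mem_image]
      constructor
      · intro h
        refine ⟨x - n, ?_, by ring⟩
        have : x - n = x * (x + 1) - (n + x ^ 2) := by ring
        rw [this]
        exact hdiff.sub h
      · rintro ⟨w, hw, rfl⟩
        have : (n : R) + (w + n) ^ 2 = (w + n) * (w + n + 1) - w := by ring
        rw [this]
        exact hdiff.sub hw
    rw [this, Set.ncard_prod]
    linear_combination 2 * {y : R | Odd y}.ncard * hx + 2 ^ (m + 1) * hodd + hpow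
  have he : 4 * Se.ncard = cntG2 (m + 1) n := by
    let g : R × R × R ≃ R × R × R :=
      { toFun := fun v => (v.2.1, v.1, v.2.2)
        invFun := fun v => (v.2.1, v.1, v.2.2)
        left_inv := fun _ => rfl
        right_inv := fun _ => rfl }
    let g' : R × R × R ≃ R × R × R :=
      { toFun := fun v => (v.2.2, v.2.1, v.1)
        invFun := fun v => (v.2.2, v.2.1, v.1)
        left_inv := fun _ => rfl
        right_inv := fun _ => rfl }
    have h1 := ncard_two_mul_add g 0 Se (by
      rintro c ⟨-, -, w, hw⟩
      exact ⟨w, by simp [g, hw, two_mul]⟩)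
    have h2 := ncard_two_mul_add g' 0 {v | g (2 * v.1 + 0, v.2) ∈ Se} (by
      rintro c ⟨-, ⟨w, hw⟩, -⟩
      refine ⟨w, ?_⟩
      change c.2.2 = _
      rw [add_zero, two_mul]
      exact hw)
    have h3 : 4 * Se.ncard = 2 * (2 * Se.ncard) := by ring
    rw [h3, ← h1, ← h2, cntG2_eq_ncard,
      ← Set.ncard_image_of_injective {v : R × R × R | 4 * v.2.1 * v.2.2 - v.1 ^ 2 = (n : R)}
        (f := fun v => (v.2.2, v.1, v.2.1))
        (by rintro ⟨a, b, c⟩ ⟨a', b', c'⟩ h; simp_all)]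
    congr 1
    ext ⟨z, x, y⟩
    simp only [g, g', Se, hS, Set.mem_ofPred_eq, Equiv.coe_fn_mk, Set.mem_image, Prod.exists,
      Prod.mk.injEq, add_zero]
    constructor
    · rintro ⟨h, -⟩
      exact ⟨x, y, z, by linear_combination h, rfl, rfl, rfl⟩
    · rintro ⟨x, y, z, h, rfl, rfl, rfl⟩
      exact ⟨by linear_combination h, even_two_mul _, even_two_mul _⟩
  change 4 * S.ncard = _
  omega

lemma cntG2_of_mod_four_eq (s : ℕ) {k : ℤ} (hk : k % 4 = 1 ∨ k % 4 = 2) :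
    cntG2 (s + 2) k = 0 := by
  rw [cntG2_eq_ncard, Set.ncard_eq_zero, Set.eq_empty_iff_forall_notMem]
  rintro ⟨x, y, z⟩ h
  obtain ⟨x, rfl⟩ := ZMod.intCast_surjective x
  obtain ⟨y, rfl⟩ := ZMod.intCast_surjective y
  obtain ⟨z, rfl⟩ := ZMod.intCast_surjective z
  have h' : ((4 * y * z - x ^ 2 : ℤ) : ZMod (2 ^ (s + 2))) = (k : ZMod (2 ^ (s + 2))) := by
    push_cast
    exact h
  rw [ZMod.intCast_eq_intCast_iff_dvd_sub] at h'
  have h4 : (4 : ℤ) ∣ k - (4 * y * z - x ^ 2) :=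
    Dvd.dvd.trans (by push_cast; rw [pow_add]; norm_num) h'
  have hx : x ^ 2 % 4 = 0 ∨ x ^ 2 % 4 = 1 := by
    obtain ⟨r, rfl⟩ | ⟨r, rfl⟩ := Int.even_or_odd x
    · left; ring_nf; omega
    · right; ring_nf; omega
  rw [mul_assoc] at h4
  omega

lemma cntG2_of_mod_eight_eq_three (m : ℕ) {k : ℤ} (hk : k % 8 = 3) :
    cntG2 (m + 3) k = 4 ^ (m + 3) := by
  obtain ⟨j, rfl⟩ : ∃ j, k = 4 * (2 * j) + 3 := ⟨k / 8, by omega⟩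
  rw [cntG2_four_mul_add_three (m + 1), ncard_mul_sub_sq_add_self]
  have h := four_mul_ncard_odd_mul m
  have : {v : ZMod (2 ^ (m + 1)) × ZMod (2 ^ (m + 1)) |
      Even (v.1 * v.2 - ((2 * j + 1 : ℤ) : ZMod (2 ^ (m + 1))))}
      = {v | Odd (v.1 * v.2)} := by
    have ho : Odd ((2 * j + 1 : ℤ) : ZMod (2 ^ (m + 1))) := ⟨j, by push_cast; ring⟩
    ext v
    simp only [Set.mem_ofPred_eq]
    exact ⟨fun h => by simpa using h.add_odd ho, fun h => h.sub_odd ho⟩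
  rw [this, pow_succ 4 (m + 2), pow_succ 4 (m + 1)]
  omega

lemma cntG2_of_mod_eight_eq_seven (m : ℕ) {k : ℤ} (hk : k % 8 = 7) :
    cntG2 (m + 3) k = 3 * 4 ^ (m + 3) := by
  obtain ⟨j, rfl⟩ : ∃ j, k = 4 * (2 * j + 1) + 3 := ⟨k / 8, by omega⟩
  rw [cntG2_four_mul_add_three (m + 1), ncard_mul_sub_sq_add_self]
  have h := four_mul_ncard_even_mul m
  have : {v : ZMod (2 ^ (m + 1)) × ZMod (2 ^ (m + 1)) |
      Even (v.1 * v.2 - ((2 * j + 1 + 1 : ℤ) : ZMod (2 ^ (m + 1))))}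
      = {v | Even (v.1 * v.2)} := by
    have he : Even ((2 * j + 1 + 1 : ℤ) : ZMod (2 ^ (m + 1))) := ⟨j + 1, by push_cast; ring⟩
    ext v
    simp only [Set.mem_ofPred_eq]
    exact ⟨fun h => by simpa using h.add he, fun h => h.sub he⟩
  rw [this, pow_succ 4 (m + 2), pow_succ 4 (m + 1)]
  omega

/-- Multiplying `k` by `4` halves the defect `c` of the density `3 - c`. -/
lemma two_pow_mul_cntG2 {k c : ℤ} (hbase : ∀ m, (cntG2 (m + 3) k : ℤ) = (3 - c) * 4 ^ (m + 3))
    (a m : ℕ) : 2 ^ a * (cntG2 (2 * a + m + 3) (4 ^ a * k) : ℤ)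
      = (3 * 2 ^ a - c) * 4 ^ (2 * a + m + 3) := by
  induction a with
  | zero => simpa using hbase m
  | succ a ih =>
    have h1 := cntG2_four_mul (2 * a + m + 2 + 1) (4 ^ a * k)
    have h2 := four_mul_cntG1 (2 * a + m + 2) (4 ^ a * k)
    have e1 : 2 * (a + 1) + m + 3 = 2 * a + m + 2 + 1 + 2 := by ring
    have e2 : (4 : ℤ) ^ (a + 1) * k = 4 * (4 ^ a * k) := by ring
    rw [e1, e2, h1]
    zify at h2
    push_cast
    linear_combination 16 * 2 ^ a * h2 + 16 * ih

theorem dyadic_count_G2 (n : ℕ) (hn : 0 < n) (a k : ℕ) (hk : n = 4 ^ a * k)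
    (h4 : ¬ (4 ∣ k)) :
    ∃ T : ℕ, ∀ t : ℕ, T ≤ t →
      (k % 8 = 7 → (cntG2 t n : ℤ) = 3 * 2 ^ (2 * t)) ∧
      (k % 8 = 3 → (cntG2 t n : ℤ) = 3 * 2 ^ (2 * t) - 2 ^ (2 * t + 1 - a)) ∧
      (k % 4 = 1 ∨ k % 4 = 2 →
        (cntG2 t n : ℤ) = 3 * 2 ^ (2 * t) - 3 * 2 ^ (2 * t - a)) := by
  refine ⟨2 * a + 3, fun t ht => ?_⟩
  obtain ⟨m, rfl⟩ : ∃ m, t = 2 * a + m + 3 := ⟨t - (2 * a + 3), by omega⟩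
  have hn' : (n : ℤ) = 4 ^ a * (k : ℤ) := by rw [hk]; push_cast; ring
  rw [hn']
  set t := 2 * a + m + 3
  have ha : (2 : ℤ) ^ a ≠ 0 := by positivity
  have h4t : (4 : ℤ) ^ t = 2 ^ (2 * t) := by rw [pow_mul]; norm_num
  have hsub : (2 : ℤ) ^ a * 2 ^ (2 * t - a) = 2 ^ (2 * t) := by
    rw [← pow_add]; congr 1; omega
  have hsucc : (2 : ℤ) ^ (2 * t + 1 - a) = 2 * 2 ^ (2 * t - a) := by
    rw [← pow_succ']; congr 1; omega
  refine ⟨fun h => ?_, fun h => ?_, fun h => ?_⟩ <;> apply mul_left_cancel₀ ha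
  · rw [two_pow_mul_cntG2 (c := 0) (fun m => ?_) a m, h4t]
    · ring
    · rw [cntG2_of_mod_eight_eq_seven m (by omega)]; push_cast; ring
  · rw [two_pow_mul_cntG2 (c := 2) (fun m => ?_) a m, h4t, hsucc]
    · linear_combination 2 * hsub
    · rw [cntG2_of_mod_eight_eq_three m (by omega)]; push_cast; ring
  · rw [two_pow_mul_cntG2 (c := 3) (fun m => ?_) a m, h4t]
    · linear_combination 3 * hsub
    · rw [cntG2_of_mod_four_eq (m + 1) (by omega)]; simp
end
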